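/- arXiv:2511.17002 — 2 statements merged into one kernel-verified Lean document; each statement's English description precedes it below -/
import Mathlib

section
/- Assume f_ρ(β) > 0. Then for every positive solution u of equation (E) in Ω∖{0}, either |x|^β u(x) → 0 as |x| → 0, or u(x)/U_{ρ,β}(x) → 1 as |x| → 0. -/
open MeasureTheory Filter Topology Real RealInnerProductSpace

noncomputable section

/-- The gradient factor `G_τ(x,z,ξ) = z^τ ‖ξ‖^(1-τ) / ‖x‖^(τ+1)`.
For `τ = 0` this equals `‖ξ‖ / ‖x‖`, since `z ^ (0:ℝ) = 1` for real powers. -/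
def Gt {N : ℕ} (τ : ℝ) (x : EuclideanSpace ℝ (Fin N)) (z : ℝ)
    (ξ : EuclideanSpace ℝ (Fin N)) : ℝ :=
  z ^ τ * ‖ξ‖ ^ (1 - τ) / ‖x‖ ^ (τ + 1)

/-- Test functions: `C¹` functions with compact support contained in `Ω \ {0}`. -/
def IsTestFun {N : ℕ} (Ω : Set (EuclideanSpace ℝ (Fin N)))
    (φ : EuclideanSpace ℝ (Fin N) → ℝ) : Prop :=
  ContDiff ℝ 1 φ ∧ HasCompactSupport φ ∧ tsupport φ ⊆ Ω \ {0}

/-- The distributional pairing of equation (E) with a test function `φ`: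
`∫ ∇u·∇φ + (N-2+2ρ) ∫ ((x·∇u)/|x|²) φ - λ ∫ G_τ(x,u,∇u) φ + ∫ |x|^θ u^q φ`. -/
def weakE (N : ℕ) (ρ lam τ θ q : ℝ) (Ω : Set (EuclideanSpace ℝ (Fin N)))
    (u φ : EuclideanSpace ℝ (Fin N) → ℝ) : ℝ :=
  (∫ x in Ω \ {0}, ⟪gradient u x, gradient φ x⟫)
    + ((N : ℝ) - 2 + 2 * ρ) * (∫ x in Ω \ {0}, ⟪x, gradient u x⟫ / ‖x‖ ^ 2 * φ x)
    - lam * (∫ x in Ω \ {0}, Gt τ x (u x) (gradient u x) * φ x)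
    + ∫ x in Ω \ {0}, ‖x‖ ^ θ * u x ^ q * φ x

/-- A positive `C¹` function on `Ω \ {0}`. -/
def PosC1 {N : ℕ} (Ω : Set (EuclideanSpace ℝ (Fin N)))
    (u : EuclideanSpace ℝ (Fin N) → ℝ) : Prop :=
  ContDiffOn ℝ 1 u (Ω \ {0}) ∧ ∀ x ∈ Ω \ {0}, 0 < u x

/-- Positive distributional solution of equation (E) in `Ω \ {0}`. -/
def IsSolutionE (N : ℕ) (ρ lam τ θ q : ℝ) (Ω : Set (EuclideanSpace ℝ (Fin N)))
    (u : EuclideanSpace ℝ (Fin N) → ℝ) : Prop :=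
  PosC1 Ω u ∧ ∀ φ, IsTestFun Ω φ → weakE N ρ lam τ θ q Ω u φ = 0

/-- Positive sub-solution of equation (E) in `Ω \ {0}`. -/
def IsSubSolutionE (N : ℕ) (ρ lam τ θ q : ℝ) (Ω : Set (EuclideanSpace ℝ (Fin N)))
    (u : EuclideanSpace ℝ (Fin N) → ℝ) : Prop :=
  PosC1 Ω u ∧ ∀ φ, IsTestFun Ω φ → (∀ x, 0 ≤ φ x) → weakE N ρ lam τ θ q Ω u φ ≤ 0

/-- Positive super-solution of equation (E) in `Ω \ {0}`. -/
def IsSuperSolutionE (N : ℕ) (ρ lam τ θ q : ℝ) (Ω : Set (EuclideanSpace ℝ (Fin N)))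
    (u : EuclideanSpace ℝ (Fin N) → ℝ) : Prop :=
  PosC1 Ω u ∧ ∀ φ, IsTestFun Ω φ → (∀ x, 0 ≤ φ x) → 0 ≤ weakE N ρ lam τ θ q Ω u φ

/-- `f_ρ(t) = t (t + 2ρ) + λ |t|^(1-τ)`. -/
def fRho (ρ lam τ t : ℝ) : ℝ := t * (t + 2 * ρ) + lam * |t| ^ (1 - τ)

/-- `Υ = ((τ+1)/(2τ)) (λτ)^(1/(τ+1))`. -/
def Upsilon (lam τ : ℝ) : ℝ := ((τ + 1) / (2 * τ)) * (lam * τ) ^ (1 / (τ + 1))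

/-- Case [N₀]: (a) `τ = 0` and `λ ≥ 2ρ`, or (b) `λ > 0`, `τ ∈ (0,1)` and `ρ < Υ`. -/
def CaseN0 (ρ lam τ : ℝ) : Prop :=
  (τ = 0 ∧ 2 * ρ ≤ lam) ∨ (0 < lam ∧ 0 < τ ∧ τ < 1 ∧ ρ < Upsilon lam τ)

/-- Case [N₁]: (a) `τ = 0` and `λ < 2ρ`, or (b) `λ < 0` and `τ ∈ (0,1)`. -/
def CaseN1 (ρ lam τ : ℝ) : Prop :=
  (τ = 0 ∧ lam < 2 * ρ) ∨ (lam < 0 ∧ 0 < τ ∧ τ < 1)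

/-- Case [N₂]: `λ > 0`, `τ ∈ (0,1)` and `ρ ≥ Υ`. -/
def CaseN2 (ρ lam τ : ℝ) : Prop :=
  0 < lam ∧ 0 < τ ∧ τ < 1 ∧ Upsilon lam τ ≤ ρ

/-- `w` is the smallest negative root of `f_ρ` (i.e. `w = ϖ₁`). -/
def IsMinNegRoot (ρ lam τ w : ℝ) : Prop :=
  w < 0 ∧ fRho ρ lam τ w = 0 ∧ ∀ t, t < 0 → fRho ρ lam τ t = 0 → w ≤ t

/-- `w` is the largest negative root of `f_ρ` (i.e. `w = ϖ₂`). -/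
def IsMaxNegRoot (ρ lam τ w : ℝ) : Prop :=
  w < 0 ∧ fRho ρ lam τ w = 0 ∧ ∀ t, t < 0 → fRho ρ lam τ t = 0 → t ≤ w

/-- `Φ_{ϖ₂}(r)`: equal to `r^(-ϖ₂)` if `ρ > Υ` and to `r^(-ϖ₂) |log r|^(2/(1+τ))` if `ρ = Υ`. -/
def Phi2 (ρ lam τ w2 r : ℝ) : ℝ :=
  if ρ = Upsilon lam τ then r ^ (-w2) * |Real.log r| ^ (2 / (1 + τ)) else r ^ (-w2)

/-- `Ψ_{ϖ₁}(t)`: equal to `t^(-ϖ₁)` if `ρ > Υ` and to `t^(-ϖ₁) (log t)^(2/(1+τ))` if `ρ = Υ`. -/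
def Psi1 (ρ lam τ w1 t : ℝ) : ℝ :=
  if ρ = Upsilon lam τ then t ^ (-w1) * (Real.log t) ^ (2 / (1 + τ)) else t ^ (-w1)

/-- The radial operator `L_{ρ,λ,τ}[P](r) = P'' + (1-2ρ) P'/r + λ P^τ |P'|^(1-τ)/r^(1+τ)`. -/
def Lrad (ρ lam τ : ℝ) (P : ℝ → ℝ) (r : ℝ) : ℝ :=
  deriv (deriv P) r + (1 - 2 * ρ) * deriv P r / r
    + lam * P r ^ τ * |deriv P r| ^ (1 - τ) / r ^ (1 + τ)

/-- The Laplacian of `u` at `x`, as the trace of the second derivative. -/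
def lapl {N : ℕ} (u : EuclideanSpace ℝ (Fin N) → ℝ) (x : EuclideanSpace ℝ (Fin N)) : ℝ :=
  ∑ i : Fin N, iteratedFDeriv ℝ 2 u x ![EuclideanSpace.single i 1, EuclideanSpace.single i 1]

/-- A `C¹` function `w` has the continuous function `h` as its weak Laplacian on `D`. -/
structure HasWeakLaplacianOn {N : ℕ} (w h : EuclideanSpace ℝ (Fin N) → ℝ)
    (D : Set (EuclideanSpace ℝ (Fin N))) : Prop where
  contDiffOn : ContDiffOn ℝ 1 w D
  continuousOn : ContinuousOn h D
  integral_eq : ∀ η : EuclideanSpace ℝ (Fin N) → ℝ, ContDiff ℝ 1 η → HasCompactSupport η →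
    tsupport η ⊆ D → ∫ x, ⟪gradient w x, gradient η x⟫ = -∫ x, h x * η x

section WeakLaplacian

variable {N : ℕ} {D : Set (EuclideanSpace ℝ (Fin N))} {w h : EuclideanSpace ℝ (Fin N) → ℝ}

theorem hasGradientAt_of_contDiffOn (hD : IsOpen D) (hw : ContDiffOn ℝ 1 w D)
    {x : EuclideanSpace ℝ (Fin N)} (hx : x ∈ D) : HasGradientAt w (gradient w x) x :=
  ((hw.differentiableOn one_ne_zero).differentiableAt (hD.mem_nhds hx)).hasGradientAt

theorem continuousOn_gradient (hD : IsOpen D) (hw : ContDiffOn ℝ 1 w D) :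
    ContinuousOn (gradient w) D :=
  (InnerProductSpace.toDual ℝ (EuclideanSpace ℝ (Fin N))).symm.continuous.comp_continuousOn
    (hw.continuousOn_fderiv_of_isOpen hD le_rfl)

theorem gradient_eq_zero_of_notMem_tsupport {η : EuclideanSpace ℝ (Fin N) → ℝ}
    {x : EuclideanSpace ℝ (Fin N)} (hx : x ∉ tsupport η) : gradient η x = 0 := by
  have : fderiv ℝ η x = 0 := by
    by_contra hne
    exact hx (support_fderiv_subset ℝ hne)
  simp [gradient, this]

theorem integrable_mul_of_tsupport_subset (hD : IsOpen D) (hh : ContinuousOn h D)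
    {η : EuclideanSpace ℝ (Fin N) → ℝ} (hη : Continuous η) (hc : HasCompactSupport η)
    (hs : tsupport η ⊆ D) : Continuous (fun x => h x * η x) ∧ HasCompactSupport (fun x => h x * η x)
      ∧ Integrable (fun x => h x * η x) := by
  have h1 : HasCompactSupport (fun x => h x * η x) := hc.mul_left
  have h2 : Continuous (fun x => h x * η x) := by
    refine continuous_of_tsupport fun x hx => ?_
    have hxD : x ∈ D := hs (tsupport_mul_subset_right hx)
    exact (hh.continuousAt (hD.mem_nhds hxD)).mul hη.continuousAt
  exact ⟨h2, h1, h2.integrable_of_hasCompactSupport h1⟩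

theorem integrable_inner_gradient (hD : IsOpen D) {V : EuclideanSpace ℝ (Fin N) →
    EuclideanSpace ℝ (Fin N)} (hV : ContinuousOn V D)
    {η : EuclideanSpace ℝ (Fin N) → ℝ} (hη : ContDiff ℝ 1 η) (hc : HasCompactSupport η)
    (hs : tsupport η ⊆ D) : Integrable (fun x => ⟪V x, gradient η x⟫) := by
  have hsub : Function.support (fun x => ⟪V x, gradient η x⟫) ⊆ tsupport η := by
    intro x hx
    by_contra hne
    exact hx (by simp [gradient_eq_zero_of_notMem_tsupport hne])
  have h1 : HasCompactSupport (fun x => ⟪V x, gradient η x⟫) :=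
    HasCompactSupport.of_support_subset_isCompact hc hsub
  have h2 : Continuous (fun x => ⟪V x, gradient η x⟫) := by
    refine continuous_of_tsupport fun x hx => ?_
    have hxD : x ∈ D := hs (closure_minimal hsub (isClosed_tsupport η) hx)
    have hg : ContinuousOn (gradient η) Set.univ := continuousOn_gradient isOpen_univ hη.contDiffOn
    exact (hV.continuousAt (hD.mem_nhds hxD)).inner ((continuousOn_univ.1 hg).continuousAt)
  exact h2.integrable_of_hasCompactSupport h1

namespace HasWeakLaplacianOn

variable {w₁ w₂ h₁ h₂ : EuclideanSpace ℝ (Fin N) → ℝ}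

theorem mono (hw : HasWeakLaplacianOn w h D) {D' : Set (EuclideanSpace ℝ (Fin N))}
    (hsub : D' ⊆ D) : HasWeakLaplacianOn w h D' :=
  ⟨hw.contDiffOn.mono hsub, hw.continuousOn.mono hsub,
    fun η h1 h2 h3 => hw.integral_eq η h1 h2 (h3.trans hsub)⟩

theorem sub (hD : IsOpen D) (hw₁ : HasWeakLaplacianOn w₁ h₁ D)
    (hw₂ : HasWeakLaplacianOn w₂ h₂ D) :
    HasWeakLaplacianOn (fun x => w₁ x - w₂ x) (fun x => h₁ x - h₂ x) D := by
  refine ⟨hw₁.contDiffOn.sub hw₂.contDiffOn, hw₁.continuousOn.sub hw₂.continuousOn,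
    fun η hη hc hs => ?_⟩
  have hgrad : ∀ x, ⟪gradient (fun x => w₁ x - w₂ x) x, gradient η x⟫
      = ⟪gradient w₁ x, gradient η x⟫ - ⟪gradient w₂ x, gradient η x⟫ := by
    intro x
    by_cases hx : x ∈ tsupport η
    · have h1 := hasGradientAt_of_contDiffOn hD hw₁.contDiffOn (hs hx)
      have h2 := hasGradientAt_of_contDiffOn hD hw₂.contDiffOn (hs hx)
      have h3 : HasGradientAt (fun x => w₁ x - w₂ x) (gradient w₁ x - gradient w₂ x) x := by
        rw [hasGradientAt_iff_hasFDerivAt] at h1 h2 ⊢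
        rw [map_sub]
        exact h1.sub h2
      rw [h3.gradient, inner_sub_left]
    · simp [gradient_eq_zero_of_notMem_tsupport hx]
  simp_rw [hgrad, sub_mul]
  rw [integral_sub (integrable_inner_gradient hD (continuousOn_gradient hD hw₁.contDiffOn) hη hc hs)
    (integrable_inner_gradient hD (continuousOn_gradient hD hw₂.contDiffOn) hη hc hs),
    integral_sub (integrable_mul_of_tsupport_subset hD hw₁.continuousOn hη.continuous hc hs).2.2
      (integrable_mul_of_tsupport_subset hD hw₂.continuousOn hη.continuous hc hs).2.2,
    hw₁.integral_eq η hη hc hs, hw₂.integral_eq η hη hc hs]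
  ring

theorem of_hasFDerivAt_gradient (hD : IsOpen D)
    {V : EuclideanSpace ℝ (Fin N) → EuclideanSpace ℝ (Fin N)}
    {V' : EuclideanSpace ℝ (Fin N) → EuclideanSpace ℝ (Fin N) →L[ℝ] EuclideanSpace ℝ (Fin N)}
    (hw : ∀ x ∈ D, HasGradientAt w (V x) x) (hV : ∀ x ∈ D, HasFDerivAt V (V' x) x)
    (hV' : ∀ i, ContinuousOn (fun x => V' x (EuclideanSpace.single i 1) i) D)
    (hh : ∀ x ∈ D, h x = ∑ i, V' x (EuclideanSpace.single i 1) i) :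
    HasWeakLaplacianOn w h D := by
  have hVc : ContinuousOn V D := fun x hx => (hV x hx).continuousAt.continuousWithinAt
  have hhc : ContinuousOn h D :=
    (continuousOn_finsetSum Finset.univ fun i _ => hV' i).congr hh
  have hw1 : ContDiffOn ℝ 1 w D := by
    rw [show (1 : WithTop ℕ∞) = 0 + 1 from rfl, contDiffOn_succ_iff_fderiv_of_isOpen hD]
    refine ⟨fun x hx => (hw x hx).differentiableAt.differentiableWithinAt, by simp, ?_⟩
    refine contDiffOn_zero.2 ?_
    refine ((InnerProductSpace.toDual ℝ _).continuous.comp_continuousOn hVc).congr fun x hx => ?_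
    exact (hasGradientAt_iff_hasFDerivAt.1 (hw x hx)).fderiv
  refine ⟨hw1, hhc, fun η hη hc hs => ?_⟩
  have key : ∀ i : Fin N, Integrable (fun x => V x i * fderiv ℝ η x (EuclideanSpace.single i 1)) ∧
      Integrable (fun x => V' x (EuclideanSpace.single i 1) i * η x) ∧
      ∫ x, V x i * fderiv ℝ η x (EuclideanSpace.single i 1)
        = -∫ x, V' x (EuclideanSpace.single i 1) i * η x := by
    intro i
    have hVi : ContinuousOn (fun x => V x i) D := by fun_prop
    have hd : ∀ x ∈ D, HasFDerivAt (fun x => V x i) ((EuclideanSpace.proj i).comp (V' x)) x :=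
      fun x hx => (EuclideanSpace.proj i : EuclideanSpace ℝ (Fin N) →L[ℝ] ℝ).hasFDerivAt.comp x (hV x hx)
    have hη' : Continuous (fun x => fderiv ℝ η x (EuclideanSpace.single i 1)) :=
      (hη.continuous_fderiv one_ne_zero).clm_apply continuous_const
    have hs' : tsupport (fun x => fderiv ℝ η x (EuclideanSpace.single i (1 : ℝ))) ⊆ tsupport η :=
      tsupport_fderiv_apply_subset ℝ _
    have hc' : HasCompactSupport (fun x => fderiv ℝ η x (EuclideanSpace.single i (1 : ℝ))) :=
      hc.fderiv_apply ℝ _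
    have i1 := (integrable_mul_of_tsupport_subset hD hVi hη' hc' (hs'.trans hs)).2.2
    have i2 := (integrable_mul_of_tsupport_subset hD (hV' i) hη.continuous hc hs).2.2
    have i3 := (integrable_mul_of_tsupport_subset hD hVi hη.continuous hc hs).2.2
    have heq : (fun x => fderiv ℝ (fun x => V x i) x (EuclideanSpace.single i 1) * η x)
        = fun x => V' x (EuclideanSpace.single i 1) i * η x := by
      funext x
      by_cases hx : x ∈ tsupport η
      · rw [(hd x (hs hx)).fderiv]; rfl
      · simp [image_eq_zero_of_notMem_tsupport hx]
    refine ⟨i1, i2, ?_⟩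
    have := integral_mul_fderiv_eq_neg_fderiv_mul_of_integrable (μ := volume)
      (f := fun x => V x i) (g := η) (v := EuclideanSpace.single i 1) (heq ▸ i2) i1 i3
      (fun x hx => (hd x (hs hx)).differentiableAt)
      (fun x _ => (hη.differentiable one_ne_zero).differentiableAt)
    rw [this]
    exact congrArg Neg.neg (congrArg (integral volume) heq)
  have e1 : ∀ x, ⟪gradient w x, gradient η x⟫
      = ∑ i, V x i * fderiv ℝ η x (EuclideanSpace.single i 1) := by
    intro x
    by_cases hx : x ∈ tsupport η
    · rw [(hw x (hs hx)).gradient, real_inner_comm, inner_gradient_left]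
      conv_lhs => rw [← (EuclideanSpace.basisFun (Fin N) ℝ).sum_repr (V x)]
      simp [map_sum]
    · have : fderiv ℝ η x = 0 := by
        by_contra hne
        exact hx (support_fderiv_subset ℝ hne)
      simp [gradient_eq_zero_of_notMem_tsupport hx, this]
  have e2 : ∀ x, h x * η x = ∑ i, V' x (EuclideanSpace.single i 1) i * η x := by
    intro x
    by_cases hx : x ∈ tsupport η
    · rw [hh x (hs hx), Finset.sum_mul]
    · simp [image_eq_zero_of_notMem_tsupport hx]
  simp_rw [e1, e2]
  rw [integral_finsetSum _ fun i _ => (key i).1, integral_finsetSum _ fun i _ => (key i).2.1,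
    ← Finset.sum_neg_distrib]
  exact Finset.sum_congr rfl fun i _ => (key i).2.2

/-- The Laplacian of `x ↦ P (‖x - y‖²)`. -/
theorem comp_norm_sq {P P' P'' : ℝ → ℝ} {I : Set ℝ} (hI : IsOpen I)
    (y : EuclideanSpace ℝ (Fin N))
    (hP : ∀ s ∈ I, HasDerivAt P (P' s) s) (hP' : ∀ s ∈ I, HasDerivAt P' (P'' s) s)
    (hP'' : ContinuousOn P'' I) :
    HasWeakLaplacianOn (fun x => P (‖x - y‖ ^ 2))
      (fun x => 4 * ‖x - y‖ ^ 2 * P'' (‖x - y‖ ^ 2) + 2 * N * P' (‖x - y‖ ^ 2))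
      {x | ‖x - y‖ ^ 2 ∈ I} ∧ ∀ x, ‖x - y‖ ^ 2 ∈ I →
        HasGradientAt (fun x => P (‖x - y‖ ^ 2)) ((2 * P' (‖x - y‖ ^ 2)) • (x - y)) x := by
  have hcont : Continuous fun x : EuclideanSpace ℝ (Fin N) => ‖x - y‖ ^ 2 := by fun_prop
  have hD : IsOpen {x : EuclideanSpace ℝ (Fin N) | ‖x - y‖ ^ 2 ∈ I} := hI.preimage hcont
  have hs : ∀ x : EuclideanSpace ℝ (Fin N),
      HasFDerivAt (fun x => ‖x - y‖ ^ 2) (2 • innerSL ℝ (x - y)) x := by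
    intro x
    simpa using ((hasFDerivAt_id x).sub_const y).norm_sq
  have hgrad : ∀ x, ‖x - y‖ ^ 2 ∈ I →
      HasGradientAt (fun x => P (‖x - y‖ ^ 2)) ((2 * P' (‖x - y‖ ^ 2)) • (x - y)) x := by
    intro x hx
    rw [hasGradientAt_iff_hasFDerivAt]
    refine ((hP _ hx).comp_hasFDerivAt x (hs x)).congr_fderiv ?_
    ext z
    simp
    ring
  have hP'c : ContinuousOn P' I := fun s hs => (hP' s hs).continuousAt.continuousWithinAt
  have hc1 : ContinuousOn (fun x : EuclideanSpace ℝ (Fin N) => P' (‖x - y‖ ^ 2))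
      {x | ‖x - y‖ ^ 2 ∈ I} := hP'c.comp hcont.continuousOn fun x hx => hx
  have hc2 : ContinuousOn (fun x : EuclideanSpace ℝ (Fin N) => P'' (‖x - y‖ ^ 2))
      {x | ‖x - y‖ ^ 2 ∈ I} := hP''.comp hcont.continuousOn fun x hx => hx
  refine ⟨of_hasFDerivAt_gradient hD
    (V' := fun x => (2 * P' (‖x - y‖ ^ 2)) • ContinuousLinearMap.id ℝ _ +
      ((2 * P'' (‖x - y‖ ^ 2)) • (2 • innerSL ℝ (x - y))).smulRight (x - y))
    hgrad ?_ ?_ ?_, hgrad⟩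
  · intro x hx
    have h1 := (((hP' _ hx).comp_hasFDerivAt x (hs x)).const_mul 2).smul
      ((hasFDerivAt_id x).sub_const y)
    refine h1.congr_fderiv ?_
    ext z i
    simp only [Function.comp_apply, id_eq, add_apply, smul_apply,
      ContinuousLinearMap.smulRight_apply, PiLp.add_apply, PiLp.smul_apply, smul_eq_mul,
      ContinuousLinearMap.coe_id', two_smul]
    ring
  · intro i
    simp [EuclideanSpace.inner_single_right]
    have hi : Continuous fun x : EuclideanSpace ℝ (Fin N) => x i := by fun_prop
    exact (hc1.const_mul 2).add
      (((hc2.const_mul 2).mul (by fun_prop)).mul (by fun_prop))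
  · intro x hx
    have hN : ∑ i : Fin N, (x - y) i * (x - y) i = ‖x - y‖ ^ 2 := by
      rw [EuclideanSpace.norm_sq_eq]
      exact Finset.sum_congr rfl fun i _ => by rw [Real.norm_eq_abs, sq_abs, sq]
    set s := ‖x - y‖ ^ 2
    rw [show 4 * s * P'' s = 4 * P'' s * s by ring, ← hN]
    simp [EuclideanSpace.inner_single_right, Finset.sum_add_distrib, Finset.mul_sum]
    rw [add_comm]
    congr 1
    · ring
    · refine Finset.sum_congr rfl fun i _ => ?_
      ring

/-- The Laplacian of a quadratic polynomial in `‖x - y‖` and `⟪x - y, e⟫`. -/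
theorem quadratic (y e : EuclideanSpace ℝ (Fin N)) (he : ‖e‖ = 1) (a b c : ℝ) :
    HasWeakLaplacianOn
      (fun x => a * ‖x - y‖ ^ 2 + b * ⟪x - y, e⟫ + c * ⟪x - y, e⟫ ^ 2)
      (fun _ => 2 * a * N + 2 * c) Set.univ := by
  have hs : ∀ x : EuclideanSpace ℝ (Fin N),
      HasFDerivAt (fun x => ‖x - y‖ ^ 2) (2 • innerSL ℝ (x - y)) x := by
    intro x
    simpa using ((hasFDerivAt_id x).sub_const y).norm_sq
  have hl : ∀ x : EuclideanSpace ℝ (Fin N), HasFDerivAt (fun x => ⟪x - y, e⟫) (innerSL ℝ e) x := by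
    intro x
    have h1 := (innerSL ℝ e).hasFDerivAt.comp x ((hasFDerivAt_id x).sub_const y)
    refine (h1.congr_fderiv (by ext; simp)).congr_of_eventuallyEq (Eventually.of_forall fun z => ?_)
    simp [real_inner_comm]
  refine of_hasFDerivAt_gradient isOpen_univ
    (V := fun x => (2 * a) • (x - y) + (b + 2 * c * ⟪x - y, e⟫) • e)
    (V' := fun x => (2 * a) • ContinuousLinearMap.id ℝ _ +
      ((2 * c) • innerSL ℝ e).smulRight e) ?_ ?_ ?_ ?_
  · intro x _
    rw [hasGradientAt_iff_hasFDerivAt]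
    refine ((((hs x).const_mul a).add ((hl x).const_mul b)).add
      (((hl x).pow 2).const_mul c)).congr_fderiv ?_
    ext z
    simp
    ring
  · intro x _
    refine ((((hasFDerivAt_id x).sub_const y).const_smul (2 * a)).add
      ((((hl x).const_mul (2 * c)).const_add b).smul_const e)).congr_fderiv ?_
    ext z i
    simp
  · intro i
    exact continuousOn_const
  · intro x _
    have hN : ∑ i : Fin N, e i * e i = 1 := by
      have := EuclideanSpace.norm_sq_eq e
      rw [he] at this
      simp only [Real.norm_eq_abs, sq_abs] at this
      simp only [← sq]; linarith
    simp [EuclideanSpace.inner_single_right, Finset.sum_add_distrib, mul_assoc, ← Finset.mul_sum, hN]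
    ring

theorem comp_isometry (hD : IsOpen D) (hw : HasWeakLaplacianOn w h D)
    (R : EuclideanSpace ℝ (Fin N) ≃ₗᵢ[ℝ] EuclideanSpace ℝ (Fin N))
    (c : EuclideanSpace ℝ (Fin N)) :
    HasWeakLaplacianOn (fun x => w (R x + c)) (fun x => h (R x + c)) {x | R x + c ∈ D} := by
  have hcont : Continuous fun x => R x + c := by fun_prop
  have hsm : ContDiff ℝ 1 fun x => R x + c := by fun_prop
  refine ⟨hw.contDiffOn.comp hsm.contDiffOn fun x hx => hx,
    hw.continuousOn.comp hcont.continuousOn fun x hx => hx, fun η hη hc hs => ?_⟩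
  set S : EuclideanSpace ℝ (Fin N) ≃ₜ EuclideanSpace ℝ (Fin N) :=
    R.toHomeomorph.trans (Homeomorph.addRight c) with hS
  have hSa : ∀ x, S x = R x + c := fun x => rfl
  have hSs : ∀ x, S.symm x = R.symm (x - c) := fun x => by
    rw [Homeomorph.symm_apply_eq, hSa]
    simp
  have hmp : MeasurePreserving (fun x => R x + c) volume volume :=
    (measurePreserving_add_right volume c).comp R.measurePreserving
  have hme : MeasurableEmbedding (fun x => R x + c) := S.measurableEmbedding
  set ζ : EuclideanSpace ℝ (Fin N) → ℝ := fun x => η (S.symm x) with hζ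
  have hζ1 : ContDiff ℝ 1 ζ := by
    simp only [hζ, hSs]
    fun_prop
  have hζη : ∀ x, ζ (R x + c) = η x := fun x => by rw [← hSa]; simp [hζ]
  have hζ2 : HasCompactSupport ζ := hc.comp_homeomorph S.symm
  have hζ3 : tsupport ζ ⊆ D := by
    intro x hx
    have h1 : S.symm x ∈ tsupport η := tsupport_comp_subset_preimage η S.symm.continuous hx
    have h2 := hs h1
    simpa [← hSa] using h2
  have h1 := hw.integral_eq ζ hζ1 hζ2 hζ3
  rw [← hmp.integral_comp hme, ← hmp.integral_comp hme (fun x => h x * ζ x)] at h1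
  simp only [hζη] at h1
  rw [← h1]
  refine integral_congr_ae (Eventually.of_forall fun x => ?_)
  by_cases hx : x ∈ tsupport η
  · have hxD : R x + c ∈ D := hs hx
    have hRd : HasFDerivAt (fun x => R x + c)
        (R : EuclideanSpace ℝ (Fin N) →L[ℝ] EuclideanSpace ℝ (Fin N)) x :=
      (R : EuclideanSpace ℝ (Fin N) →L[ℝ] EuclideanSpace ℝ (Fin N)).hasFDerivAt.add_const c
    have key : ∀ f : EuclideanSpace ℝ (Fin N) → ℝ, HasGradientAt f (gradient f (R x + c)) (R x + c) →
        gradient (fun x => f (R x + c)) x = R.symm (gradient f (R x + c)) := by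
      intro f hf
      refine HasGradientAt.gradient ?_
      rw [hasGradientAt_iff_hasFDerivAt] at hf ⊢
      refine (hf.comp x hRd).congr_fderiv ?_
      ext z
      have := R.inner_map_map (R.symm (gradient f (R x + c))) z
      rw [LinearIsometryEquiv.apply_symm_apply] at this
      simpa using this
    have e1 := key w (hasGradientAt_of_contDiffOn hD hw.contDiffOn hxD)
    have e2 := key ζ (hasGradientAt_of_contDiffOn isOpen_univ hζ1.contDiffOn (Set.mem_univ _))
    rw [show (fun x => ζ (R x + c)) = η from funext hζη] at e2
    beta_reduce
    rw [e1, e2,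
      LinearIsometryEquiv.inner_map_map]
  · have hx' : R x + c ∉ tsupport ζ := by
      intro hmem
      have h1 : S.symm (S x) ∈ tsupport η :=
        tsupport_comp_subset_preimage η S.symm.continuous hmem
      exact hx (by simpa using h1)
    simp [gradient_eq_zero_of_notMem_tsupport hx, gradient_eq_zero_of_notMem_tsupport hx']

end HasWeakLaplacianOn

end WeakLaplacian

namespace HasWeakLaplacianOn

variable {N : ℕ} {D : Set (EuclideanSpace ℝ (Fin N))} {w h : EuclideanSpace ℝ (Fin N) → ℝ}

theorem neg (hD : IsOpen D) (hw : HasWeakLaplacianOn w h D) :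
    HasWeakLaplacianOn (fun x => -w x) (fun x => -h x) D := by
  have h0 : HasWeakLaplacianOn (fun _ : EuclideanSpace ℝ (Fin N) => (0 : ℝ)) (fun _ => 0) D := by
    refine ⟨contDiffOn_const, continuousOn_const, fun η _ _ _ => ?_⟩
    simp [gradient_fun_const]
  simpa using h0.sub hD hw

/-- A function with positive weak Laplacian does not have a local maximum. -/
theorem nonpos_of_isLocalMax (hD : IsOpen D) (hw : HasWeakLaplacianOn w h D)
    {x₀ : EuclideanSpace ℝ (Fin N)} (hx₀ : x₀ ∈ D) (hmax : IsLocalMax w x₀) : h x₀ ≤ 0 := by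
  by_contra! hpos
  set δ : ℝ := h x₀ / (4 * (N + 1)) with hδ
  have hN1 : (0 : ℝ) < N + 1 := by positivity
  have hδ0 : 0 < δ := by positivity
  have hquad : HasWeakLaplacianOn (fun x => δ * ‖x - x₀‖ ^ 2) (fun _ => 2 * N * δ) D := by
    have := (comp_norm_sq (P := fun s => δ * s) (P' := fun _ => δ) (P'' := fun _ => 0)
      isOpen_univ x₀ (fun s _ => by simpa using (hasDerivAt_id s).const_mul δ)
      (fun s _ => hasDerivAt_const s δ) continuousOn_const).1
    simpa using this.mono (Set.subset_univ D)
  have hv := hw.sub hD hquad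
  set v : EuclideanSpace ℝ (Fin N) → ℝ := fun x => w x - δ * ‖x - x₀‖ ^ 2 with hvdef
  set k : EuclideanSpace ℝ (Fin N) → ℝ := fun x => h x - 2 * N * δ with hkdef
  have hk0 : 0 < k x₀ := by
    have h1 : 4 * (N + 1) * δ = h x₀ := by rw [hδ]; field_simp
    have : 0 ≤ (N : ℝ) * δ := by positivity
    simp only [hkdef]
    nlinarith
  have hev : ∀ᶠ x in 𝓝 x₀, x ∈ D ∧ 0 < k x ∧ w x ≤ w x₀ :=
    (hD.eventually_mem hx₀).and (((hv.continuousOn.continuousAt (hD.mem_nhds hx₀)).eventually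
      (lt_mem_nhds hk0)).and hmax)
  obtain ⟨r, hr0, hr⟩ := Metric.eventually_nhds_iff_ball.1 hev
  set c : ℝ := w x₀ - δ * (r / 2) ^ 2 with hc
  set η : EuclideanSpace ℝ (Fin N) → ℝ :=
    (Metric.ball x₀ r).indicator fun x => smoothTransition (v x - c) with hη
  have hfar : ∀ x ∈ Metric.ball x₀ r, r / 2 ≤ ‖x - x₀‖ → smoothTransition (v x - c) = 0 := by
    intro x hx hxr
    refine smoothTransition.zero_of_nonpos ?_
    have h1 := (hr x hx).2.2
    have h2 : (r / 2) ^ 2 ≤ ‖x - x₀‖ ^ 2 := by gcongr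
    simp only [hvdef, hc]
    nlinarith
  have hsupp : tsupport η ⊆ Metric.closedBall x₀ (r / 2) := by
    refine closure_minimal (fun x hx => ?_) Metric.isClosed_closedBall
    by_contra hne
    have hne' : r / 2 < ‖x - x₀‖ := by simpa [dist_eq_norm] using hne
    refine hx ?_
    by_cases hxb : x ∈ Metric.ball x₀ r
    · rw [hη, Set.indicator_of_mem hxb]
      exact hfar x hxb hne'.le
    · rw [hη, Set.indicator_of_notMem hxb]
  have hcb : Metric.closedBall x₀ (r / 2) ⊆ Metric.ball x₀ r :=
    Metric.closedBall_subset_ball (by linarith)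
  have hbD : Metric.ball x₀ r ⊆ D := fun x hx => (hr x hx).1
  have heq : ∀ x ∈ Metric.ball x₀ r, η =ᶠ[𝓝 x] fun x => smoothTransition (v x - c) := by
    intro x hx
    filter_upwards [Metric.isOpen_ball.mem_nhds hx] with z hz
    rw [hη, Set.indicator_of_mem hz]
  have hη1 : ContDiff ℝ 1 η := by
    rw [contDiff_iff_contDiffAt]
    intro x
    by_cases hx : x ∈ Metric.ball x₀ r
    · refine ContDiffAt.congr_of_eventuallyEq ?_ (heq x hx)
      exact (smoothTransition.contDiffAt (n := 1)).comp x
        ((hv.contDiffOn.contDiffAt (hD.mem_nhds (hbD hx))).sub contDiffAt_const)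
    · have hx' : x ∉ tsupport η := fun hmem => hx (hcb (hsupp hmem))
      exact contDiffAt_const.congr_of_eventuallyEq (notMem_tsupport_iff_eventuallyEq.1 hx')
  have hη2 : HasCompactSupport η :=
    HasCompactSupport.of_support_subset_isCompact (isCompact_closedBall x₀ (r / 2))
      ((subset_tsupport η).trans hsupp)
  have hη3 : tsupport η ⊆ D := hsupp.trans (hcb.trans hbD)
  have hint := hv.integral_eq η hη1 hη2 hη3
  have hleft : 0 ≤ ∫ x, ⟪gradient v x, gradient η x⟫ := by
    refine integral_nonneg fun x => ?_
    by_cases hx : x ∈ Metric.ball x₀ r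
    · have hg : HasGradientAt η (deriv smoothTransition (v x - c) • gradient v x) x := by
        refine HasGradientAt.congr_of_eventuallyEq ?_ (heq x hx)
        have h1 := hasGradientAt_of_contDiffOn hD hv.contDiffOn (hbD hx)
        rw [hasGradientAt_iff_hasFDerivAt] at h1 ⊢
        have h2 : HasDerivAt smoothTransition (deriv smoothTransition (v x - c)) (v x - c) :=
          ((smoothTransition.contDiff (n := 1)).differentiable (by simp)).differentiableAt.hasDerivAt
        refine (h2.comp_hasFDerivAt x (h1.sub_const c)).congr_fderiv ?_
        ext z
        simp
      simp only [Pi.zero_apply]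
      rw [hg.gradient, inner_smul_right]
      exact mul_nonneg smoothTransition.monotone.deriv_nonneg real_inner_self_nonneg
    · have hx' : x ∉ tsupport η := fun hmem => hx (hcb (hsupp hmem))
      simp [gradient_eq_zero_of_notMem_tsupport hx']
  obtain ⟨c1, c2, -⟩ := integrable_mul_of_tsupport_subset hD hv.continuousOn hη1.continuous hη2 hη3
  have hright : 0 < ∫ x, k x * η x := by
    refine c1.integral_pos_of_hasCompactSupport_nonneg_nonzero (x := x₀) c2 ?_ ?_
    · intro x
      by_cases hx : x ∈ Metric.ball x₀ r
      · simp only [hη, Set.indicator_of_mem hx, Pi.zero_apply]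
        exact mul_nonneg (hr x hx).2.1.le (smoothTransition.nonneg _)
      · simp [hη, Set.indicator_of_notMem hx]
    · have hxm : x₀ ∈ Metric.ball x₀ r := Metric.mem_ball_self hr0
      have : 0 < smoothTransition (v x₀ - c) := by
        refine smoothTransition.pos_of_pos ?_
        simp only [hvdef, hc, sub_self, norm_zero]
        have : 0 < δ * (r / 2) ^ 2 := by positivity
        linarith
      simp only [hη, Set.indicator_of_mem hxm]
      exact (mul_pos hk0 this).ne'
  linarith

theorem nonneg_of_isLocalMin (hD : IsOpen D) (hw : HasWeakLaplacianOn w h D)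
    {x₀ : EuclideanSpace ℝ (Fin N)} (hx₀ : x₀ ∈ D) (hmin : IsLocalMin w x₀) : 0 ≤ h x₀ := by
  have := (hw.neg hD).nonpos_of_isLocalMax hD hx₀ hmin.neg
  linarith

/-- Interior gradient estimate for the Poisson equation. -/
theorem norm_gradient_le (hD : IsOpen D) (hw : HasWeakLaplacianOn w h D)
    {x₀ : EuclideanSpace ℝ (Fin N)} {d M K : ℝ} (hd : 0 < d)
    (hball : Metric.closedBall x₀ d ⊆ D) (hM : ∀ x ∈ Metric.closedBall x₀ d, |w x| ≤ M)
    (hK : ∀ x ∈ Metric.closedBall x₀ d, |h x| < K) :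
    ‖gradient w x₀‖ ≤ N * M / d + K * d / 2 := by
  have hx₀b : x₀ ∈ Metric.closedBall x₀ d := Metric.mem_closedBall_self hd.le
  have hM0 : 0 ≤ M := (abs_nonneg _).trans (hM _ hx₀b)
  have hK0 : 0 < K := (abs_nonneg _).trans_lt (hK _ hx₀b)
  rcases eq_or_ne (gradient w x₀) 0 with hzero | hne
  · rw [hzero, norm_zero]; positivity
  set e : EuclideanSpace ℝ (Fin N) := ‖gradient w x₀‖⁻¹ • gradient w x₀ with he
  have hn : ‖gradient w x₀‖ ≠ 0 := norm_ne_zero_iff.2 hne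
  have he1 : ‖e‖ = 1 := by rw [he, norm_smul, norm_inv, norm_norm, inv_mul_cancel₀ hn]
  have hge : ⟪gradient w x₀, e⟫ = ‖gradient w x₀‖ := by
    rw [he, inner_smul_right, real_inner_self_eq_norm_sq]
    field_simp
  set R : EuclideanSpace ℝ (Fin N) ≃ₗᵢ[ℝ] EuclideanSpace ℝ (Fin N) :=
    (ℝ ∙ e)ᗮ.reflection with hR
  have hRz : ∀ z, R z = z - (2 * ⟪z, e⟫) • e := by
    intro z
    rw [hR, Submodule.reflection_orthogonal_apply, Submodule.reflection_singleton_apply, he1,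
      real_inner_comm]
    simp only [map_one, one_pow, div_one, mul_smul, two_smul]
    abel
  set c : EuclideanSpace ℝ (Fin N) := x₀ - R x₀ with hc
  have hσ : ∀ x, R x + c = x₀ + R (x - x₀) := fun x => by rw [hc, map_sub]; abel
  have hσb : ∀ x, R x + c ∈ Metric.closedBall x₀ d ↔ x ∈ Metric.closedBall x₀ d := by
    intro x
    rw [hσ, mem_closedBall_iff_norm, mem_closedBall_iff_norm, add_sub_cancel_left, R.norm_map]
  set B := Metric.ball x₀ d with hB
  have hBcb : B ⊆ Metric.closedBall x₀ d := Metric.ball_subset_closedBall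
  have hBo : IsOpen B := Metric.isOpen_ball
  have hcomp := (hw.comp_isometry hD R c).mono
    (D' := B) fun x hx => hball ((hσb x).2 (hBcb hx))
  have hΦ := ((hw.mono (hBcb.trans hball)).sub hBo hcomp)
  set Φ : EuclideanSpace ℝ (Fin N) → ℝ := fun x => w x - w (R x + c) with hΦdef
  set ψ : EuclideanSpace ℝ (Fin N) → ℝ := fun x => 2 * M / d ^ 2 * ‖x - x₀‖ ^ 2 +
    (2 * M * N / d + K * d) * ⟪x - x₀, e⟫ + (-(2 * M * N / d ^ 2) - K) * ⟪x - x₀, e⟫ ^ 2 with hψ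
  have hψL := quadratic x₀ e he1 (2 * M / d ^ 2) (2 * M * N / d + K * d)
    (-(2 * M * N / d ^ 2) - K)
  have hdiff := hΦ.sub hBo (hψL.mono (Set.subset_univ B))
  set A : Set (EuclideanSpace ℝ (Fin N)) :=
    Metric.closedBall x₀ d ∩ {x | 0 ≤ ⟪x - x₀, e⟫} with hA
  have hcin : Continuous fun x : EuclideanSpace ℝ (Fin N) => ⟪x - x₀, e⟫ := by fun_prop
  have hAc : IsCompact A := (isCompact_closedBall x₀ d).inter_right
    (isClosed_le continuous_const hcin)
  have hle_norm : ∀ x : EuclideanSpace ℝ (Fin N), ⟪x - x₀, e⟫ ≤ ‖x - x₀‖ := fun x => by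
    simpa [he1] using real_inner_le_norm (x - x₀) e
  have hψ_split : ∀ x, ψ x = 2 * M / d ^ 2 * ‖x - x₀‖ ^ 2 +
      (2 * M * N / d ^ 2 + K) * (⟪x - x₀, e⟫ * (d - ⟪x - x₀, e⟫)) := by
    intro x
    simp only [hψ]
    field_simp
    ring
  have hΦc : ContinuousOn (fun x => Φ x - ψ x) A := by
    have hwc := hw.contDiffOn.continuousOn
    have h1 : ContinuousOn w A := hwc.mono fun x hx => hball hx.1
    have h2 : ContinuousOn (fun x => w (R x + c)) A :=
      hwc.comp (by fun_prop) fun x hx => hball ((hσb x).2 hx.1)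
    exact (h1.sub h2).sub (by fun_prop)
  have hle : ∀ x ∈ A, Φ x ≤ ψ x := by
    by_contra! hcon
    obtain ⟨z, hzA, hz⟩ := hcon
    obtain ⟨y, hyA, hy⟩ := hAc.exists_isMaxOn ⟨z, hzA⟩ hΦc
    have hpos : 0 < Φ y - ψ y := lt_of_lt_of_le (by linarith) (hy hzA)
    have hyd : ‖y - x₀‖ ≤ d := mem_closedBall_iff_norm.1 hyA.1
    have hy0 : 0 ≤ ⟪y - x₀, e⟫ := hyA.2
    have hprod : 0 ≤ ⟪y - x₀, e⟫ * (d - ⟪y - x₀, e⟫) :=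
      mul_nonneg hy0 (by linarith [hle_norm y])
    have hψ0 : 2 * M / d ^ 2 * ‖y - x₀‖ ^ 2 ≤ ψ y := by
      rw [hψ_split]
      have : 0 ≤ (2 * M * N / d ^ 2 + K) * (⟪y - x₀, e⟫ * (d - ⟪y - x₀, e⟫)) := by positivity
      linarith
    have hyd' : ‖y - x₀‖ < d := by
      refine lt_of_le_of_ne hyd fun heq => ?_
      have h1 : Φ y ≤ 2 * M := by
        have := abs_le.1 (hM y hyA.1)
        have := abs_le.1 (hM _ ((hσb y).2 hyA.1))
        simp only [hΦdef]
        linarith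
      rw [heq] at hψ0
      have : 2 * M / d ^ 2 * d ^ 2 = 2 * M := by field_simp
      linarith
    have hy0' : 0 < ⟪y - x₀, e⟫ := by
      refine lt_of_le_of_ne hy0 fun heq => ?_
      have h1 : Φ y = 0 := by
        simp only [hΦdef]
        rw [hσ, hRz, ← heq]
        simp
      have : 0 ≤ 2 * M / d ^ 2 * ‖y - x₀‖ ^ 2 := by positivity
      linarith
    have hyB : y ∈ B := mem_ball_iff_norm.2 hyd'
    have hloc : IsLocalMax (fun x => Φ x - ψ x) y := by
      filter_upwards [hBo.mem_nhds hyB, (isOpen_lt continuous_const hcin).mem_nhds hy0'] with x h1 h2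
      exact hy ⟨hBcb h1, le_of_lt h2⟩
    have hfin := hdiff.nonpos_of_isLocalMax hBo hyB hloc
    have h1 := abs_lt.1 (hK y hyA.1)
    have h2 := abs_lt.1 (hK _ ((hσb y).2 hyA.1))
    have h3 : 2 * (2 * M / d ^ 2) * N + 2 * (-(2 * M * N / d ^ 2) - K) = -2 * K := by ring
    linarith
  have hline : HasDerivAt (fun t : ℝ => Φ (x₀ + t • e)) (2 * ‖gradient w x₀‖) 0 := by
    have hlin : ∀ a : EuclideanSpace ℝ (Fin N), HasDerivAt (fun t : ℝ => x₀ + t • a) a 0 := by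
      intro a
      simpa using ((hasDerivAt_id (0 : ℝ)).smul_const a).const_add x₀
    have hg := hasGradientAt_iff_hasFDerivAt.1
      (hasGradientAt_of_contDiffOn hD hw.contDiffOn (hball hx₀b))
    have hdir : ∀ a : EuclideanSpace ℝ (Fin N),
        HasDerivAt (fun t : ℝ => w (x₀ + t • a)) ⟪gradient w x₀, a⟫ 0 := by
      intro a
      have hg' : HasFDerivAt w (InnerProductSpace.toDual ℝ _ (gradient w x₀))
          (x₀ + (0 : ℝ) • a) := by simpa using hg
      exact hg'.comp_hasDerivAt (0 : ℝ) (hlin a)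
    have h1 := (hdir e).sub (hdir (-e))
    rw [inner_neg_right, hge] at h1
    have h2 : (fun t : ℝ => Φ (x₀ + t • e)) =
        (fun t : ℝ => w (x₀ + t • e)) - fun t : ℝ => w (x₀ + t • (-e)) := by
      funext t
      simp only [hΦdef, Pi.sub_apply]
      rw [hσ, add_sub_cancel_left, hRz, inner_smul_left, real_inner_self_eq_norm_sq, he1]
      congr 3
      simp only [conj_trivial, one_pow, mul_one, mul_smul, two_smul, smul_neg]
      abel
    rw [h2]
    exact h1.congr_deriv (by ring)
  have hlineψ : HasDerivAt (fun t : ℝ => 2 * M / d ^ 2 * t ^ 2 +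
      (2 * M * N / d ^ 2 + K) * (t * (d - t))) ((2 * M * N / d ^ 2 + K) * d) 0 := by
    have h1 := ((hasDerivAt_id (0 : ℝ)).pow 2).const_mul (2 * M / d ^ 2)
    have h2 := (((hasDerivAt_id (0 : ℝ)).mul ((hasDerivAt_id (0 : ℝ)).const_sub d))).const_mul
      (2 * M * N / d ^ 2 + K)
    have h3 := h1.add h2
    refine h3.congr_deriv ?_
    simp
  have hmain : 2 * ‖gradient w x₀‖ ≤ (2 * M * N / d ^ 2 + K) * d := by
    set p : ℝ → ℝ := fun t => 2 * M / d ^ 2 * t ^ 2 +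
      (2 * M * N / d ^ 2 + K) * (t * (d - t)) - Φ (x₀ + t • e) with hp
    have hdd : HasDerivAt p _ 0 := hlineψ.sub hline
    have hmin : ∀ᶠ t in 𝓝[>] (0 : ℝ), 0 ≤ p t := by
      filter_upwards [Ioo_mem_nhdsGT hd] with t ht
      have hmem : x₀ + t • e ∈ A := by
        refine ⟨?_, ?_⟩
        · rw [mem_closedBall_iff_norm, add_sub_cancel_left, norm_smul, he1, mul_one,
            Real.norm_of_nonneg ht.1.le]
          exact ht.2.le
        · simp only [Set.mem_ofPred_eq, add_sub_cancel_left, inner_smul_left]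
          rw [real_inner_self_eq_norm_sq, he1]
          simpa using ht.1.le
      have h1 := hle _ hmem
      rw [hψ_split, add_sub_cancel_left, inner_smul_left, real_inner_self_eq_norm_sq, norm_smul, he1,
        Real.norm_of_nonneg ht.1.le] at h1
      simp only [conj_trivial, one_pow, mul_one] at h1
      simp only [hp]
      linarith
    have hslope := (hasDerivAt_iff_tendsto_slope.1 hdd).mono_left
      (nhdsWithin_mono 0 (fun t (ht : t ∈ Set.Ioi (0 : ℝ)) => ne_of_gt ht))
    have hnn := ge_of_tendsto hslope (b := 0) (by
      filter_upwards [hmin, self_mem_nhdsWithin] with t ht htpos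
      have hΦ0 : Φ x₀ = 0 := by simp [hΦdef, hc]
      rw [slope_def_field]
      refine div_nonneg ?_ (by simpa using le_of_lt htpos)
      have h0 : p 0 = 0 := by simp [hp, hΦ0]
      rw [h0, sub_zero]
      exact ht)
    linarith
  have : (2 * M * N / d ^ 2 + K) * d = 2 * (N * M / d + K * d / 2) := by
    field_simp
  linarith

end HasWeakLaplacianOn

/-- The Laplacian of a solution of equation (E), expressed through its value and gradient. -/
def solLaplacian {N : ℕ} (ρ lam τ θ q : ℝ) (u : EuclideanSpace ℝ (Fin N) → ℝ)
    (x : EuclideanSpace ℝ (Fin N)) : ℝ :=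
  ((N : ℝ) - 2 + 2 * ρ) * (⟪x, gradient u x⟫ / ‖x‖ ^ 2) - lam * Gt τ x (u x) (gradient u x)
    + ‖x‖ ^ θ * u x ^ q

/-- The value, up to a power of `|x|`, of the operator of equation (E) without absorption at
`|x|^(-β) Q(|x|²)`, where `a = s Q'(s)` and `b = s² Q''(s)` with `s = |x|²`. -/
def radialOp (ρ lam τ β Q a b : ℝ) : ℝ :=
  4 * (b - β * a + β / 2 * (β / 2 + 1) * Q) + (4 - 4 * ρ) * (a - β / 2 * Q)
    + lam * (Q ^ τ * |2 * a - β * Q| ^ (1 - τ))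

section Solution

variable {N : ℕ} {ρ lam τ θ q β : ℝ} {Ω : Set (EuclideanSpace ℝ (Fin N))}
  {u : EuclideanSpace ℝ (Fin N) → ℝ}

theorem isOpen_punctured (hΩ : IsOpen Ω) : IsOpen (Ω \ {0}) := hΩ.sdiff isClosed_singleton

theorem norm_pos_of_mem {x : EuclideanSpace ℝ (Fin N)} (hx : x ∈ Ω \ {0}) : 0 < ‖x‖ :=
  norm_pos_iff.2 hx.2

theorem IsSolutionE.hasWeakLaplacianOn (hτ1 : τ < 1) (hΩ : IsOpen Ω)
    (hu : IsSolutionE N ρ lam τ θ q Ω u) :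
    HasWeakLaplacianOn u (solLaplacian ρ lam τ θ q u) (Ω \ {0}) := by
  have hD := isOpen_punctured hΩ
  have hg := continuousOn_gradient hD hu.1.1
  have huc := hu.1.1.continuousOn
  have hx0 : ∀ x ∈ Ω \ {0}, ‖x‖ ≠ 0 := fun x hx => (norm_pos_of_mem hx).ne'
  have hnorm : ContinuousOn (fun x : EuclideanSpace ℝ (Fin N) => ‖x‖) (Ω \ {0}) :=
    continuous_norm.continuousOn
  have c1 : ContinuousOn (fun x => ⟪x, gradient u x⟫ / ‖x‖ ^ 2) (Ω \ {0}) :=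
    (continuousOn_id.inner hg).div (hnorm.pow 2) fun x hx => pow_ne_zero 2 (hx0 x hx)
  have c2 : ContinuousOn (fun x => Gt τ x (u x) (gradient u x)) (Ω \ {0}) := by
    refine ((huc.rpow_const fun x hx => Or.inl (hu.1.2 x hx).ne').mul
      (hg.norm.rpow_const fun x _ => Or.inr (by linarith))).div
      (hnorm.rpow_const fun x hx => Or.inl (hx0 x hx)) fun x hx => ?_
    exact (rpow_pos_of_pos (norm_pos_of_mem hx) _).ne'
  have c3 : ContinuousOn (fun x => ‖x‖ ^ θ * u x ^ q) (Ω \ {0}) :=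
    (hnorm.rpow_const fun x hx => Or.inl (hx0 x hx)).mul
      (huc.rpow_const fun x hx => Or.inl (hu.1.2 x hx).ne')
  refine ⟨hu.1.1, ((continuousOn_const.mul c1).sub (continuousOn_const.mul c2)).add c3,
    fun η hη hc hs => ?_⟩
  have hweak := hu.2 η ⟨hη, hc, hs⟩
  have hout : ∀ x ∉ Ω \ {0}, x ∉ tsupport η := fun x hx hmem => hx (hs hmem)
  rw [weakE, setIntegral_eq_integral_of_forall_compl_eq_zero, 
    setIntegral_eq_integral_of_forall_compl_eq_zero,
    setIntegral_eq_integral_of_forall_compl_eq_zero,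
    setIntegral_eq_integral_of_forall_compl_eq_zero] at hweak
  · have i1 := (integrable_mul_of_tsupport_subset hD c1 hη.continuous hc hs).2.2
    have i2 := (integrable_mul_of_tsupport_subset hD c2 hη.continuous hc hs).2.2
    have i3 := (integrable_mul_of_tsupport_subset hD c3 hη.continuous hc hs).2.2
    have hsplit : ∫ x, solLaplacian ρ lam τ θ q u x * η x =
        ((N : ℝ) - 2 + 2 * ρ) * (∫ x, ⟪x, gradient u x⟫ / ‖x‖ ^ 2 * η x)
        - lam * (∫ x, Gt τ x (u x) (gradient u x) * η x) + ∫ x, ‖x‖ ^ θ * u x ^ q * η x := by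
      have i12 : Integrable (fun x => ((N : ℝ) - 2 + 2 * ρ) * (⟪x, gradient u x⟫ / ‖x‖ ^ 2 * η x)
          - lam * (Gt τ x (u x) (gradient u x) * η x)) := (i1.const_mul _).sub (i2.const_mul _)
      rw [← integral_const_mul, ← integral_const_mul,
        ← integral_sub (i1.const_mul _) (i2.const_mul _), ← integral_add i12 i3]
      refine integral_congr_ae (Eventually.of_forall fun x => ?_)
      simp only [solLaplacian]
      ring
    linarith
  all_goals
    intro x hx
    simp [image_eq_zero_of_notMem_tsupport (hout x hx),
      gradient_eq_zero_of_notMem_tsupport (hout x hx)]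

theorem solLaplacian_sub_radial (hβ : β * (q - 1) = θ + 2)
    {x : EuclideanSpace ℝ (Fin N)} (hx : x ≠ 0) {Q a b : ℝ} (hQ : 0 < Q)
    (hux : u x = ‖x‖ ^ (-β) * Q)
    (hgx : gradient u x = (2 * (‖x‖ ^ (-β) * (a - β / 2 * Q) / ‖x‖ ^ 2)) • x) :
    solLaplacian ρ lam τ θ q u x -
      (4 * ‖x‖ ^ 2 * (‖x‖ ^ (-β) * (b - β * a + β / 2 * (β / 2 + 1) * Q) / (‖x‖ ^ 2) ^ 2)
        + 2 * N * (‖x‖ ^ (-β) * (a - β / 2 * Q) / ‖x‖ ^ 2))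
      = ‖x‖ ^ (-β) / ‖x‖ ^ 2 * (Q ^ q - radialOp ρ lam τ β Q a b) := by
  have hn : 0 < ‖x‖ := norm_pos_iff.2 hx
  have hr : 0 < ‖x‖ ^ (-β) := rpow_pos_of_pos hn _
  have hinner : ⟪x, gradient u x⟫ / ‖x‖ ^ 2 = 2 * (‖x‖ ^ (-β) * (a - β / 2 * Q) / ‖x‖ ^ 2) := by
    rw [hgx, inner_smul_right, real_inner_self_eq_norm_sq]
    field_simp
  have hnorm : ‖gradient u x‖ = ‖x‖ ^ (-β) * |2 * a - β * Q| / ‖x‖ := by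
    rw [hgx, norm_smul, Real.norm_eq_abs, show 2 * (‖x‖ ^ (-β) * (a - β / 2 * Q) / ‖x‖ ^ 2)
      = ‖x‖ ^ (-β) / ‖x‖ ^ 2 * (2 * a - β * Q) by ring, abs_mul, abs_of_pos (by positivity)]
    field_simp
  have hGt : Gt τ x (u x) (gradient u x)
      = ‖x‖ ^ (-β) / ‖x‖ ^ 2 * (Q ^ τ * |2 * a - β * Q| ^ (1 - τ)) := by
    rw [Gt, hnorm, hux, mul_rpow hr.le hQ.le, div_rpow (by positivity) hn.le,
      mul_rpow hr.le (abs_nonneg _)]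
    have h1 : (‖x‖ ^ (-β)) ^ τ * (‖x‖ ^ (-β)) ^ (1 - τ) = ‖x‖ ^ (-β) := by
      rw [← rpow_add hr]; simp
    have h2 : ‖x‖ ^ (1 - τ) * ‖x‖ ^ (τ + 1) = ‖x‖ ^ 2 := by
      rw [← rpow_add hn, show 1 - τ + (τ + 1) = ((2 : ℕ) : ℝ) by push_cast; ring, rpow_natCast]
    rw [← h2]
    nth_rewrite 3 [← h1]
    have h3 := (rpow_pos_of_pos hn (1 - τ)).ne'
    have h4 := (rpow_pos_of_pos hn (τ + 1)).ne'
    field_simp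
  have hpow : ‖x‖ ^ θ * u x ^ q = ‖x‖ ^ (-β) / ‖x‖ ^ 2 * Q ^ q := by
    rw [hux, mul_rpow hr.le hQ.le, ← rpow_mul hn.le, ← mul_assoc, ← rpow_add hn,
      show θ + -β * q = -β - 2 by linarith, rpow_sub hn]
    norm_num
  rw [solLaplacian, hinner, hGt, hpow, radialOp]
  field_simp
  ring

/-- Data for the radial comparison function `|x|^(-β) Q(|x|²)`. -/
theorem hasWeakLaplacianOn_radial {Q Q' Q'' : ℝ → ℝ} {I : Set ℝ} (hI : IsOpen I)
    (hIpos : ∀ s ∈ I, 0 < s)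
    (hQ : ∀ s ∈ I, HasDerivAt Q (Q' s) s) (hQ' : ∀ s ∈ I, HasDerivAt Q' (Q'' s) s)
    (hQ'' : ContinuousOn Q'' I) :
    ∃ L : EuclideanSpace ℝ (Fin N) → ℝ,
      HasWeakLaplacianOn (fun x => (‖x‖ ^ 2) ^ (-β / 2) * Q (‖x‖ ^ 2)) L {x | ‖x‖ ^ 2 ∈ I} ∧
      ∀ x, ‖x‖ ^ 2 ∈ I → ∀ Q₀ a b, Q₀ = Q (‖x‖ ^ 2) → a = ‖x‖ ^ 2 * Q' (‖x‖ ^ 2) →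
        b = (‖x‖ ^ 2) ^ 2 * Q'' (‖x‖ ^ 2) →
        HasGradientAt (fun x => (‖x‖ ^ 2) ^ (-β / 2) * Q (‖x‖ ^ 2))
          ((2 * (‖x‖ ^ (-β) * (a - β / 2 * Q₀) / ‖x‖ ^ 2)) • x) x ∧
        L x = 4 * ‖x‖ ^ 2 * (‖x‖ ^ (-β) * (b - β * a + β / 2 * (β / 2 + 1) * Q₀) / (‖x‖ ^ 2) ^ 2)
          + 2 * N * (‖x‖ ^ (-β) * (a - β / 2 * Q₀) / ‖x‖ ^ 2) := by
  set p : ℝ := -β / 2 with hp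
  have d0 : ∀ p : ℝ, ∀ s ∈ I, HasDerivAt (fun s : ℝ => s ^ p) (p * s ^ (p - 1)) s :=
    fun p s hs => hasDerivAt_rpow_const (Or.inl (hIpos s hs).ne')
  have c0 : ∀ p : ℝ, ContinuousOn (fun s : ℝ => s ^ p) I :=
    fun p s hs => (d0 p s hs).continuousAt.continuousWithinAt
  have d1 : ∀ s ∈ I, HasDerivAt (fun s => s ^ p * Q s) (p * s ^ (p - 1) * Q s + s ^ p * Q' s) s :=
    fun s hs => (d0 p s hs).mul (hQ s hs)
  have d2 : ∀ s ∈ I, HasDerivAt (fun s => p * s ^ (p - 1) * Q s + s ^ p * Q' s)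
      (p * ((p - 1) * s ^ (p - 1 - 1)) * Q s + p * s ^ (p - 1) * Q' s
        + (p * s ^ (p - 1) * Q' s + s ^ p * Q'' s)) s :=
    fun s hs => (((d0 (p - 1) s hs).const_mul p).mul (hQ s hs)).add ((d0 p s hs).mul (hQ' s hs))
  have cQ : ContinuousOn Q I := fun s hs => (hQ s hs).continuousAt.continuousWithinAt
  have cQ' : ContinuousOn Q' I := fun s hs => (hQ' s hs).continuousAt.continuousWithinAt
  have d3 : ContinuousOn (fun s => p * ((p - 1) * s ^ (p - 1 - 1)) * Q s + p * s ^ (p - 1) * Q' s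
        + (p * s ^ (p - 1) * Q' s + s ^ p * Q'' s)) I :=
    (((continuousOn_const.mul (continuousOn_const.mul (c0 _))).mul cQ).add
      ((continuousOn_const.mul (c0 _)).mul cQ')).add
      (((continuousOn_const.mul (c0 _)).mul cQ').add ((c0 _).mul hQ''))
  have key := HasWeakLaplacianOn.comp_norm_sq hI (0 : EuclideanSpace ℝ (Fin N)) d1 d2 d3
  simp only [sub_zero] at key
  refine ⟨_, key.1, ?_⟩
  rintro x hx _ _ _ rfl rfl rfl
  have hs := hIpos _ hx
  have hn : 0 < ‖x‖ := by
    rcases (norm_nonneg x).eq_or_lt with h | h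
    · rw [← h] at hs; norm_num at hs
    · exact h
  have e0 : (‖x‖ ^ 2) ^ p = ‖x‖ ^ (-β) := by
    rw [← rpow_natCast, ← rpow_mul hn.le, hp]; congr 1; push_cast; ring
  have e1 : (‖x‖ ^ 2) ^ (p - 1) = ‖x‖ ^ (-β) / ‖x‖ ^ 2 := by rw [rpow_sub_one hs.ne', e0]
  have e2 : (‖x‖ ^ 2) ^ (p - 1 - 1) = ‖x‖ ^ (-β) / ‖x‖ ^ 2 / ‖x‖ ^ 2 := by
    rw [rpow_sub_one hs.ne', e1]
  refine ⟨?_, ?_⟩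
  · convert key.2 x hx using 2
    rw [e0, e1, hp]
    field_simp
    ring
  · simp only [e0, e1, e2]
    rw [hp]
    field_simp
    ring

theorem IsSolutionE.radial_touching (hτ1 : τ < 1) (hΩ : IsOpen Ω)
    (hu : IsSolutionE N ρ lam τ θ q Ω u) (hβ : β * (q - 1) = θ + 2)
    {x₀ : EuclideanSpace ℝ (Fin N)} (hx₀ : x₀ ∈ Ω \ {0})
    {Q Q' Q'' : ℝ → ℝ} {I : Set ℝ} (hI : IsOpen I) (hIpos : ∀ s ∈ I, 0 < s)
    (hQ : ∀ s ∈ I, HasDerivAt Q (Q' s) s) (hQ' : ∀ s ∈ I, HasDerivAt Q' (Q'' s) s)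
    (hQ'' : ContinuousOn Q'' I) (hxI : ‖x₀‖ ^ 2 ∈ I) (heq : ‖x₀‖ ^ β * u x₀ = Q (‖x₀‖ ^ 2)) :
    ((∀ᶠ x in 𝓝 x₀, ‖x‖ ^ β * u x ≤ Q (‖x‖ ^ 2)) → Q (‖x₀‖ ^ 2) ^ q ≤
      radialOp ρ lam τ β (Q (‖x₀‖ ^ 2)) (‖x₀‖ ^ 2 * Q' (‖x₀‖ ^ 2))
        ((‖x₀‖ ^ 2) ^ 2 * Q'' (‖x₀‖ ^ 2))) ∧
    ((∀ᶠ x in 𝓝 x₀, Q (‖x‖ ^ 2) ≤ ‖x‖ ^ β * u x) →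
      radialOp ρ lam τ β (Q (‖x₀‖ ^ 2)) (‖x₀‖ ^ 2 * Q' (‖x₀‖ ^ 2))
        ((‖x₀‖ ^ 2) ^ 2 * Q'' (‖x₀‖ ^ 2)) ≤ Q (‖x₀‖ ^ 2) ^ q) := by
  obtain ⟨L, hL, hLx⟩ := hasWeakLaplacianOn_radial (N := N) (β := β) hI hIpos hQ hQ' hQ''
  set ψ : EuclideanSpace ℝ (Fin N) → ℝ := fun x => (‖x‖ ^ 2) ^ (-β / 2) * Q (‖x‖ ^ 2) with hψ
  have hn := norm_pos_of_mem hx₀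
  have hψeq : ∀ x : EuclideanSpace ℝ (Fin N), ψ x = ‖x‖ ^ (-β) * Q (‖x‖ ^ 2) := by
    intro x
    have : (‖x‖ ^ 2) ^ (-β / 2) = ‖x‖ ^ (-β) := by
      rw [← rpow_natCast, ← rpow_mul (norm_nonneg x)]; congr 1; push_cast; ring
    simp only [hψ, this]
  have hcancel : ∀ x ∈ Ω \ {0}, u x = ‖x‖ ^ (-β) * (‖x‖ ^ β * u x) := fun x hx => by
    rw [← mul_assoc, ← rpow_add (norm_pos_of_mem hx)]; simp
  set D : Set (EuclideanSpace ℝ (Fin N)) := (Ω \ {0}) ∩ {x | ‖x‖ ^ 2 ∈ I} with hDdef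
  have hI' : IsOpen {x : EuclideanSpace ℝ (Fin N) | ‖x‖ ^ 2 ∈ I} :=
    hI.preimage (by fun_prop)
  have hD : IsOpen D := (isOpen_punctured hΩ).inter hI'
  have hxD : x₀ ∈ D := ⟨hx₀, hxI⟩
  have hw := ((hu.hasWeakLaplacianOn hτ1 hΩ).mono (Set.inter_subset_left : D ⊆ _)).sub hD
    (hL.mono Set.inter_subset_right)
  obtain ⟨hψg, hLval⟩ := hLx x₀ hxI _ _ _ rfl rfl rfl
  have hug := hasGradientAt_of_contDiffOn (isOpen_punctured hΩ) hu.1.1 hx₀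
  have hQpos : 0 < Q (‖x₀‖ ^ 2) := by
    rw [← heq]; exact mul_pos (rpow_pos_of_pos hn _) (hu.1.2 _ hx₀)
  have hval : IsLocalExtr (fun x => u x - ψ x) x₀ → solLaplacian ρ lam τ θ q u x₀ - L x₀ =
      ‖x₀‖ ^ (-β) / ‖x₀‖ ^ 2 * (Q (‖x₀‖ ^ 2) ^ q -
        radialOp ρ lam τ β (Q (‖x₀‖ ^ 2)) (‖x₀‖ ^ 2 * Q' (‖x₀‖ ^ 2))
        ((‖x₀‖ ^ 2) ^ 2 * Q'' (‖x₀‖ ^ 2))) := by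
    intro hext
    have hz := hext.hasFDerivAt_eq_zero (hug.hasFDerivAt.sub hψg.hasFDerivAt)
    have hgrad := (InnerProductSpace.toDual ℝ (EuclideanSpace ℝ (Fin N))).injective (sub_eq_zero.1 hz)
    rw [hLval]
    exact solLaplacian_sub_radial hβ hx₀.2 hQpos (by rw [hcancel x₀ hx₀, heq]) hgrad
  have hcoef : 0 < ‖x₀‖ ^ (-β) / ‖x₀‖ ^ 2 := by positivity
  have h0 : u x₀ - ψ x₀ = 0 := by rw [hψeq, hcancel x₀ hx₀, heq, sub_self]
  constructor
  · intro hle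
    have hmax : IsLocalMax (fun x => u x - ψ x) x₀ := by
      filter_upwards [hle, hD.mem_nhds hxD] with x hx hxm
      rw [h0, hψeq, hcancel x hxm.1, ← mul_sub]
      exact mul_nonpos_of_nonneg_of_nonpos (by positivity) (by linarith)
    have := hw.nonpos_of_isLocalMax hD hxD hmax
    rw [hval (Or.inr hmax)] at this
    nlinarith
  · intro hle
    have hmin : IsLocalMin (fun x => u x - ψ x) x₀ := by
      filter_upwards [hle, hD.mem_nhds hxD] with x hx hxm
      rw [h0, hψeq, hcancel x hxm.1, ← mul_sub]
      exact mul_nonneg (by positivity) (by linarith)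
    have := hw.nonneg_of_isLocalMin hD hxD hmin
    rw [hval (Or.inl hmin)] at this
    nlinarith

theorem radialOp_const {Q : ℝ} (hQ : 0 < Q) :
    radialOp ρ lam τ β Q 0 0 = fRho ρ lam τ β * Q := by
  have h : Q ^ τ * Q ^ (1 - τ) = Q := by rw [← rpow_add hQ]; simp
  rw [radialOp, fRho, show 2 * 0 - β * Q = -(β * Q) by ring, abs_neg, abs_mul, abs_of_pos hQ,
    mul_rpow (abs_nonneg _) hQ.le]
  linear_combination lam * |β| ^ (1 - τ) * h

/-- Weighted arithmetic-geometric mean bound for the gradient term. -/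
theorem rpow_mul_rpow_one_sub_le (hτ0 : 0 ≤ τ) (hτ1 : τ < 1) {a b : ℝ} (ha : 0 ≤ a) (hb : 0 ≤ b) :
    a ^ τ * b ^ (1 - τ) ≤ a + b := by
  have := Real.geom_mean_le_arith_mean2_weighted hτ0 (by linarith : 0 ≤ 1 - τ) ha hb (by ring)
  nlinarith

theorem radialOp_le (hτ0 : 0 ≤ τ) (hτ1 : τ < 1) : ∃ A > 0, ∀ Q a b : ℝ, 0 < Q →
    radialOp ρ lam τ β Q a b ≤ A * (Q + |a| + |b|) := by
  refine ⟨4 * (1 + |β| + |β / 2 * (β / 2 + 1)|) + |4 - 4 * ρ| * (1 + |β / 2|)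
    + |lam| * (3 + |β|), by positivity, fun Q a b hQ => ?_⟩
  have h1 : |2 * a - β * Q| ≤ 2 * |a| + |β| * Q := by
    refine (abs_sub _ _).trans ?_
    rw [abs_mul, abs_mul, abs_of_pos hQ, abs_two]
  have h2 : lam * (Q ^ τ * |2 * a - β * Q| ^ (1 - τ)) ≤ |lam| * (Q + (2 * |a| + |β| * Q)) := by
    refine (mul_le_mul_of_nonneg_right (le_abs_self lam) (by positivity)).trans ?_
    refine mul_le_mul_of_nonneg_left ?_ (abs_nonneg _)
    exact (rpow_mul_rpow_one_sub_le hτ0 hτ1 hQ.le (abs_nonneg _)).trans (by linarith)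
  have h3 : b - β * a + β / 2 * (β / 2 + 1) * Q ≤
      |b| + |β| * |a| + |β / 2 * (β / 2 + 1)| * Q := by
    have e1 := le_abs_self b
    have e2 := neg_abs_le (β * a)
    have e3 := mul_le_mul_of_nonneg_right (le_abs_self (β / 2 * (β / 2 + 1))) hQ.le
    rw [abs_mul] at e2
    linarith
  have h4 : (4 - 4 * ρ) * (a - β / 2 * Q) ≤ |4 - 4 * ρ| * (|a| + |β / 2| * Q) := by
    refine (le_abs_self _).trans ?_
    rw [abs_mul]
    refine mul_le_mul_of_nonneg_left ?_ (abs_nonneg _)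
    refine (abs_sub _ _).trans ?_
    rw [abs_mul (β / 2), abs_of_pos hQ]
  rw [radialOp]
  have p1 := abs_nonneg a
  have p2 := abs_nonneg b
  have p3 := abs_nonneg β
  have p4 := abs_nonneg (4 - 4 * ρ)
  have p5 := abs_nonneg (β / 2)
  have p6 := abs_nonneg lam
  have p7 := abs_nonneg (β / 2 * (β / 2 + 1))
  have m1 := mul_nonneg p3 p1
  have m2 := mul_nonneg p3 p2
  have m3 := mul_nonneg p3 hQ.le
  have m4 := mul_nonneg p7 p1
  have m5 := mul_nonneg p7 p2
  have m6 := mul_nonneg p4 hQ.le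
  have m7 := mul_nonneg p4 p2
  have m8 := mul_nonneg (mul_nonneg p4 p5) p1
  have m9 := mul_nonneg (mul_nonneg p4 p5) p2
  have m10 := mul_nonneg p6 hQ.le
  have m11 := mul_nonneg p6 p1
  have m12 := mul_nonneg p6 p2
  have m13 := mul_nonneg (mul_nonneg p6 p3) p1
  have m14 := mul_nonneg (mul_nonneg p6 p3) p2
  nlinarith

end Solution

section UpperBound

variable {N : ℕ} {ρ lam τ θ q β : ℝ} {Ω : Set (EuclideanSpace ℝ (Fin N))}
  {u : EuclideanSpace ℝ (Fin N) → ℝ}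

theorem isCompact_annulus (a b : ℝ) :
    IsCompact {x : EuclideanSpace ℝ (Fin N) | a ≤ ‖x‖ ^ 2 ∧ ‖x‖ ^ 2 ≤ b} := by
  refine (isCompact_closedBall (0 : EuclideanSpace ℝ (Fin N)) (b + 1)).of_isClosed_subset
    (isClosed_Icc.preimage (by fun_prop : Continuous fun x : EuclideanSpace ℝ (Fin N) => ‖x‖ ^ 2))
    fun x hx => ?_
  rw [mem_closedBall_zero_iff]
  nlinarith [hx.2, sq_nonneg (‖x‖ - 1), norm_nonneg x]

theorem continuousOn_norm_rpow_mul (hu : ContinuousOn u (Ω \ {0})) (β : ℝ) :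
    ContinuousOn (fun x => ‖x‖ ^ β * u x) (Ω \ {0}) :=
  (continuous_norm.continuousOn.rpow_const fun _ hx => Or.inl (norm_pos_of_mem hx).ne').mul hu

theorem le_of_barrier_inequality {A k c s s₀ Y : ℝ} (hA : 0 < A) (hq1 : 0 < q - 1) (hk0 : 0 < k)
    (hkq : k * q = k + 2) (hs₀0 : 0 < s₀) (hc0 : 0 < c) (hs : s₀ / 2 < s ∧ s < 3 / 2 * s₀)
    (hY : Y = 1 / 4 - (s / s₀ - 1) ^ 2) (hY0 : 0 < Y)
    (hfin : (c * Y ^ (-k)) ^ q ≤ A * (c * Y ^ (-k)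
      + |s * (c * (-(2 * (s / s₀ - 1) / s₀) * (-k) * Y ^ (-k - 1)))|
      + |s ^ 2 * (c * (-(2 / s₀ / s₀) * (-k) * Y ^ (-k - 1) + -(2 * (s / s₀ - 1) / s₀) * (-k) *
        (-(2 * (s / s₀ - 1) / s₀) * (-k - 1) * Y ^ (-k - 1 - 1))))|)) :
    c ≤ (A * (1 + 3 / 2 * k + k * (9 / 4 * (k + 1) + 9 / 2))) ^ (1 / (q - 1)) := by
  set B : ℝ := 1 + 3 / 2 * k + k * (9 / 4 * (k + 1) + 9 / 2) with hB
  have hB0 : 0 < B := by positivity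
  obtain ⟨hs1, hs2⟩ := hs
  set t : ℝ := s / s₀ with ht
  have hst : s = t * s₀ := by rw [ht]; field_simp
  have ht1 : 1 / 2 < t := by rw [ht, lt_div_iff₀ hs₀0]; linarith
  have ht2 : t < 3 / 2 := by rw [ht, div_lt_iff₀ hs₀0]; linarith
  have hY1 : Y ≤ 1 / 4 := by nlinarith [sq_nonneg (s / s₀ - 1)]
  set Z : ℝ := Y ^ (-k - 2) with hZ
  have hZ0 : 0 < Z := rpow_pos_of_pos hY0 _
  have z1 : Y ^ (-k - 1 - 1) = Z := by rw [hZ]; congr 1; ring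
  have z2 : Y ^ (-k - 1) = Z * Y := by
    rw [← z1, ← rpow_add_one hY0.ne']; congr 1; ring
  have z3 : Y ^ (-k) = Z * Y ^ 2 := by
    rw [pow_two, ← mul_assoc, ← z2, ← rpow_add_one hY0.ne']; congr 1; ring
  have hlhs : (c * Y ^ (-k)) ^ q = c ^ q * Z := by
    rw [mul_rpow hc0.le (rpow_nonneg hY0.le _), ← rpow_mul hY0.le, hZ]
    congr 2; linarith
  rw [hlhs] at hfin
  rw [z1, z2, z3] at hfin
  have hm : |t * (t - 1)| ≤ 3 / 4 := by
    rw [abs_le]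
    constructor <;> nlinarith
  have hα : |s * (c * (-(2 * (t - 1) / s₀) * -k * (Z * Y)))| ≤ 3 / 2 * k * (c * Z) := by
    have e : s * (c * (-(2 * (t - 1) / s₀) * -k * (Z * Y))) = 2 * (t * (t - 1)) * Y * (k * (c * Z)) := by
      rw [hst]; field_simp
    rw [e, abs_mul, abs_of_pos (by positivity : 0 < k * (c * Z)), mul_assoc (3 / 2)]
    refine mul_le_mul_of_nonneg_right ?_ (by positivity)
    rw [abs_mul, abs_mul, abs_two, abs_of_pos hY0]
    have := mul_le_mul hm hY1 hY0.le (by norm_num)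
    linarith
  have hb : |s ^ 2 * (c * (-(2 / s₀ / s₀) * -k * (Z * Y) + -(2 * (t - 1) / s₀) * -k *
      (-(2 * (t - 1) / s₀) * (-k - 1) * Z)))| ≤ k * (9 / 4 * (k + 1) + 9 / 2) * (c * Z) := by
    have e : s ^ 2 * (c * (-(2 / s₀ / s₀) * -k * (Z * Y) + -(2 * (t - 1) / s₀) * -k *
      (-(2 * (t - 1) / s₀) * (-k - 1) * Z))) =
      (2 * t ^ 2 * Y + 4 * (t * (t - 1)) ^ 2 * (k + 1)) * (k * (c * Z)) := by
      rw [hst]; field_simp; ring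
    rw [e, abs_of_nonneg (by positivity)]
    have h1 : (t * (t - 1)) ^ 2 ≤ 9 / 16 := by
      rw [← sq_abs]
      exact (pow_le_pow_left₀ (abs_nonneg _) hm 2).trans (by norm_num)
    have h2 : t ^ 2 ≤ 9 / 4 :=
      (pow_le_pow_left₀ (by linarith) ht2.le 2).trans (by norm_num)
    have h3 : t ^ 2 * Y ≤ 9 / 4 * 1 := mul_le_mul h2 (by linarith) hY0.le (by norm_num)
    have h4 := mul_le_mul_of_nonneg_right h1 (by linarith : 0 ≤ k + 1)
    have : 2 * t ^ 2 * Y + 4 * (t * (t - 1)) ^ 2 * (k + 1) ≤ 9 / 4 * (k + 1) + 9 / 2 := by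
      linarith
    calc _ ≤ (9 / 4 * (k + 1) + 9 / 2) * (k * (c * Z)) :=
          mul_le_mul_of_nonneg_right this (by positivity)
      _ = _ := by ring
  have hQ : c * (Z * Y ^ 2) ≤ 1 * (c * Z) := by
    have : Y ^ 2 ≤ 1 := pow_le_one₀ hY0.le (by linarith)
    have := mul_le_mul_of_nonneg_left this (mul_pos hc0 hZ0).le
    linarith
  have hfin2 : c ^ q * Z ≤ A * B * c * Z := by
    refine hfin.trans ?_
    calc _ ≤ A * (1 * (c * Z) + 3 / 2 * k * (c * Z)
          + k * (9 / 4 * (k + 1) + 9 / 2) * (c * Z)) :=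
          mul_le_mul_of_nonneg_left (add_le_add (add_le_add hQ hα) hb) hA.le
      _ = _ := by rw [hB]; ring
  have hfin3 : c ^ (q - 1) ≤ A * B := by
    have h := le_of_mul_le_mul_right hfin2 hZ0
    rw [rpow_sub_one hc0.ne', div_le_iff₀ hc0]
    exact h
  rw [one_div, le_rpow_inv_iff_of_pos hc0.le (by positivity) hq1]
  exact hfin3

/-- Every positive solution is `O(|x|^(-β))` near the origin (Keller-Osserman estimate). -/
theorem IsSolutionE.norm_rpow_mul_le (hτ0 : 0 ≤ τ) (hτ1 : τ < 1) (hq : 1 < q) (hΩ : IsOpen Ω)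
    (hu : IsSolutionE N ρ lam τ θ q Ω u) (hβ : β * (q - 1) = θ + 2) {R : ℝ}
    (hR : Metric.ball 0 R ⊆ Ω) :
    ∃ C > 0, ∀ x : EuclideanSpace ℝ (Fin N), x ≠ 0 → ‖x‖ < R / 2 → ‖x‖ ^ β * u x ≤ C := by
  obtain ⟨A, hA, hAle⟩ := radialOp_le (ρ := ρ) (lam := lam) (β := β) hτ0 hτ1
  have hq1 : 0 < q - 1 := by linarith
  set k : ℝ := 2 / (q - 1) with hk
  have hk0 : 0 < k := by positivity
  have hkq : k * q = k + 2 := by rw [hk]; field_simp; ring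
  set B : ℝ := 1 + 3 / 2 * k + k * (9 / 4 * (k + 1) + 9 / 2) with hB
  have hB0 : 0 < B := by positivity
  refine ⟨(A * B) ^ (1 / (q - 1)) * 4 ^ k, by positivity, fun x₀ hx₀ hx₀R => ?_⟩
  have hn₀ : 0 < ‖x₀‖ := norm_pos_iff.2 hx₀
  set s₀ : ℝ := ‖x₀‖ ^ 2 with hs₀
  have hs₀0 : 0 < s₀ := by positivity
  set y : ℝ → ℝ := fun s => 1 / 4 - (s / s₀ - 1) ^ 2 with hy
  set K : Set (EuclideanSpace ℝ (Fin N)) := {x | s₀ / 2 ≤ ‖x‖ ^ 2 ∧ ‖x‖ ^ 2 ≤ 3 / 2 * s₀} with hK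
  have hyc : Continuous y := by fun_prop
  have hKΩ : K ⊆ Ω \ {0} := by
    intro x hx
    refine ⟨hR ?_, ?_⟩
    · rw [mem_ball_zero_iff]
      have : ‖x‖ ^ 2 < (2 * ‖x₀‖) ^ 2 := by nlinarith [hx.2]
      have := lt_of_pow_lt_pow_left₀ 2 (by positivity) this
      linarith
    · rintro rfl
      have := hx.1
      norm_num at this
      linarith
  have hyK : ∀ x ∈ K, 0 ≤ y (‖x‖ ^ 2) := by
    intro x hx
    have h1 : 1 / 2 ≤ ‖x‖ ^ 2 / s₀ := by rw [le_div_iff₀ hs₀0]; linarith [hx.1]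
    have h2 : ‖x‖ ^ 2 / s₀ ≤ 3 / 2 := by rw [div_le_iff₀ hs₀0]; linarith [hx.2]
    simp only [hy]
    nlinarith
  have hx₀K : x₀ ∈ K := ⟨by linarith, by linarith⟩
  have hFc : ContinuousOn (fun x => ‖x‖ ^ β * u x * y (‖x‖ ^ 2) ^ k) K :=
    ((continuousOn_norm_rpow_mul hu.1.1.continuousOn β).mono hKΩ).mul
      ((hyc.comp (by fun_prop : Continuous fun x : EuclideanSpace ℝ (Fin N) => ‖x‖ ^ 2)
        ).continuousOn.rpow_const fun _ _ => Or.inr hk0.le)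
  obtain ⟨x₁, hx₁K, hx₁⟩ := (isCompact_annulus _ _).exists_isMaxOn ⟨x₀, hx₀K⟩ hFc
  have hv0 : ∀ x ∈ Ω \ {0}, 0 < ‖x‖ ^ β * u x := fun x hx =>
    mul_pos (rpow_pos_of_pos (norm_pos_of_mem hx) _) (hu.1.2 x hx)
  set c : ℝ := ‖x₁‖ ^ β * u x₁ * y (‖x₁‖ ^ 2) ^ k with hc
  have hy₀ : y (‖x₀‖ ^ 2) = 1 / 4 := by
    simp only [hy, ← hs₀, div_self hs₀0.ne']; norm_num
  have hcx₀ : ‖x₀‖ ^ β * u x₀ * (1 / 4) ^ k ≤ c := hy₀ ▸ hx₁ hx₀K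
  have hc0 : 0 < c := (mul_pos (hv0 x₀ (hKΩ hx₀K)) (by positivity)).trans_le hcx₀
  have hy₁ : 0 < y (‖x₁‖ ^ 2) := by
    refine (hyK x₁ hx₁K).lt_of_ne fun h => hc0.ne' ?_
    rw [hc, ← h, zero_rpow hk0.ne', mul_zero]
  have hIpos : ∀ s, 0 < y s → s₀ / 2 < s ∧ s < 3 / 2 * s₀ := by
    intro s hs
    have h : |s / s₀ - 1| < 1 / 2 := abs_lt_of_sq_lt_sq (by simp only [hy] at hs; linarith) (by norm_num)
    rw [abs_lt] at h
    exact ⟨by have := (lt_div_iff₀ hs₀0).1 (by linarith [h.1] : 1 / 2 < s / s₀); linarith,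
      (div_lt_iff₀ hs₀0).1 (by linarith [h.2])⟩
  have hyd : ∀ s, HasDerivAt y (-(2 * (s / s₀ - 1) / s₀)) s := by
    intro s
    have := ((((hasDerivAt_id s).div_const s₀).sub_const 1).pow 2).const_sub (1 / 4 : ℝ)
    exact this.congr_deriv (by simp only [id]; norm_num; ring)
  have hyd' : ∀ s, HasDerivAt (fun s => -(2 * (s / s₀ - 1) / s₀)) (-(2 / s₀ / s₀)) s := by
    intro s
    have := (((((hasDerivAt_id s).div_const s₀).sub_const 1).const_mul 2).div_const s₀).neg
    exact this.congr_deriv (by ring)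
  have hrp : ∀ p s : ℝ, 0 < y s →
      HasDerivAt (fun s => y s ^ p) (-(2 * (s / s₀ - 1) / s₀) * p * y s ^ (p - 1)) s :=
    fun p s hs => (hyd s).rpow_const (Or.inl hs.ne')
  have hcond := (hu.radial_touching hτ1 hΩ hβ (hKΩ hx₁K) (Q := fun s => c * y s ^ (-k))
    (Q' := fun s => c * (-(2 * (s / s₀ - 1) / s₀) * (-k) * y s ^ (-k - 1)))
    (Q'' := fun s => c * (-(2 / s₀ / s₀) * (-k) * y s ^ (-k - 1) + -(2 * (s / s₀ - 1) / s₀) * (-k) *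
      (-(2 * (s / s₀ - 1) / s₀) * (-k - 1) * y s ^ (-k - 1 - 1))))
    (I := {s | 0 < y s}) (isOpen_lt continuous_const hyc)
    (fun s hs => by linarith [(hIpos s hs).1])
    (fun s hs => (hrp (-k) s hs).const_mul c)
    (fun s hs => (((hyd' s).mul_const (-k)).mul (hrp (-k - 1) s hs)).const_mul c)
    (by
      have hyr : ∀ p : ℝ, ContinuousOn (fun s => y s ^ p) {s | 0 < y s} := fun p =>
        hyc.continuousOn.rpow_const fun s hs => Or.inl (ne_of_gt hs)
      have hd : ContinuousOn (fun s => -(2 * (s / s₀ - 1) / s₀)) {s | 0 < y s} := by fun_prop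
      exact continuousOn_const.mul ((continuousOn_const.mul (hyr _)).add
        ((hd.mul continuousOn_const).mul ((hd.mul continuousOn_const).mul (hyr _)))))
    hy₁ (by
      rw [hc, mul_assoc, ← rpow_add hy₁]; simp)).1 (by
      have hopen : IsOpen {x : EuclideanSpace ℝ (Fin N) | 0 < y (‖x‖ ^ 2)} :=
        isOpen_lt continuous_const (hyc.comp (by fun_prop))
      filter_upwards [hopen.mem_nhds hy₁] with x hx
      have hxK : x ∈ K := ⟨(hIpos _ hx).1.le, (hIpos _ hx).2.le⟩
      have : ‖x‖ ^ β * u x * y (‖x‖ ^ 2) ^ k ≤ c := hx₁ hxK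
      rw [rpow_neg hx.le, ← div_eq_mul_inv, le_div_iff₀ (rpow_pos_of_pos hx k)]
      exact this)
  have hcle := le_of_barrier_inequality hA hq1 hk0 hkq hs₀0 hc0 (hIpos _ hy₁) rfl hy₁
    (hcond.trans (hAle _ _ _ (mul_pos hc0 (rpow_pos_of_pos hy₁ _))))
  have h4 : (1 / 4 : ℝ) ^ k * 4 ^ k = 1 := by
    rw [← mul_rpow (by norm_num) (by norm_num)]; norm_num
  calc ‖x₀‖ ^ β * u x₀ = ‖x₀‖ ^ β * u x₀ * (1 / 4) ^ k * 4 ^ k := by rw [mul_assoc _ ((1 / 4 : ℝ) ^ k), h4, mul_one]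
    _ ≤ _ := mul_le_mul_of_nonneg_right (hcx₀.trans hcle) (by positivity)

end UpperBound

section Harnack

variable {N : ℕ} {ρ lam τ θ q β : ℝ} {Ω : Set (EuclideanSpace ℝ (Fin N))}
  {u h : EuclideanSpace ℝ (Fin N) → ℝ}

theorem Gt_le (hτ0 : 0 ≤ τ) (hτ1 : τ < 1) {x ξ : EuclideanSpace ℝ (Fin N)} (hx : x ≠ 0) {z : ℝ}
    (hz : 0 ≤ z) : Gt τ x z ξ ≤ ‖ξ‖ / ‖x‖ + z / ‖x‖ ^ 2 := by
  have hn : 0 < ‖x‖ := norm_pos_iff.2 hx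
  have h := rpow_mul_rpow_one_sub_le hτ0 hτ1 (a := z / ‖x‖ ^ 2) (b := ‖ξ‖ / ‖x‖) (by positivity)
    (by positivity)
  have e : (z / ‖x‖ ^ 2) ^ τ * (‖ξ‖ / ‖x‖) ^ (1 - τ) = Gt τ x z ξ := by
    rw [Gt, div_rpow hz (by positivity), div_rpow (norm_nonneg _) hn.le, div_mul_div_comm]
    congr 1
    rw [← rpow_natCast, ← rpow_mul hn.le, ← rpow_add hn]
    congr 1; push_cast; ring
  linarith

theorem IsSolutionE.abs_solLaplacian_lt (hτ0 : 0 ≤ τ) (hτ1 : τ < 1) (hq : 1 < q)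
    (hu : IsSolutionE N ρ lam τ θ q Ω u) (hβ : β * (q - 1) = θ + 2) {C : ℝ} (hC0 : 0 < C) :
    ∃ A ≥ 1, ∀ x ∈ Ω \ {0}, ‖x‖ ^ β * u x ≤ C →
      |solLaplacian ρ lam τ θ q u x| < A * (‖gradient u x‖ / ‖x‖ + u x / ‖x‖ ^ 2) := by
  refine ⟨|(N : ℝ) - 2 + 2 * ρ| + |lam| + C ^ (q - 1) + 1, ?_, fun x hx hxC => ?_⟩
  · have := abs_nonneg ((N : ℝ) - 2 + 2 * ρ)
    have := abs_nonneg lam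
    have := rpow_pos_of_pos hC0 (q - 1)
    linarith
  have hn := norm_pos_of_mem hx
  have hux := hu.1.2 x hx
  have hu2 : 0 < u x / ‖x‖ ^ 2 := by positivity
  have hg2 : 0 ≤ ‖gradient u x‖ / ‖x‖ := by positivity
  have h1 : |⟪x, gradient u x⟫ / ‖x‖ ^ 2| ≤ ‖gradient u x‖ / ‖x‖ := by
    rw [abs_div, abs_of_pos (by positivity : 0 < ‖x‖ ^ 2), div_le_div_iff₀ (by positivity) hn]
    have := abs_real_inner_le_norm x (gradient u x)
    nlinarith
  have h2 := Gt_le hτ0 hτ1 (ξ := gradient u x) hx.2 hux.le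
  have h2' : 0 ≤ Gt τ x (u x) (gradient u x) := by rw [Gt]; positivity
  have h3 : ‖x‖ ^ θ * u x ^ q ≤ C ^ (q - 1) * (u x / ‖x‖ ^ 2) := by
    have e : ‖x‖ ^ θ * u x ^ q = (‖x‖ ^ β * u x) ^ (q - 1) * (u x / ‖x‖ ^ 2) := by
      rw [mul_rpow (by positivity) hux.le, ← rpow_mul hn.le, hβ, rpow_sub_one hux.ne',
        rpow_add hn, show (2 : ℝ) = ((2 : ℕ) : ℝ) by norm_num, rpow_natCast]
      field_simp
    rw [e]
    exact mul_le_mul_of_nonneg_right (rpow_le_rpow (by positivity) hxC (by linarith)) hu2.le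
  have h3' : 0 ≤ ‖x‖ ^ θ * u x ^ q := by positivity
  rw [solLaplacian]
  calc _ ≤ |(N : ℝ) - 2 + 2 * ρ| * (‖gradient u x‖ / ‖x‖)
        + |lam| * (‖gradient u x‖ / ‖x‖ + u x / ‖x‖ ^ 2) + C ^ (q - 1) * (u x / ‖x‖ ^ 2) := by
        refine (abs_add_le _ _).trans (add_le_add ((abs_sub _ _).trans (add_le_add ?_ ?_)) ?_)
        · rw [abs_mul]; exact mul_le_mul_of_nonneg_left h1 (abs_nonneg _)
        · rw [abs_mul, abs_of_nonneg h2']; exact mul_le_mul_of_nonneg_left h2 (abs_nonneg _)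
        · rwa [abs_of_nonneg h3']
    _ < _ := by
        have p1 := mul_nonneg (abs_nonneg ((N : ℝ) - 2 + 2 * ρ)) hu2.le
        have p2 := mul_nonneg (rpow_nonneg hC0.le (q - 1)) hg2
        linarith

theorem rpow_le_of_ratio {a b p : ℝ} (hb : 0 < b) (h1 : b / 2 ≤ a) (h2 : a ≤ 2 * b) :
    a ^ p ≤ 2 ^ |p| * b ^ p := by
  have ha : 0 < a := by linarith
  rcases le_total 0 p with hp | hp
  · rw [abs_of_nonneg hp, ← mul_rpow (by norm_num) hb.le]
    exact rpow_le_rpow ha.le h2 hp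
  · rw [abs_of_nonpos hp, rpow_neg (by norm_num), ← inv_rpow (by norm_num), ← mul_rpow (by norm_num) hb.le]
    exact rpow_le_rpow_of_nonpos (by positivity) (by linarith) hp

/-- Scale invariant gradient bound near the origin. -/
theorem HasWeakLaplacianOn.norm_gradient_le_rpow {R A C : ℝ}
    (hw : HasWeakLaplacianOn u h (Metric.ball 0 R \ {0}))
    (hpos : ∀ x ∈ Metric.ball 0 R \ {0}, 0 < u x) (hA1 : 1 ≤ A)
    (hA : ∀ x ∈ Metric.ball 0 R \ {0}, |h x| < A * (‖gradient u x‖ / ‖x‖ + u x / ‖x‖ ^ 2))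
    (hC0 : 0 < C) (hC : ∀ x ∈ Metric.ball 0 R \ {0}, ‖x‖ ^ β * u x ≤ C)
    {x₀ : EuclideanSpace ℝ (Fin N)} (hx₀ : x₀ ≠ 0) (hx₀R : ‖x₀‖ < R / 2) :
    ‖gradient u x₀‖ ≤ (8 * N * A + 1) * (C * 2 ^ |β|) * (‖x₀‖ ^ (-β) / ‖x₀‖) := by
  have hD : IsOpen (Metric.ball (0 : EuclideanSpace ℝ (Fin N)) R \ {0}) :=
    isOpen_punctured Metric.isOpen_ball
  set n : ℝ := ‖x₀‖ with hn
  have hn0 : 0 < n := norm_pos_iff.2 hx₀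
  set r : ℝ := n / 2 with hr
  have hbd : ∀ x ∈ Metric.closedBall x₀ r, n / 2 ≤ ‖x‖ ∧ ‖x‖ ≤ 3 / 2 * n := by
    intro x hx
    rw [mem_closedBall_iff_norm] at hx
    have h1 := norm_sub_norm_le x x₀
    have h2 := norm_sub_norm_le x₀ x
    rw [norm_sub_rev] at h2
    constructor <;> linarith
  have hsub : Metric.closedBall x₀ r ⊆ Metric.ball 0 R \ {0} := by
    intro x hx
    obtain ⟨h1, h2⟩ := hbd x hx
    refine ⟨?_, ?_⟩
    · rw [mem_ball_zero_iff]; linarith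
    · exact norm_pos_iff.1 (by linarith)
  set M : ℝ := C * 2 ^ |β| * n ^ (-β) with hM
  have hM0 : 0 < M := by positivity
  have huM : ∀ x ∈ Metric.closedBall x₀ r, u x ≤ M := by
    intro x hx
    obtain ⟨h1, h2⟩ := hbd x hx
    have hx0 : 0 < ‖x‖ := by linarith
    have h3 : ‖x‖ ^ (-β) ≤ 2 ^ |β| * n ^ (-β) := by
      have := rpow_le_of_ratio (p := -β) hn0 h1 (by linarith); rwa [abs_neg] at this
    calc u x = ‖x‖ ^ (-β) * (‖x‖ ^ β * u x) := by rw [← mul_assoc, ← rpow_add hx0]; simp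
      _ ≤ 2 ^ |β| * n ^ (-β) * C :=
        mul_le_mul h3 (hC x (hsub hx)) (mul_nonneg (by positivity) (hpos x (hsub hx)).le) (by positivity)
      _ = M := by rw [hM]; ring
  have hgc : ContinuousOn (fun x => (r - ‖x - x₀‖) * ‖gradient u x‖) (Metric.closedBall x₀ r) :=
    (by fun_prop : Continuous fun x => r - ‖x - x₀‖).continuousOn.mul
      ((continuousOn_gradient hD hw.contDiffOn).mono hsub).norm
  have hx₀b : x₀ ∈ Metric.closedBall x₀ r := Metric.mem_closedBall_self (by positivity)
  obtain ⟨x₁, hx₁, hmax⟩ := (isCompact_closedBall x₀ r).exists_isMaxOn ⟨x₀, hx₀b⟩ hgc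
  set S : ℝ := (r - ‖x₁ - x₀‖) * ‖gradient u x₁‖ with hS
  have hS0 : r * ‖gradient u x₀‖ ≤ S := by simpa using hmax hx₀b
  set d : ℝ := r - ‖x₁ - x₀‖ with hd
  have hd0 : 0 ≤ d := by rw [hd, sub_nonneg]; exact mem_closedBall_iff_norm.1 hx₁
  have hdn : 2 * d ≤ n := by linarith [norm_nonneg (x₁ - x₀)]
  have hSM : S ≤ (4 * N * A + 1 / 2) * M := by
    rcases hd0.eq_or_lt with h0 | hdpos
    · rw [hS, ← h0, zero_mul]; positivity
    set κ : ℝ := 1 / (2 * A) with hκ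
    have hκ0 : 0 < κ := by positivity
    have hκ1 : κ ≤ 1 / 2 := by
      rw [hκ]; exact one_div_le_one_div_of_le (by norm_num) (by linarith)
    have hS0' : 0 ≤ S := by positivity
    have hin : ∀ x ∈ Metric.closedBall x₁ (κ * d), x ∈ Metric.closedBall x₀ r ∧
        ‖gradient u x‖ ≤ 2 * S / d := by
      intro x hx
      rw [mem_closedBall_iff_norm] at hx
      have h1 : ‖x - x₀‖ ≤ ‖x - x₁‖ + ‖x₁ - x₀‖ := norm_sub_le_norm_sub_add_norm_sub ..
      have h2 : κ * d ≤ 1 / 2 * d := mul_le_mul_of_nonneg_right hκ1 hd0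
      have h3 : d / 2 ≤ r - ‖x - x₀‖ := by linarith
      have hxb : x ∈ Metric.closedBall x₀ r := by rw [mem_closedBall_iff_norm]; linarith
      refine ⟨hxb, ?_⟩
      have h4 : (r - ‖x - x₀‖) * ‖gradient u x‖ ≤ S := hmax hxb
      have h5 := mul_le_mul_of_nonneg_right h3 (norm_nonneg (gradient u x))
      rw [le_div_iff₀ hdpos]
      linarith
    have hK : ∀ x ∈ Metric.closedBall x₁ (κ * d), |h x| < A * (2 * S / d / (n / 2) + M / (n / 2) ^ 2) := by
      intro x hx
      obtain ⟨hxb, hg⟩ := hin x hx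
      obtain ⟨h1, -⟩ := hbd x hxb
      refine (hA x (hsub hxb)).trans_le (mul_le_mul_of_nonneg_left ?_ (by linarith))
      have := huM x hxb
      gcongr
    have key := hw.norm_gradient_le hD (by positivity : 0 < κ * d)
      (fun x hx => hsub (hin x hx).1)
      (fun x hx => by rw [abs_of_pos (hpos x (hsub (hin x hx).1))]; exact huM x (hin x hx).1) hK
    have hSle : S ≤ d * (N * M / (κ * d) + A * (2 * S / d / (n / 2) + M / (n / 2) ^ 2) * (κ * d) / 2) :=
      mul_le_mul_of_nonneg_left key hd0
    have e1 : d * (N * M / (κ * d) + A * (2 * S / d / (n / 2) + M / (n / 2) ^ 2) * (κ * d) / 2)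
        = 2 * N * A * M + S * (d / n) + M * (d / n) ^ 2 := by
      rw [hκ]; field_simp; ring
    have hdn' : d / n ≤ 1 / 2 := by rw [div_le_iff₀ hn0]; linarith
    have hdn0 : 0 ≤ d / n := by positivity
    have e2 := mul_le_mul_of_nonneg_left hdn' hS0'
    have e3 : (d / n) ^ 2 ≤ 1 / 4 := (pow_le_pow_left₀ hdn0 hdn' 2).trans (by norm_num)
    have e4 := mul_le_mul_of_nonneg_left e3 hM0.le
    rw [e1] at hSle
    linarith
  have hfin : n * ‖gradient u x₀‖ ≤ (8 * N * A + 1) * M := by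
    have : n * ‖gradient u x₀‖ = 2 * (r * ‖gradient u x₀‖) := by rw [hr]; ring
    linarith
  rw [← mul_div_assoc, le_div_iff₀ hn0, mul_comm]
  rw [hM] at hfin
  linarith

end Harnack

section Propagation

variable {N : ℕ} {β : ℝ} {u h : EuclideanSpace ℝ (Fin N) → ℝ}

theorem norm_bounds_of_mem_closedBall {y x : EuclideanSpace ℝ (Fin N)} {l : ℝ}
    (hx : x ∈ Metric.closedBall y l) (hl : l ≤ ‖y‖ / 2) :
    ‖y‖ / 2 ≤ ‖x‖ ∧ ‖x‖ ≤ 3 / 2 * ‖y‖ := by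
  rw [mem_closedBall_iff_norm] at hx
  have h1 := norm_sub_norm_le x y
  have h2 := norm_sub_norm_le y x
  rw [norm_sub_rev] at h2
  constructor <;> linarith

theorem closedBall_subset_punctured {y : EuclideanSpace ℝ (Fin N)} {l R : ℝ} (hy : y ≠ 0)
    (hyR : ‖y‖ < R / 2) (hl : l ≤ ‖y‖ / 2) :
    Metric.closedBall y l ⊆ Metric.ball 0 R \ {0} := by
  intro x hx
  obtain ⟨h1, h2⟩ := norm_bounds_of_mem_closedBall hx hl
  have := norm_pos_iff.2 hy
  refine ⟨?_, norm_pos_iff.1 (by linarith)⟩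
  rw [mem_ball_zero_iff]
  linarith

/-- A pointwise lower bound extends to a ball of comparable radius. -/
theorem HasWeakLaplacianOn.exists_forall_closedBall_ge {R A C c : ℝ}
    (hw : HasWeakLaplacianOn u h (Metric.ball 0 R \ {0}))
    (hpos : ∀ x ∈ Metric.ball 0 R \ {0}, 0 < u x) (hA1 : 1 ≤ A)
    (hA : ∀ x ∈ Metric.ball 0 R \ {0}, |h x| < A * (‖gradient u x‖ / ‖x‖ + u x / ‖x‖ ^ 2))
    (hC0 : 0 < C) (hC : ∀ x ∈ Metric.ball 0 R \ {0}, ‖x‖ ^ β * u x ≤ C) (hc : 0 < c) :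
    ∃ δ > 0, δ ≤ 1 / 6 ∧ ∀ x₀ : EuclideanSpace ℝ (Fin N), x₀ ≠ 0 → ‖x₀‖ < R / 4 →
      c * ‖x₀‖ ^ (-β) ≤ u x₀ →
      ∀ x ∈ Metric.closedBall x₀ (δ * ‖x₀‖), c / 2 * ‖x₀‖ ^ (-β) ≤ u x := by
  set G : ℝ := (8 * N * A + 1) * (C * 2 ^ |β|) * (2 ^ |β| * 2) with hG
  have hG0 : 0 < G := by positivity
  refine ⟨min (1 / 6) (c / (2 * G)), by positivity, min_le_left _ _, fun x₀ hx₀ hx₀R hux₀ x hx => ?_⟩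
  set δ : ℝ := min (1 / 6) (c / (2 * G)) with hδ
  have hδ6 : δ ≤ 1 / 6 := min_le_left _ _
  have hδG : δ * G ≤ c / 2 := by
    have := mul_le_mul_of_nonneg_right (min_le_right (1 / 6) (c / (2 * G))) hG0.le
    calc _ ≤ _ := this
      _ = c / 2 := by field_simp
  have hn : 0 < ‖x₀‖ := norm_pos_iff.2 hx₀
  have hl : δ * ‖x₀‖ ≤ ‖x₀‖ / 2 := by nlinarith
  have hsub := closedBall_subset_punctured hx₀ (by linarith : ‖x₀‖ < R / 2) hl
  have hD : IsOpen (Metric.ball (0 : EuclideanSpace ℝ (Fin N)) R \ {0}) :=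
    isOpen_punctured Metric.isOpen_ball
  have hgrad : ∀ z ∈ Metric.closedBall x₀ (δ * ‖x₀‖),
      ‖InnerProductSpace.toDual ℝ _ (gradient u z)‖ ≤ G * (‖x₀‖ ^ (-β) / ‖x₀‖) := by
    intro z hz
    obtain ⟨h1, h2⟩ := norm_bounds_of_mem_closedBall hz hl
    have hz0 : 0 < ‖z‖ := by linarith
    rw [LinearIsometryEquiv.norm_map]
    refine (hw.norm_gradient_le_rpow hpos hA1 hA hC0 hC (hsub hz).2 (by linarith)).trans ?_
    have h3 : ‖z‖ ^ (-β) ≤ 2 ^ |β| * ‖x₀‖ ^ (-β) := by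
      have := rpow_le_of_ratio (p := -β) hn h1 (by linarith); rwa [abs_neg] at this
    have h4 : ‖z‖ ^ (-β) / ‖z‖ ≤ 2 ^ |β| * ‖x₀‖ ^ (-β) / (‖x₀‖ / 2) := by gcongr
    calc _ ≤ (8 * N * A + 1) * (C * 2 ^ |β|) * (2 ^ |β| * ‖x₀‖ ^ (-β) / (‖x₀‖ / 2)) := by gcongr
      _ = _ := by rw [hG]; field_simp
  have hmv := (convex_closedBall x₀ (δ * ‖x₀‖)).norm_image_sub_le_of_norm_hasFDerivWithin_le
    (fun z hz => (hasGradientAt_of_contDiffOn hD hw.contDiffOn (hsub hz)).hasFDerivAt.hasFDerivWithinAt)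
    hgrad (Metric.mem_closedBall_self (by positivity)) hx
  have h5 : G * (‖x₀‖ ^ (-β) / ‖x₀‖) * ‖x - x₀‖ ≤ c / 2 * ‖x₀‖ ^ (-β) := by
    rw [mem_closedBall_iff_norm] at hx
    calc _ ≤ G * (‖x₀‖ ^ (-β) / ‖x₀‖) * (δ * ‖x₀‖) := by gcongr
      _ = δ * G * ‖x₀‖ ^ (-β) := by field_simp
      _ ≤ _ := by gcongr
  rw [Real.norm_eq_abs] at hmv
  have := (abs_le.1 hmv).1
  linarith

/-- Expansion of positivity: a lower bound on a ball yields one on the doubled ball. -/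
theorem HasWeakLaplacianOn.expansion_of_positivity {R A k μ l : ℝ}
    (hw : HasWeakLaplacianOn u h (Metric.ball 0 R \ {0}))
    (hpos : ∀ x ∈ Metric.ball 0 R \ {0}, 0 < u x) (hA1 : 1 ≤ A)
    (hA : ∀ x ∈ Metric.ball 0 R \ {0}, |h x| < A * (‖gradient u x‖ / ‖x‖ + u x / ‖x‖ ^ 2))
    (hk : N + A + 1 ≤ k) {y : EuclideanSpace ℝ (Fin N)} (hyR : ‖y‖ < R / 2)
    (hl0 : 0 < l) (hl : l ≤ ‖y‖ / 6) (hμ : 0 < μ) (hball : ∀ x ∈ Metric.closedBall y l, μ ≤ u x) :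
    ∀ x ∈ Metric.closedBall y (2 * l), (4 ^ (-k) - 9 ^ (-k)) * μ ≤ u x := by
  have hk0 : 0 < k := by have : (0 : ℝ) ≤ N := by positivity
                         linarith
  have hy : y ≠ 0 := norm_pos_iff.1 (by linarith)
  have hD : IsOpen (Metric.ball (0 : EuclideanSpace ℝ (Fin N)) R \ {0}) :=
    isOpen_punctured Metric.isOpen_ball
  have hsub := closedBall_subset_punctured hy hyR (by linarith : 3 * l ≤ ‖y‖ / 2)
  set P : ℝ → ℝ := fun s => μ * ((s / l ^ 2) ^ (-k) - 9 ^ (-k)) with hP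
  have hd1 : ∀ s ∈ Set.Ioi (0 : ℝ), HasDerivAt P
      (μ * (1 / l ^ 2 * (-k) * (s / l ^ 2) ^ (-k - 1))) s := fun s hs => by
    have hs' : s / l ^ 2 ≠ 0 := (div_pos hs (by positivity)).ne'
    exact ((((hasDerivAt_id s).div_const (l ^ 2)).rpow_const (Or.inl hs')).sub_const _).const_mul μ
  have hd2 : ∀ s ∈ Set.Ioi (0 : ℝ), HasDerivAt
      (fun s => μ * (1 / l ^ 2 * (-k) * (s / l ^ 2) ^ (-k - 1)))
      (μ * (1 / l ^ 2 * (-k) * (1 / l ^ 2 * (-k - 1) * (s / l ^ 2) ^ (-k - 1 - 1)))) s :=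
    fun s hs => by
    have hs' : s / l ^ 2 ≠ 0 := (div_pos hs (by positivity)).ne'
    exact ((((hasDerivAt_id s).div_const (l ^ 2)).rpow_const (Or.inl hs')).const_mul _).const_mul μ
  have hc2 : ContinuousOn (fun s => μ * (1 / l ^ 2 * (-k) *
      (1 / l ^ 2 * (-k - 1) * (s / l ^ 2) ^ (-k - 1 - 1)))) (Set.Ioi (0 : ℝ)) := by
    refine continuousOn_const.mul (continuousOn_const.mul (continuousOn_const.mul ?_))
    exact (continuousOn_id.div_const _).rpow_const fun s hs =>
      Or.inl (div_pos hs (by positivity)).ne'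
  obtain ⟨hψ, hψg⟩ := HasWeakLaplacianOn.comp_norm_sq isOpen_Ioi y hd1 hd2 hc2
  set K : Set (EuclideanSpace ℝ (Fin N)) :=
    Metric.closedBall y (3 * l) ∩ {x | l ≤ ‖x - y‖} with hKdef
  have hKc : IsCompact K := (isCompact_closedBall _ _).inter_right
    (isClosed_le continuous_const (by fun_prop))
  have hKD : K ⊆ (Metric.ball 0 R \ {0}) ∩ {x | ‖x - y‖ ^ 2 ∈ Set.Ioi (0 : ℝ)} := fun x hx =>
    ⟨hsub hx.1, pow_pos (hl0.trans_le hx.2) 2⟩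
  have hDK : IsOpen ((Metric.ball 0 R \ {0}) ∩
      {x : EuclideanSpace ℝ (Fin N) | ‖x - y‖ ^ 2 ∈ Set.Ioi (0 : ℝ)}) :=
    hD.inter (isOpen_Ioi.preimage (by fun_prop))
  have hdiff := (hw.mono Set.inter_subset_left).sub hDK (hψ.mono Set.inter_subset_right)
  have hmain : ∀ x ∈ K, P (‖x - y‖ ^ 2) ≤ u x := by
    by_contra! hcon
    obtain ⟨x₂, hx₂K, hx₂⟩ := hcon
    obtain ⟨x₁, hx₁K, hmin⟩ := hKc.exists_isMinOn ⟨x₂, hx₂K⟩ (hdiff.contDiffOn.continuousOn.mono hKD)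
    have hneg : u x₁ - P (‖x₁ - y‖ ^ 2) < 0 :=
      lt_of_le_of_lt (hmin hx₂K) (by linarith : u x₂ - P (‖x₂ - y‖ ^ 2) < 0)
    have hux₁ := hpos x₁ (hsub hx₁K.1)
    have hlow : l < ‖x₁ - y‖ := by
      refine lt_of_le_of_ne hx₁K.2 fun heq => ?_
      have h1 := hball x₁ (by rw [mem_closedBall_iff_norm]; exact heq.ge)
      have h2 : P (‖x₁ - y‖ ^ 2) = μ * (1 - 9 ^ (-k)) := by
        simp only [hP]; rw [← heq, div_self (by positivity), one_rpow]
      have h3 : (0 : ℝ) < 9 ^ (-k) := by positivity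
      nlinarith
    have hhigh : ‖x₁ - y‖ < 3 * l := by
      refine lt_of_le_of_ne (mem_closedBall_iff_norm.1 hx₁K.1) fun heq => ?_
      have h2 : P (‖x₁ - y‖ ^ 2) = 0 := by
        simp only [hP]
        rw [heq, show (3 * l) ^ 2 / l ^ 2 = 9 by field_simp; norm_num, sub_self, mul_zero]
      linarith
    have hloc : IsLocalMin (fun x => u x - P (‖x - y‖ ^ 2)) x₁ := by
      have hopen : IsOpen {x : EuclideanSpace ℝ (Fin N) | l < ‖x - y‖ ∧ ‖x - y‖ < 3 * l} :=
        isOpen_Ioo.preimage (by fun_prop : Continuous fun x : EuclideanSpace ℝ (Fin N) => ‖x - y‖)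
      filter_upwards [hopen.mem_nhds ⟨hlow, hhigh⟩] with x hx
      exact hmin ⟨mem_closedBall_iff_norm.2 hx.2.le, hx.1.le⟩
    have hlap := hdiff.nonneg_of_isLocalMin hDK (hKD hx₁K) hloc
    have hug := hasGradientAt_of_contDiffOn hD hw.contDiffOn (hsub hx₁K.1)
    have hz := hloc.hasFDerivAt_eq_zero
      (hug.hasFDerivAt.sub (hψg x₁ (hKD hx₁K).2).hasFDerivAt)
    have hgrad := (InnerProductSpace.toDual ℝ (EuclideanSpace ℝ (Fin N))).injective (sub_eq_zero.1 hz)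
    have hbound := hA x₁ (hsub hx₁K.1)
    set t : ℝ := ‖x₁ - y‖ with ht
    have ht0 : 0 < t := hl0.trans hlow
    set σ : ℝ := t ^ 2 / l ^ 2 with hσ
    have hσ0 : 0 < σ := by positivity
    have hσ9 : σ ≤ 9 := by
      rw [hσ, div_le_iff₀ (by positivity)]
      nlinarith
    set Z : ℝ := σ ^ (-k - 1) with hZ
    have hZ0 : 0 < Z := rpow_pos_of_pos hσ0 _
    have z1 : σ ^ (-k - 1 - 1) = Z / σ := by rw [rpow_sub_one hσ0.ne']
    have z2 : σ ^ (-k) = Z * σ := by rw [hZ, ← rpow_add_one hσ0.ne']; congr 1; ring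
    have hx₁l : 3 * l ≤ ‖x₁‖ := by
      have := (norm_bounds_of_mem_closedBall hx₁K.1 (by linarith : 3 * l ≤ ‖y‖ / 2)).1
      linarith
    have hgn : ‖gradient u x₁‖ ≤ 6 * k * μ * Z / l := by
      rw [hgrad, norm_smul, Real.norm_eq_abs, show 2 * (μ * (1 / l ^ 2 * -k * Z)) =
        -(2 * μ * k * Z / l ^ 2) by ring, abs_neg, abs_of_pos (by positivity), ← ht]
      calc _ ≤ 2 * μ * k * Z / l ^ 2 * (3 * l) := by gcongr
        _ = _ := by field_simp; norm_num
    have hun : u x₁ ≤ 9 * μ * Z := by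
      have h3 : (0 : ℝ) < 9 ^ (-k) := by positivity
      have h4 : P (t ^ 2) ≤ μ * (Z * σ) := by
        simp only [hP]
        rw [← hσ, z2]
        nlinarith
      have h5 : μ * (Z * σ) ≤ μ * (Z * 9) := by gcongr
      linarith
    have hb2 : |h x₁| < A * (2 * k + 1) * (μ * Z / l ^ 2) := by
      refine hbound.trans_le ?_
      calc _ ≤ A * (6 * k * μ * Z / l / (3 * l) + 9 * μ * Z / (3 * l) ^ 2) := by gcongr
        _ = _ := by field_simp; ring
    have hval : 4 * t ^ 2 * (μ * (1 / l ^ 2 * -k * (1 / l ^ 2 * (-k - 1) * (Z / σ))))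
        + 2 * N * (μ * (1 / l ^ 2 * -k * Z)) = (4 * k * (k + 1) - 2 * N * k) * (μ * Z / l ^ 2) := by
      have : t ^ 2 = σ * l ^ 2 := by rw [hσ]; field_simp
      rw [this]; field_simp; ring
    rw [z1, hval] at hlap
    have hcoef : A * (2 * k + 1) ≤ 4 * k * (k + 1) - 2 * N * k := by
      have : (0 : ℝ) ≤ N := by positivity
      nlinarith
    have := mul_le_mul_of_nonneg_right hcoef (by positivity : 0 ≤ μ * Z / l ^ 2)
    linarith [le_abs_self (h x₁)]
  have hmono : (4 : ℝ) ^ (-k) - 9 ^ (-k) ≤ 1 := by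
    have h1 : (4 : ℝ) ^ (-k) ≤ 1 := rpow_le_one_of_one_le_of_nonpos (by norm_num) (by linarith)
    have h3 : (0 : ℝ) < 9 ^ (-k) := by positivity
    linarith
  intro x hx
  rw [mem_closedBall_iff_norm] at hx
  rcases le_total ‖x - y‖ l with hxl | hxl
  · have := hball x (mem_closedBall_iff_norm.2 hxl)
    nlinarith
  · refine le_trans ?_ (hmain x ⟨mem_closedBall_iff_norm.2 (by linarith), hxl⟩)
    simp only [hP]
    rw [mul_comm]
    have h1 : ‖x - y‖ ^ 2 / l ^ 2 ≤ 4 := by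
      rw [div_le_iff₀ (by positivity)]
      nlinarith [norm_nonneg (x - y)]
    have h2 : (4 : ℝ) ^ (-k) ≤ (‖x - y‖ ^ 2 / l ^ 2) ^ (-k) :=
      rpow_le_rpow_of_nonpos (div_pos (pow_pos (hl0.trans_le hxl) 2) (by positivity)) h1 (by linarith)
    gcongr

/-- Two points of a sphere in dimension at least two are joined by a great circle arc. -/
theorem exists_great_circle (hN : 2 ≤ N) {a b : EuclideanSpace ℝ (Fin N)} (ha : a ≠ 0)
    (hab : ‖b‖ = ‖a‖) : ∃ (e : EuclideanSpace ℝ (Fin N)) (φ : ℝ), ‖e‖ = ‖a‖ ∧ ⟪a, e⟫ = 0 ∧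
      0 ≤ φ ∧ φ ≤ π ∧ b = Real.cos φ • a + Real.sin φ • e := by
  have hn : 0 < ‖a‖ := norm_pos_iff.2 ha
  set p : ℝ := ⟪a, b⟫ / ‖a‖ ^ 2 with hp
  set w : EuclideanSpace ℝ (Fin N) := b - p • a with hw
  have haw : ⟪a, w⟫ = 0 := by
    rw [hw, inner_sub_right, inner_smul_right, real_inner_self_eq_norm_sq, hp]
    field_simp
    ring
  have hb : b = p • a + w := by rw [hw]; abel
  have hsq : ‖b‖ ^ 2 = p ^ 2 * ‖a‖ ^ 2 + ‖w‖ ^ 2 := by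
    rw [hb, norm_add_sq_real, inner_smul_left, haw, norm_smul, mul_pow, Real.norm_eq_abs, sq_abs]
    simp
  obtain ⟨e₀, he₀, hae₀, hwe₀⟩ : ∃ e₀ : EuclideanSpace ℝ (Fin N), ‖e₀‖ = 1 ∧ ⟪a, e₀⟫ = 0 ∧
      w = ‖w‖ • e₀ := by
    rcases eq_or_ne w 0 with h0 | h0
    · have hfr : Module.finrank ℝ (ℝ ∙ a)ᗮ ≠ 0 := by
        have h1 := Submodule.finrank_add_finrank_orthogonal (ℝ ∙ a)
        rw [finrank_span_singleton ha, finrank_euclideanSpace_fin] at h1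
        omega
      have := Module.nontrivial_of_finrank_pos (Nat.pos_of_ne_zero hfr)
      obtain ⟨v, hv⟩ := exists_ne (0 : (ℝ ∙ a)ᗮ)
      have hv0 : ‖(v : EuclideanSpace ℝ (Fin N))‖ ≠ 0 :=
        norm_ne_zero_iff.2 fun h => hv (Subtype.ext h)
      refine ⟨‖(v : EuclideanSpace ℝ (Fin N))‖⁻¹ • (v : EuclideanSpace ℝ (Fin N)), ?_, ?_, ?_⟩
      · rw [norm_smul, norm_inv, norm_norm, inv_mul_cancel₀ hv0]
      · rw [inner_smul_right, Submodule.mem_orthogonal_singleton_iff_inner_right.1 v.2, mul_zero]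
      · rw [h0, norm_zero, zero_smul]
    · refine ⟨‖w‖⁻¹ • w, ?_, ?_, ?_⟩
      · rw [norm_smul, norm_inv, norm_norm, inv_mul_cancel₀ (norm_ne_zero_iff.2 h0)]
      · rw [inner_smul_right, haw, mul_zero]
      · rw [smul_smul, mul_inv_cancel₀ (norm_ne_zero_iff.2 h0), one_smul]
  have hpw : (‖w‖ / ‖a‖) ^ 2 = 1 - p ^ 2 := by
    rw [hab] at hsq
    rw [div_pow, div_eq_iff (by positivity)]
    linarith
  have hp1 : |p| ≤ 1 := by
    rw [← sq_le_one_iff_abs_le_one]; nlinarith [sq_nonneg (‖w‖ / ‖a‖)]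
  rw [abs_le] at hp1
  refine ⟨‖a‖ • e₀, Real.arccos p, ?_, ?_, Real.arccos_nonneg p, Real.arccos_le_pi p, ?_⟩
  · rw [norm_smul, norm_norm, he₀, mul_one]
  · rw [inner_smul_right, hae₀, mul_zero]
  · rw [Real.cos_arccos hp1.1 hp1.2, Real.sin_arccos, ← hpw, Real.sqrt_sq (by positivity), smul_smul,
      div_mul_cancel₀ _ hn.ne', ← hwe₀]
    exact hb

/-- Harnack type propagation of a lower bound along spheres centred at the origin. -/
theorem HasWeakLaplacianOn.exists_forall_sphere_ge (hN : 2 ≤ N) {R A C c : ℝ}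
    (hw : HasWeakLaplacianOn u h (Metric.ball 0 R \ {0}))
    (hpos : ∀ x ∈ Metric.ball 0 R \ {0}, 0 < u x) (hA1 : 1 ≤ A)
    (hA : ∀ x ∈ Metric.ball 0 R \ {0}, |h x| < A * (‖gradient u x‖ / ‖x‖ + u x / ‖x‖ ^ 2))
    (hC0 : 0 < C) (hC : ∀ x ∈ Metric.ball 0 R \ {0}, ‖x‖ ^ β * u x ≤ C) (hc : 0 < c) :
    ∃ c' > 0, ∀ x₀ : EuclideanSpace ℝ (Fin N), x₀ ≠ 0 → ‖x₀‖ < R / 4 →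
      c * ‖x₀‖ ^ (-β) ≤ u x₀ → ∀ z, ‖z‖ = ‖x₀‖ → c' * ‖x₀‖ ^ (-β) ≤ u z := by
  obtain ⟨δ, hδ0, hδ6, hδ⟩ := hw.exists_forall_closedBall_ge hpos hA1 hA hC0 hC hc
  set k : ℝ := N + A + 1 with hk
  have hk0 : 0 < k := by positivity
  set ε : ℝ := 4 ^ (-k) - 9 ^ (-k) with hε
  have hε0 : 0 < ε := sub_pos.2 (rpow_lt_rpow_of_neg (by norm_num) (by norm_num) (by linarith))
  obtain ⟨n, hn⟩ := exists_nat_gt (2 * π / δ)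
  have hn0 : (0 : ℝ) < n := lt_trans (by positivity) hn
  refine ⟨ε ^ n * (c / 2), by positivity, fun x₀ hx₀ hx₀R hux₀ z hz => ?_⟩
  obtain ⟨e, φ, he, hae, hφ0, hφπ, rfl⟩ := exists_great_circle hN hx₀ hz
  have hx0 : 0 < ‖x₀‖ := norm_pos_iff.2 hx₀
  set γ : ℝ → EuclideanSpace ℝ (Fin N) := fun t => Real.cos t • x₀ + Real.sin t • e with hγ
  have hγn : ∀ t, ‖γ t‖ = ‖x₀‖ := by
    intro t
    have : ‖γ t‖ ^ 2 = ‖x₀‖ ^ 2 := by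
      simp only [hγ]
      rw [norm_add_sq_real, inner_smul_left, inner_smul_right, hae, norm_smul, norm_smul, he,
        mul_pow, mul_pow, Real.norm_eq_abs, Real.norm_eq_abs, sq_abs, sq_abs]
      linear_combination ‖x₀‖ ^ 2 * Real.sin_sq_add_cos_sq t
    exact (pow_left_inj₀ (norm_nonneg _) (norm_nonneg _) two_ne_zero).1 this
  have hγd : ∀ s t, ‖γ s - γ t‖ ≤ 2 * |s - t| * ‖x₀‖ := by
    intro s t
    have e1 : γ s - γ t = (Real.cos s - Real.cos t) • x₀ + (Real.sin s - Real.sin t) • e := by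
      simp only [hγ, sub_smul]; abel
    rw [e1]
    refine (norm_add_le _ _).trans ?_
    rw [norm_smul, norm_smul, he, Real.norm_eq_abs, Real.norm_eq_abs]
    have h1 := Real.abs_cos_sub_cos_le s t
    have h2 := Real.abs_sin_sub_sin_le s t
    nlinarith
  have hind : ∀ i : ℕ, ∀ x ∈ Metric.closedBall (γ (i * (φ / n))) (δ * ‖x₀‖),
      ε ^ i * (c / 2) * ‖x₀‖ ^ (-β) ≤ u x := by
    intro i
    induction i with
    | zero =>
      have : γ ((0 : ℕ) * (φ / n)) = x₀ := by simp [hγ]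
      rw [this]
      simpa using hδ x₀ hx₀ hx₀R hux₀
    | succ i ih =>
      intro x hx
      have hstep := hw.expansion_of_positivity hpos hA1 hA (k := k) le_rfl
        (y := γ (i * (φ / n))) (by rw [hγn]; linarith) (by positivity)
        (by rw [hγn]; nlinarith) (by positivity) ih x ?_
      · calc _ = ε * (ε ^ i * (c / 2) * ‖x₀‖ ^ (-β)) := by ring
          _ ≤ _ := hstep
      · rw [mem_closedBall_iff_norm] at hx ⊢
        have h1 := hγd ((i + 1 : ℕ) * (φ / n)) (i * (φ / n))
        have h2 : 2 * |((i + 1 : ℕ) : ℝ) * (φ / n) - i * (φ / n)| ≤ δ := by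
          rw [show ((i + 1 : ℕ) : ℝ) * (φ / n) - i * (φ / n) = φ / n by push_cast; ring,
            abs_of_nonneg (by positivity), ← mul_div_assoc, div_le_iff₀ hn0]
          rw [div_lt_iff₀ hδ0] at hn
          linarith
        have h3 := mul_le_mul_of_nonneg_right h2 hx0.le
        have h4 := norm_sub_le_norm_sub_add_norm_sub x (γ ((i + 1 : ℕ) * (φ / n))) (γ (i * (φ / n)))
        linarith
  refine hind n _ ?_
  rw [mul_div_cancel₀ _ hn0.ne']
  exact Metric.mem_closedBall_self (by positivity)

end Propagation

section Dichotomy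

variable {N : ℕ} {ρ lam τ θ q β : ℝ} {Ω : Set (EuclideanSpace ℝ (Fin N))}
  {u : EuclideanSpace ℝ (Fin N) → ℝ}

theorem mul_le_rpow_iff {f c : ℝ} (hq : 1 < q) (hf : 0 < f) (hc : 0 < c) :
    f * c ≤ c ^ q ↔ f ^ (1 / (q - 1)) ≤ c := by
  have hq1 : 0 < q - 1 := by linarith
  have e : c ^ q = c ^ (q - 1) * c := by rw [← rpow_add_one hc.ne']; congr 1; ring
  rw [e, mul_le_mul_iff_left₀ hc, one_div, rpow_inv_le_iff_of_pos hf.le hc.le hq1]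

theorem rpow_le_mul_iff {f c : ℝ} (hq : 1 < q) (hf : 0 < f) (hc : 0 < c) :
    c ^ q ≤ f * c ↔ c ≤ f ^ (1 / (q - 1)) := by
  have hq1 : 0 < q - 1 := by linarith
  have e : c ^ q = c ^ (q - 1) * c := by rw [← rpow_add_one hc.ne']; congr 1; ring
  rw [e, mul_le_mul_iff_left₀ hc, one_div, le_rpow_inv_iff_of_pos hc.le hf.le hq1]

/-- A lower bound below `Λ` on two concentric spheres propagates to the annulus between them. -/
theorem IsSolutionE.le_norm_rpow_mul_of_annulus (hτ1 : τ < 1) (hq : 1 < q) (hΩ : IsOpen Ω)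
    (hu : IsSolutionE N ρ lam τ θ q Ω u) (hβ : β * (q - 1) = θ + 2)
    (hf : 0 < fRho ρ lam τ β) {r r' κ : ℝ} (hr : 0 < r) (hr' : 0 < r')
    (hΩr : Metric.closedBall 0 r' ⊆ Ω) (hκ : κ ≤ fRho ρ lam τ β ^ (1 / (q - 1)))
    (h₁ : ∀ x, ‖x‖ = r → κ ≤ ‖x‖ ^ β * u x) (h₂ : ∀ x, ‖x‖ = r' → κ ≤ ‖x‖ ^ β * u x)
    {x : EuclideanSpace ℝ (Fin N)} (hx₁ : r ≤ ‖x‖) (hx₂ : ‖x‖ ≤ r') :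
    κ ≤ ‖x‖ ^ β * u x := by
  have hK : {x : EuclideanSpace ℝ (Fin N) | r ^ 2 ≤ ‖x‖ ^ 2 ∧ ‖x‖ ^ 2 ≤ r' ^ 2} ⊆ Ω \ {0} := by
    intro y hy
    refine ⟨hΩr (mem_closedBall_zero_iff.2 (le_of_sq_le_sq hy.2 hr'.le)), ?_⟩
    rintro rfl
    have := hy.1
    simp only [norm_zero] at this
    nlinarith
  obtain ⟨y, hyK, hy⟩ := (isCompact_annulus (N := N) (r ^ 2) (r' ^ 2)).exists_isMinOn
    ⟨x, by gcongr, by gcongr⟩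
    ((continuousOn_norm_rpow_mul hu.1.1.continuousOn β).mono hK)
  refine le_trans ?_ (hy (show x ∈ _ from ⟨by gcongr, by gcongr⟩))
  change κ ≤ ‖y‖ ^ β * u y
  by_contra! hlt
  have hy1 : r < ‖y‖ := lt_of_le_of_ne (le_of_sq_le_sq hyK.1 (norm_nonneg y))
    fun e => (h₁ y e.symm).not_gt hlt
  have hy2 : ‖y‖ < r' := lt_of_le_of_ne (le_of_sq_le_sq hyK.2 hr'.le)
    fun e => (h₂ y e).not_gt hlt
  have hc : 0 < ‖y‖ ^ β * u y :=
    mul_pos (rpow_pos_of_pos (norm_pos_of_mem (hK hyK)) _) (hu.1.2 y (hK hyK))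
  have h := (hu.radial_touching hτ1 hΩ hβ (hK hyK) (Q := fun _ => ‖y‖ ^ β * u y)
    (Q' := fun _ => 0) (Q'' := fun _ => 0) isOpen_Ioi (fun s hs => hs)
    (fun s _ => hasDerivAt_const s _) (fun s _ => hasDerivAt_const s _) continuousOn_const
    (show ‖y‖ ^ 2 ∈ Set.Ioi (0 : ℝ) from by have := hr.trans hy1; exact pow_pos this 2) rfl).2 (by
      have h1 : ∀ᶠ z : EuclideanSpace ℝ (Fin N) in 𝓝 y, r < ‖z‖ :=
        continuous_norm.continuousAt.eventually (lt_mem_nhds hy1)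
      have h2 : ∀ᶠ z : EuclideanSpace ℝ (Fin N) in 𝓝 y, ‖z‖ < r' :=
        continuous_norm.continuousAt.eventually (gt_mem_nhds hy2)
      filter_upwards [h1, h2] with z hz1 hz2
      exact hy (show z ∈ _ from ⟨by gcongr, by gcongr⟩))
  simp only [mul_zero, radialOp_const hc] at h
  exact (hκ.trans ((mul_le_rpow_iff hq hf hc).1 h)).not_gt hlt

theorem IsSolutionE.exists_eventually_ge (hN : 2 ≤ N) (hτ0 : 0 ≤ τ) (hτ1 : τ < 1) (hq : 1 < q)
    (hΩ : IsOpen Ω) (h0 : 0 ∈ Ω) (hu : IsSolutionE N ρ lam τ θ q Ω u)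
    (hβ : β * (q - 1) = θ + 2) (hf : 0 < fRho ρ lam τ β)
    (hnot : ¬ Tendsto (fun x => ‖x‖ ^ β * u x) (𝓝[≠] 0) (𝓝 0)) :
    ∃ κ > 0, ∀ᶠ x in 𝓝[≠] 0, κ ≤ ‖x‖ ^ β * u x := by
  obtain ⟨R₀, hR₀, hR₀Ω⟩ := Metric.isOpen_iff.1 hΩ 0 h0
  obtain ⟨C, hC0, hC⟩ := hu.norm_rpow_mul_le hτ0 hτ1 hq hΩ hβ hR₀Ω
  have hsub : Metric.ball 0 (R₀ / 2) \ {0} ⊆ Ω \ {0} :=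
    Set.sdiff_subset_sdiff_left ((Metric.ball_subset_ball (by linarith)).trans hR₀Ω)
  have hC' : ∀ x ∈ Metric.ball 0 (R₀ / 2) \ {0}, ‖x‖ ^ β * u x ≤ C :=
    fun x hx => hC x hx.2 (mem_ball_zero_iff.1 hx.1)
  obtain ⟨A, hA1, hA⟩ := hu.abs_solLaplacian_lt hτ0 hτ1 hq hβ hC0
  have hpos : ∀ x ∈ Ω \ {0}, 0 < ‖x‖ ^ β * u x := fun x hx =>
    mul_pos (rpow_pos_of_pos (norm_pos_of_mem hx) _) (hu.1.2 x hx)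
  obtain ⟨c, hc0, hc⟩ : ∃ c > 0, ∃ᶠ x in 𝓝[≠] (0 : EuclideanSpace ℝ (Fin N)),
      c ≤ ‖x‖ ^ β * u x := by
    by_contra! hcon
    refine hnot (Metric.tendsto_nhds.2 fun ε hε => ?_)
    have hmem : Ω \ {0} ∈ 𝓝[≠] (0 : EuclideanSpace ℝ (Fin N)) :=
      Filter.inter_mem (mem_nhdsWithin_of_mem_nhds (hΩ.mem_nhds h0)) self_mem_nhdsWithin
    filter_upwards [hcon ε hε, hmem] with x hx hxΩ
    rw [Real.dist_eq, sub_zero, abs_of_pos (hpos x hxΩ)]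
    exact hx
  obtain ⟨c', hc'0, hc'⟩ := ((hu.hasWeakLaplacianOn hτ1 hΩ).mono hsub).exists_forall_sphere_ge hN
    (fun x hx => hu.1.2 x (hsub hx)) hA1 (fun x hx => hA x (hsub hx) (hC' x hx)) hC0 hC' hc0
  have key : ∀ r > 0, ∃ t, 0 < t ∧ t < r ∧ t < R₀ / 2 / 4 ∧
      ∀ z : EuclideanSpace ℝ (Fin N), ‖z‖ = t → c' ≤ ‖z‖ ^ β * u z := by
    intro r hr
    have hb : ∀ᶠ x in 𝓝[≠] (0 : EuclideanSpace ℝ (Fin N)),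
        x ∈ Metric.ball (0 : EuclideanSpace ℝ (Fin N)) (min r (R₀ / 2 / 4)) :=
      mem_nhdsWithin_of_mem_nhds (Metric.ball_mem_nhds _ (by positivity))
    obtain ⟨x, hxc, hxb, hx0⟩ := (hc.and_eventually (hb.and self_mem_nhdsWithin)).exists
    have hx0' : x ≠ 0 := hx0
    rw [mem_ball_zero_iff, lt_min_iff] at hxb
    have hn : 0 < ‖x‖ := norm_pos_iff.2 hx0'
    have flip : ∀ a b : ℝ, a ≤ ‖x‖ ^ β * b ↔ a * ‖x‖ ^ (-β) ≤ b := fun a b => by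
      rw [rpow_neg hn.le, ← div_eq_mul_inv, div_le_iff₀ (rpow_pos_of_pos hn _), mul_comm b]
    refine ⟨‖x‖, hn, hxb.1, hxb.2, fun z hz => ?_⟩
    rw [hz, flip]
    exact hc' x hx0' hxb.2 ((flip _ _).1 hxc) z hz
  obtain ⟨r', hr'0, -, hr'R, hr'⟩ := key 1 one_pos
  refine ⟨min c' (fRho ρ lam τ β ^ (1 / (q - 1))), by positivity, ?_⟩
  have hb : ∀ᶠ x in 𝓝[≠] (0 : EuclideanSpace ℝ (Fin N)),
      x ∈ Metric.ball (0 : EuclideanSpace ℝ (Fin N)) r' :=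
    mem_nhdsWithin_of_mem_nhds (Metric.ball_mem_nhds _ hr'0)
  filter_upwards [hb, self_mem_nhdsWithin] with x hx hx0
  obtain ⟨r, hr0, hrx, -, hr⟩ := key ‖x‖ (norm_pos_iff.2 hx0)
  exact hu.le_norm_rpow_mul_of_annulus hτ1 hq hΩ hβ hf hr0 hr'0
    ((Metric.closedBall_subset_ball (by linarith)).trans hR₀Ω) (min_le_right _ _)
    (fun z hz => (min_le_left _ _).trans (hr z hz))
    (fun z hz => (min_le_left _ _).trans (hr' z hz)) hrx.le (mem_ball_zero_iff.1 hx).le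

/-- Touching by a parabola in `‖x‖²` near an almost-minimum (`σ = 1`) or an almost-maximum
(`σ = -1`) of `‖x‖ ^ β * u x`. -/
theorem IsSolutionE.exists_radialOp_le (hτ1 : τ < 1) (hΩ : IsOpen Ω)
    (hu : IsSolutionE N ρ lam τ θ q Ω u) (hβ : β * (q - 1) = θ + 2) {σ m ε : ℝ}
    (hσ : σ = 1 ∨ σ = -1) (hε : 0 < ε) {x₀ : EuclideanSpace ℝ (Fin N)} (hx₀ : x₀ ≠ 0)
    (hball : Metric.ball 0 (2 * ‖x₀‖) ⊆ Ω)
    (hlow : ∀ x ∈ Metric.ball 0 (2 * ‖x₀‖) \ {0}, σ * m - ε < σ * (‖x‖ ^ β * u x))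
    (hup : σ * (‖x₀‖ ^ β * u x₀) < σ * m + ε) :
    ∃ c a b, |c - m| < ε ∧ |a| ≤ 24 * ε ∧ |b| ≤ 72 * ε ∧
      σ * radialOp ρ lam τ β c a b ≤ σ * c ^ q := by
  have hn₀ : 0 < ‖x₀‖ := norm_pos_iff.2 hx₀
  set s₀ : ℝ := ‖x₀‖ ^ 2 with hs₀
  have hs₀0 : 0 < s₀ := by positivity
  set K : Set (EuclideanSpace ℝ (Fin N)) :=
    {x | s₀ / 2 ≤ ‖x‖ ^ 2 ∧ ‖x‖ ^ 2 ≤ 3 / 2 * s₀} with hK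
  have hKb : K ⊆ Metric.ball 0 (2 * ‖x₀‖) \ {0} := by
    intro x hx
    refine ⟨?_, ?_⟩
    · rw [mem_ball_zero_iff]
      exact lt_of_pow_lt_pow_left₀ 2 (by positivity) (by nlinarith [hx.2])
    · rintro rfl
      have := hx.1
      simp only [norm_zero] at this
      linarith
  have hKΩ : K ⊆ Ω \ {0} := hKb.trans (Set.sdiff_subset_sdiff_left hball)
  have hx₀K : x₀ ∈ K := ⟨by rw [← hs₀]; linarith, by rw [← hs₀]; linarith⟩
  obtain ⟨x₁, hx₁K, hmin⟩ := (isCompact_annulus (N := N) (s₀ / 2) (3 / 2 * s₀)).exists_isMinOn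
    ⟨x₀, hx₀K⟩ (f := fun x => σ * (‖x‖ ^ β * u x) + 16 * ε * (‖x‖ ^ 2 / s₀ - 1) ^ 2)
    ((((continuousOn_norm_rpow_mul hu.1.1.continuousOn β).mono hKΩ).const_mul σ).add
      (by fun_prop : Continuous _).continuousOn)
  set t : ℝ := ‖x₁‖ ^ 2 / s₀ with ht
  set c : ℝ := ‖x₁‖ ^ β * u x₁ with hc
  have hst : ‖x₁‖ ^ 2 = t * s₀ := by rw [ht]; field_simp
  have hle : σ * c + 16 * ε * (t - 1) ^ 2 ≤ σ * (‖x₀‖ ^ β * u x₀) := by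
    have := hmin hx₀K
    simpa [← hs₀, div_self hs₀0.ne', ← ht, ← hc] using this
  have hlow₁ := hlow x₁ (hKb hx₁K)
  rw [← hc] at hlow₁
  have htsq : (t - 1) ^ 2 < 1 / 8 := by
    by_contra! hcon
    nlinarith
  have ht1 : 1 / 2 < t := by nlinarith
  have ht2 : t < 3 / 2 := by nlinarith
  have hcm : |c - m| < ε := by
    have h1 : σ * c < σ * m + ε := by nlinarith [mul_nonneg hε.le (sq_nonneg (t - 1))]
    rw [abs_lt]
    rcases hσ with rfl | rfl <;> constructor <;> linarith
  have hs1 : s₀ / 2 < ‖x₁‖ ^ 2 := by rw [hst]; nlinarith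
  have hs2 : ‖x₁‖ ^ 2 < 3 / 2 * s₀ := by rw [hst]; nlinarith
  have hcont : Continuous fun x : EuclideanSpace ℝ (Fin N) => ‖x‖ ^ 2 := by fun_prop
  have hnear : ∀ᶠ x in 𝓝 x₁, x ∈ K := by
    filter_upwards [hcont.continuousAt.eventually (lt_mem_nhds hs1),
      hcont.continuousAt.eventually (gt_mem_nhds hs2)] with x h1 h2
    exact ⟨h1.le, h2.le⟩
  have hσabs : |σ| = 1 := by rcases hσ with rfl | rfl <;> norm_num
  have hQ : ∀ s : ℝ, HasDerivAt
      (fun s => c + σ * (16 * ε) * ((t - 1) ^ 2 - (s / s₀ - 1) ^ 2))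
      (σ * (16 * ε) * -(2 * (s / s₀ - 1) * (1 / s₀))) s := fun s => by
    have := ((((((hasDerivAt_id s).div_const s₀).sub_const 1).pow 2).const_sub
      ((t - 1) ^ 2)).const_mul (σ * (16 * ε))).const_add c
    simpa using this
  have hQ' : ∀ s : ℝ, HasDerivAt (fun s => σ * (16 * ε) * -(2 * (s / s₀ - 1) * (1 / s₀)))
      (σ * (16 * ε) * -(2 * (1 / s₀) * (1 / s₀))) s := fun s => by
    exact ((((((hasDerivAt_id s).div_const s₀).sub_const 1).const_mul 2).mul_const
      (1 / s₀)).neg).const_mul (σ * (16 * ε))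
  have htouch := hu.radial_touching hτ1 hΩ hβ (hKΩ hx₁K) isOpen_Ioi (fun s hs => hs)
    (fun s _ => hQ s) (fun s _ => hQ' s) continuousOn_const
    (show ‖x₁‖ ^ 2 ∈ Set.Ioi (0 : ℝ) from lt_trans (by positivity) hs1) (by simp [← ht, ← hc])
  simp only [← ht, sub_self, mul_zero, add_zero] at htouch
  refine ⟨c, ‖x₁‖ ^ 2 * (σ * (16 * ε) * -(2 * (t - 1) * (1 / s₀))),
    (‖x₁‖ ^ 2) ^ 2 * (σ * (16 * ε) * -(2 * (1 / s₀) * (1 / s₀))), hcm, ?_, ?_, ?_⟩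
  · have e : ‖x₁‖ ^ 2 * (σ * (16 * ε) * -(2 * (t - 1) * (1 / s₀)))
        = σ * (-(32 * ε * (t * (t - 1)))) := by rw [hst]; field_simp; ring
    rw [e, abs_mul, hσabs, one_mul, abs_neg, abs_mul, abs_of_pos (by positivity : 0 < 32 * ε)]
    have : |t * (t - 1)| ≤ 3 / 4 := by rw [abs_le]; constructor <;> nlinarith
    nlinarith
  · have e : (‖x₁‖ ^ 2) ^ 2 * (σ * (16 * ε) * -(2 * (1 / s₀) * (1 / s₀)))
        = σ * (-(32 * ε * t ^ 2)) := by rw [hst]; field_simp; ring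
    rw [e, abs_mul, hσabs, one_mul, abs_neg, abs_of_pos (by positivity)]
    have : t ^ 2 ≤ 9 / 4 := by nlinarith
    nlinarith
  · rcases hσ with rfl | rfl
    · simp only [one_mul]
      simp only [one_mul] at htouch hmin
      refine htouch.2 ?_
      filter_upwards [hnear] with x hx
      have := hmin hx
      simp only [Set.mem_ofPred_eq, ← ht, ← hc] at this
      linarith
    · have := htouch.1 (by
        filter_upwards [hnear] with x hx
        have := hmin hx
        simp only [Set.mem_ofPred_eq, ← ht, ← hc] at this
        linarith)
      linarith

theorem eventually_radialOp_sub_pos (hτ1 : τ < 1) {σ m : ℝ} (hm : 0 < m)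
    (h : 0 < σ * (fRho ρ lam τ β * m - m ^ q)) :
    ∃ δ > 0, ∀ c a b, |c - m| < δ → |a| < δ → |b| < δ →
      0 < σ * (radialOp ρ lam τ β c a b - c ^ q) := by
  have hcont : ContinuousAt (fun p : ℝ × ℝ × ℝ =>
      σ * (radialOp ρ lam τ β p.1 p.2.1 p.2.2 - p.1 ^ q)) (m, 0, 0) := by
    unfold radialOp
    have h1 : ContinuousAt (fun p : ℝ × ℝ × ℝ => p.1 ^ τ) (m, 0, 0) :=
      continuousAt_fst.rpow_const (Or.inl hm.ne')
    have h2 : ContinuousAt (fun p : ℝ × ℝ × ℝ => p.1 ^ q) (m, 0, 0) :=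
      continuousAt_fst.rpow_const (Or.inl hm.ne')
    have h3 : ContinuousAt (fun p : ℝ × ℝ × ℝ => |2 * p.2.1 - β * p.1| ^ (1 - τ)) (m, 0, 0) :=
      ContinuousAt.rpow_const (by fun_prop) (Or.inr (by linarith))
    fun_prop
  have hpos := hcont.eventually (lt_mem_nhds (a := 0) (by simpa [radialOp_const hm] using h))
  obtain ⟨δ, hδ, hball⟩ := Metric.eventually_nhds_iff.1 hpos
  refine ⟨δ, hδ, fun c a b hc ha hb => hball (y := (c, a, b)) ?_⟩
  simp [Prod.dist_eq, Real.dist_eq, hc, ha, hb]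

theorem IsSolutionE.nonpos_of_cluster_value (hτ1 : τ < 1) (hΩ : IsOpen Ω) (h0 : 0 ∈ Ω)
    (hu : IsSolutionE N ρ lam τ θ q Ω u) (hβ : β * (q - 1) = θ + 2) {σ m : ℝ}
    (hσ : σ = 1 ∨ σ = -1) (hm : 0 < m)
    (hlow : ∀ ε > 0, ∀ᶠ x in 𝓝[≠] 0, σ * m - ε < σ * (‖x‖ ^ β * u x))
    (hup : ∀ ε > 0, ∃ᶠ x in 𝓝[≠] 0, σ * (‖x‖ ^ β * u x) < σ * m + ε) :
    σ * (fRho ρ lam τ β * m - m ^ q) ≤ 0 := by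
  by_contra! hcon
  obtain ⟨δ, hδ, hpos⟩ := eventually_radialOp_sub_pos hτ1 hm hcon
  have hε : 0 < δ / 100 := by positivity
  have hev := (eventually_nhdsWithin_iff.1 (hlow _ hε)).and (hΩ.mem_nhds h0)
  obtain ⟨r, hr, hball⟩ := Metric.eventually_nhds_iff_ball.1 hev
  have hb : ∀ᶠ x in 𝓝[≠] (0 : EuclideanSpace ℝ (Fin N)),
      x ∈ Metric.ball (0 : EuclideanSpace ℝ (Fin N)) (r / 2) :=
    mem_nhdsWithin_of_mem_nhds (Metric.ball_mem_nhds _ (by positivity))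
  obtain ⟨x₀, hx₀up, hx₀b, hx₀⟩ :=
    ((hup _ hε).and_eventually (hb.and self_mem_nhdsWithin)).exists
  rw [mem_ball_zero_iff] at hx₀b
  have hsub : Metric.ball (0 : EuclideanSpace ℝ (Fin N)) (2 * ‖x₀‖) ⊆ Metric.ball 0 r :=
    Metric.ball_subset_ball (by linarith)
  obtain ⟨c, a, b, hc, ha, hb, hle⟩ := hu.exists_radialOp_le hτ1 hΩ hβ hσ hε hx₀
    (fun x hx => (hball x (hsub hx)).2) (fun x hx => (hball x (hsub hx.1)).1 hx.2) hx₀up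
  have := hpos c a b (by linarith) (by linarith) (by linarith)
  linarith

theorem IsSolutionE.tendsto_norm_rpow_mul (hN : 2 ≤ N) (hτ0 : 0 ≤ τ) (hτ1 : τ < 1) (hq : 1 < q)
    (hΩ : IsOpen Ω) (h0 : 0 ∈ Ω) (hu : IsSolutionE N ρ lam τ θ q Ω u)
    (hβ : β * (q - 1) = θ + 2) (hf : 0 < fRho ρ lam τ β)
    (hnot : ¬ Tendsto (fun x => ‖x‖ ^ β * u x) (𝓝[≠] 0) (𝓝 0)) :
    Tendsto (fun x => ‖x‖ ^ β * u x) (𝓝[≠] 0) (𝓝 (fRho ρ lam τ β ^ (1 / (q - 1)))) := by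
  obtain ⟨κ, hκ, hge⟩ := hu.exists_eventually_ge hN hτ0 hτ1 hq hΩ h0 hβ hf hnot
  obtain ⟨R, hR, hRΩ⟩ := Metric.isOpen_iff.1 hΩ 0 h0
  obtain ⟨C, hC0, hC⟩ := hu.norm_rpow_mul_le hτ0 hτ1 hq hΩ hβ hRΩ
  have hle : ∀ᶠ x in 𝓝[≠] (0 : EuclideanSpace ℝ (Fin N)), ‖x‖ ^ β * u x ≤ C := by
    filter_upwards [self_mem_nhdsWithin, mem_nhdsWithin_of_mem_nhds
      (Metric.ball_mem_nhds (0 : EuclideanSpace ℝ (Fin N)) (half_pos hR))] with x hx hxb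
    exact hC x hx (mem_ball_zero_iff.1 hxb)
  have : Nonempty (Fin N) := ⟨⟨0, by omega⟩⟩
  have : NeBot (𝓝[≠] (0 : EuclideanSpace ℝ (Fin N))) := Module.punctured_nhds_neBot ℝ _ _
  have hbb : IsBoundedUnder (· ≥ ·) (𝓝[≠] (0 : EuclideanSpace ℝ (Fin N)))
      fun x => ‖x‖ ^ β * u x := ⟨κ, hge⟩
  have hba : IsBoundedUnder (· ≤ ·) (𝓝[≠] (0 : EuclideanSpace ℝ (Fin N)))
      fun x => ‖x‖ ^ β * u x := ⟨C, hle⟩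
  have hκl : κ ≤ liminf (fun x => ‖x‖ ^ β * u x) (𝓝[≠] (0 : EuclideanSpace ℝ (Fin N))) :=
    le_liminf_of_le hba.isCoboundedUnder_ge hge
  have hls := hκl.trans (liminf_le_limsup hba hbb)
  refine tendsto_of_le_liminf_of_limsup_le ?_ ?_ hba hbb
  · rw [← mul_le_rpow_iff hq hf (hκ.trans_le hκl)]
    have := hu.nonpos_of_cluster_value hτ1 hΩ h0 hβ (Or.inl rfl) (hκ.trans_le hκl)
      (fun ε hε => by
        filter_upwards [eventually_lt_of_lt_liminf (sub_lt_self _ hε) hbb] with x hx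
        simpa using hx)
      (fun ε hε => (frequently_lt_of_liminf_lt hba.isCoboundedUnder_ge
        (lt_add_of_pos_right _ hε)).mono fun x hx => by simpa using hx)
    linarith
  · rw [← rpow_le_mul_iff hq hf (hκ.trans_le hls)]
    have := hu.nonpos_of_cluster_value hτ1 hΩ h0 hβ (Or.inr rfl) (hκ.trans_le hls)
      (fun ε hε => by
        filter_upwards [eventually_lt_of_limsup_lt (lt_add_of_pos_right _ hε) hba] with x hx
        linarith)
      (fun ε hε => (frequently_lt_of_lt_limsup hbb.isCoboundedUnder_le
        (sub_lt_self _ hε)).mono fun x hx => by linarith)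
    linarith

end Dichotomy

/-- If `f_ρ(β) > 0`, then every positive solution `u` of (E) in `Ω \ {0}`
satisfies either `|x|^β u(x) → 0` or `u(x)/U_{ρ,β}(x) → 1` as `|x| → 0`. -/
theorem stmt7_dichotomy
    (N : ℕ) (hN : 2 ≤ N) (ρ lam τ θ q : ℝ)
    (hτ0 : 0 ≤ τ) (hτ1 : τ < 1) (hq : 1 < q)
    (Ω : Set (EuclideanSpace ℝ (Fin N))) (hΩ : IsOpen Ω) (h0 : (0 : EuclideanSpace ℝ (Fin N)) ∈ Ω)
    (hf : 0 < fRho ρ lam τ ((θ + 2) / (q - 1)))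
    (u : EuclideanSpace ℝ (Fin N) → ℝ)
    (hu : IsSolutionE N ρ lam τ θ q Ω u) :
    Filter.Tendsto (fun x : EuclideanSpace ℝ (Fin N) => ‖x‖ ^ ((θ + 2) / (q - 1)) * u x)
      (𝓝[≠] (0 : EuclideanSpace ℝ (Fin N))) (𝓝 0) ∨
    Filter.Tendsto (fun x : EuclideanSpace ℝ (Fin N) =>
        u x / ((fRho ρ lam τ ((θ + 2) / (q - 1))) ^ (1 / (q - 1)) *
          ‖x‖ ^ (-((θ + 2) / (q - 1)))))
      (𝓝[≠] (0 : EuclideanSpace ℝ (Fin N))) (𝓝 1) := by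
  have hβ : (θ + 2) / (q - 1) * (q - 1) = θ + 2 := div_mul_cancel₀ _ (by linarith)
  refine or_iff_not_imp_left.2 fun hnot => ?_
  have h := hu.tendsto_norm_rpow_mul hN hτ0 hτ1 hq hΩ h0 hβ hf hnot
  have hΛ := (rpow_pos_of_pos hf (1 / (q - 1))).ne'
  have h1 := h.div_const (fRho ρ lam τ ((θ + 2) / (q - 1)) ^ (1 / (q - 1)))
  rw [div_self hΛ] at h1
  refine h1.congr fun x => ?_
  rw [rpow_neg (norm_nonneg x), ← div_eq_mul_inv, div_div_eq_mul_div, mul_comm]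

end
end

section
/- Assume β < 0 and f_ρ(β) > 0, where Case [N0], Case [N1] or Case [N2] holds; in Case [N2] assume in addition β < ϖ1. Then every positive super-solution u of equation (E) in Ω∖{0} satisfies: for every η > 0, |x|^{β−η} u(x) → ∞ as |x| → 0. -/
open MeasureTheory Filter Topology Real RealInnerProductSpace

noncomputable section

theorem fRho_neg_eq (ρ lam τ s : ℝ) (hs : 0 < s) :
    fRho ρ lam τ (-s) = s * (s - 2 * ρ + lam * s ^ (-τ)) := by
  have h : s ^ (1 - τ) = s * s ^ (-τ) := by
    rw [sub_eq_add_neg, Real.rpow_add hs, Real.rpow_one]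
  rw [fRho, abs_neg, abs_of_pos hs, h]
  ring

theorem continuous_fRho (ρ lam τ : ℝ) (hτ1 : τ < 1) : Continuous (fRho ρ lam τ) := by
  unfold fRho
  have : Continuous fun t : ℝ => |t| ^ (1 - τ) :=
    continuous_abs.rpow_const fun _ => Or.inr (by linarith)
  fun_prop

/-- Tangent-line bound for the convex function `s ↦ s + λ s ^ (-τ)` at its minimum. -/
theorem two_mul_upsilon_le (lam τ s : ℝ) (hlam : 0 < lam) (hτ : 0 < τ) (hs : 0 < s) :
    2 * Upsilon lam τ ≤ s + lam * s ^ (-τ) := by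
  set z := (lam * τ) ^ (1 / (τ + 1)) with hz
  have hz0 : 0 < z := Real.rpow_pos_of_pos (by positivity) _
  have hzl : lam * τ = z * z ^ τ := by
    rw [← Real.rpow_one_add' hz0.le (by positivity), hz, ← Real.rpow_mul (by positivity),
      add_comm 1 τ, one_div_mul_cancel (by positivity), Real.rpow_one]
  have hy : 0 < s / z := by positivity
  have h1 : 1 - τ * (s / z - 1) ≤ (s / z) ^ (-τ) := by
    have hlog := Real.log_le_sub_one_of_pos hy
    have := Real.add_one_le_exp (Real.log (s / z) * -τ)
    rw [← Real.rpow_def_of_pos hy] at this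
    nlinarith
  have h2 : lam * τ * s ^ (-τ) = z * (s / z) ^ (-τ) := by
    rw [Real.div_rpow hs.le hz0.le, Real.rpow_neg hz0.le, hzl]
    field_simp
  have h3 : z * (1 - τ * (s / z - 1)) ≤ lam * τ * s ^ (-τ) := by
    rw [h2]; exact mul_le_mul_of_nonneg_left h1 hz0.le
  have h4 : z * (1 - τ * (s / z - 1)) = z - τ * s + τ * z := by
    field_simp
    ring
  have h5 : τ * (2 * Upsilon lam τ) = (τ + 1) * z := by
    rw [Upsilon, ← hz]
    field_simp
  nlinarith

/-- In each of the three cases `f_ρ` is positive on the whole half-line `(-∞, β]`. -/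
theorem fRho_pos_of_le (ρ lam τ β : ℝ) (hτ1 : τ < 1) (hβ : β < 0)
    (hf : 0 < fRho ρ lam τ β)
    (hcase : CaseN0 ρ lam τ ∨ CaseN1 ρ lam τ ∨
      (CaseN2 ρ lam τ ∧ ∃ w1 : ℝ, IsMinNegRoot ρ lam τ w1 ∧ β < w1))
    (t : ℝ) (ht : t ≤ β) : 0 < fRho ρ lam τ t := by
  have ht0 : t < 0 := by linarith
  have key : ∀ x < 0, fRho ρ lam τ x = -x * (-x - 2 * ρ + lam * (-x) ^ (-τ)) := fun x hx => by
    rw [← fRho_neg_eq ρ lam τ (-x) (by linarith), neg_neg]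
  rcases hcase with (⟨rfl, h⟩ | ⟨hl, hτ, -, h⟩) | (⟨rfl, h⟩ | ⟨hl, hτ, -⟩) | ⟨-, w, ⟨-, -, hw⟩, hβw⟩
  · rw [key t ht0, neg_zero, Real.rpow_zero]
    exact mul_pos (by linarith) (by linarith)
  · rw [key t ht0]
    have := two_mul_upsilon_le lam τ (-t) hl hτ (by linarith)
    exact mul_pos (by linarith) (by linarith)
  · rw [key β hβ, neg_zero, Real.rpow_zero] at hf
    have := pos_of_mul_pos_right hf (by linarith)
    rw [key t ht0, neg_zero, Real.rpow_zero]
    exact mul_pos (by linarith) (by linarith)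
  · rw [key β hβ] at hf
    have h1 := pos_of_mul_pos_right hf (by linarith)
    have h2 : (-t) ^ (-τ) ≤ (-β) ^ (-τ) :=
      Real.rpow_le_rpow_of_nonpos (by linarith) (by linarith) (by linarith)
    rw [key t ht0]
    exact mul_pos (by linarith) (by nlinarith)
  · by_contra! hneg
    obtain ⟨c, hc, hc0⟩ := intermediate_value_Icc ht (continuous_fRho ρ lam τ hτ1).continuousOn
      ⟨hneg, hf.le⟩
    linarith [hw c (by linarith [hc.2]) hc0, hc.2]

theorem exists_mul_sq_le_fRho (ρ lam τ b : ℝ) (hτ0 : 0 ≤ τ) (hτ1 : τ < 1) (hb : 0 < b)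
    (hpos : ∀ s, b ≤ s → 0 < fRho ρ lam τ (-s)) :
    ∃ δ > 0, ∀ s, b ≤ s → δ * s ^ 2 ≤ s ^ 2 - 2 * ρ * s + lam * s ^ (1 - τ) := by
  have hval : ∀ s, b ≤ s → fRho ρ lam τ (-s) = s ^ 2 - 2 * ρ * s + lam * s ^ (1 - τ) := by
    intro s hs
    rw [fRho, abs_neg, abs_of_pos (hb.trans_le hs)]
    ring
  have hlim : Tendsto (fun s : ℝ => 1 - 2 * ρ * s⁻¹ + lam * s ^ (-(1 + τ))) atTop (𝓝 1) := by
    have h1 := (tendsto_inv_atTop_zero (𝕜 := ℝ)).const_mul (2 * ρ)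
    have h2 := (tendsto_rpow_neg_atTop (show 0 < 1 + τ by linarith)).const_mul lam
    simpa using (h1.const_sub 1).add h2
  obtain ⟨M, hM⟩ := eventually_atTop.1
    (hlim.eventually (lt_mem_nhds (show (1 / 2 : ℝ) < 1 by norm_num)))
  obtain ⟨s₀, hs₀, hmin⟩ := (isCompact_Icc (a := b) (b := max b M)).exists_isMinOn
    ⟨b, le_refl b, le_max_left _ _⟩
    (f := fun s => fRho ρ lam τ (-s) / s ^ 2)
    (((continuous_fRho ρ lam τ hτ1).comp continuous_neg).continuousOn.div
      (continuous_pow 2).continuousOn fun s hs => by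
        have := hb.trans_le hs.1
        positivity)
  have hs₀p : 0 < s₀ := hb.trans_le hs₀.1
  refine ⟨min (1 / 2) (fRho ρ lam τ (-s₀) / s₀ ^ 2),
    lt_min (by norm_num) (div_pos (hpos s₀ hs₀.1) (by positivity)), fun s hs => ?_⟩
  have hs0 : 0 < s := hb.trans_le hs
  rcases le_total s (max b M) with h | h
  · have := isMinOn_iff.1 hmin s ⟨hs, h⟩
    rw [← hval s hs, ← le_div_iff₀ (by positivity)]
    exact (min_le_right _ _).trans this
  · have h1 := (hM s ((le_max_right _ _).trans h)).le
    have h2 : s ^ (1 - τ) = s ^ 2 * s ^ (-(1 + τ)) := by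
      rw [← Real.rpow_natCast, ← Real.rpow_add hs0]
      congr 1
      push_cast
      ring
    have h3 : s ^ 2 * (1 - 2 * ρ * s⁻¹ + lam * s ^ (-(1 + τ)))
        = s ^ 2 - 2 * ρ * s + lam * s ^ (1 - τ) := by
      rw [h2]
      field_simp
    rw [← h3, mul_comm]
    exact mul_le_mul_of_nonneg_left ((min_le_left _ _).trans h1) (by positivity)

section LocalizedFunctions

theorem ContinuousOn.continuous_of_eq_zero_off {E F : Type*} [TopologicalSpace E]
    [TopologicalSpace F] [Zero F] {U K : Set E} (hU : IsOpen U) (hK : IsClosed K)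
    (hKU : K ⊆ U) {g : E → F} (hg : ContinuousOn g U) (h0 : ∀ x ∉ K, g x = 0) :
    Continuous g := by
  refine continuous_iff_continuousAt.2 fun x => ?_
  by_cases hx : x ∈ K
  · exact hg.continuousAt (hU.mem_nhds (hKU hx))
  · have : g =ᶠ[𝓝 x] fun _ => 0 := by
      filter_upwards [hK.isOpen_compl.mem_nhds hx] with y hy using h0 y hy
    exact continuousAt_const.congr this.symm

variable {E F : Type*} [NormedAddCommGroup E] [NormedSpace ℝ E]
  [NormedAddCommGroup F] [NormedSpace ℝ F]

theorem ContDiffOn.contDiff_of_eq_zero_off {U K : Set E} (hU : IsOpen U) (hK : IsClosed K)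
    (hKU : K ⊆ U) {g : E → F} (hg : ContDiffOn ℝ 1 g U) (h0 : ∀ x ∉ K, g x = 0) :
    ContDiff ℝ 1 g := by
  refine contDiff_iff_contDiffAt.2 fun x => ?_
  by_cases hx : x ∈ K
  · exact hg.contDiffAt (hU.mem_nhds (hKU hx))
  · have : g =ᶠ[𝓝 x] fun _ => 0 := by
      filter_upwards [hK.isOpen_compl.mem_nhds hx] with y hy using h0 y hy
    exact contDiffAt_const.congr_of_eventuallyEq this

theorem fderiv_eq_zero_off {K : Set E} (hK : IsClosed K) {g : E → F}
    (h0 : ∀ x ∉ K, g x = 0) {x : E} (hx : x ∉ K) : fderiv ℝ g x = 0 := by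
  have : g =ᶠ[𝓝 x] fun _ => 0 := by
    filter_upwards [hK.isOpen_compl.mem_nhds hx] with y hy using h0 y hy
  rw [this.fderiv_eq]
  simp

end LocalizedFunctions

/-- The divergence of a vector field on Euclidean space. -/
def divergenceE {N : ℕ} (Z : EuclideanSpace ℝ (Fin N) → EuclideanSpace ℝ (Fin N))
    (x : EuclideanSpace ℝ (Fin N)) : ℝ :=
  ∑ i : Fin N, (fderiv ℝ Z x (EuclideanSpace.single i 1)) i

theorem continuousOn_divergenceE {N : ℕ} {U : Set (EuclideanSpace ℝ (Fin N))} (hU : IsOpen U)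
    {Z : EuclideanSpace ℝ (Fin N) → EuclideanSpace ℝ (Fin N)} (hZ : ContDiffOn ℝ 1 Z U) :
    ContinuousOn (divergenceE Z) U := by
  have h := hZ.continuousOn_fderiv_of_isOpen hU le_rfl
  refine continuousOn_finsetSum _ fun i _ => ?_
  exact (EuclideanSpace.proj (𝕜 := ℝ) i).continuous.comp_continuousOn
    (h.clm_apply continuousOn_const)

theorem integral_fderiv_apply_eq_zero {N : ℕ} {f : EuclideanSpace ℝ (Fin N) → ℝ}
    (hf : ContDiff ℝ 1 f) (hfc : HasCompactSupport f) (v : EuclideanSpace ℝ (Fin N)) :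
    ∫ x, fderiv ℝ f x v = 0 := by
  have hc : Continuous fun x => fderiv ℝ f x v :=
    (hf.continuous_fderiv one_ne_zero).clm_apply continuous_const
  have hi : Integrable fun x => fderiv ℝ f x v :=
    hc.integrable_of_hasCompactSupport (hfc.fderiv_apply ℝ v)
  have := integral_mul_fderiv_eq_neg_fderiv_mul_of_integrable (μ := volume) (v := v)
    (f := f) (g := fun _ : EuclideanSpace ℝ (Fin N) => (1 : ℝ)) (by simpa using hi) (by simp)
    (by simpa using hf.continuous.integrable_of_hasCompactSupport hfc)
    (fun x _ => (hf.differentiable one_ne_zero) x) (fun x _ => differentiableAt_const _)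
  simpa using this

theorem integral_inner_gradient_add_mul_divergenceE {N : ℕ}
    {U K : Set (EuclideanSpace ℝ (Fin N))} (hU : IsOpen U) (hK : IsCompact K) (hKU : K ⊆ U)
    {φ : EuclideanSpace ℝ (Fin N) → ℝ} (hφ : ContDiff ℝ 1 φ) (hφ0 : ∀ x ∉ K, φ x = 0)
    {Z : EuclideanSpace ℝ (Fin N) → EuclideanSpace ℝ (Fin N)} (hZ : ContDiffOn ℝ 1 Z U) :
    ∫ x, (⟪Z x, gradient φ x⟫ + divergenceE Z x * φ x) = 0 := by
  have hZi : ∀ i : Fin N, ContDiffOn ℝ 1 (fun x => φ x * Z x i) U := fun i =>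
    hφ.contDiffOn.mul ((EuclideanSpace.proj (𝕜 := ℝ) i).contDiff.comp_contDiffOn hZ)
  have h0 : ∀ i : Fin N, ∀ x ∉ K, φ x * Z x i = 0 := fun i x hx => by rw [hφ0 x hx, zero_mul]
  have hC : ∀ i : Fin N, ContDiff ℝ 1 (fun x => φ x * Z x i) := fun i =>
    (hZi i).contDiff_of_eq_zero_off hU hK.isClosed hKU (h0 i)
  have hS : ∀ i : Fin N, HasCompactSupport (fun x => φ x * Z x i) := fun i =>
    HasCompactSupport.intro hK (h0 i)
  have hpt : ∀ x, ⟪Z x, gradient φ x⟫ + divergenceE Z x * φ x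
      = ∑ i : Fin N, fderiv ℝ (fun x => φ x * Z x i) x (EuclideanSpace.single i 1) := by
    intro x
    by_cases hx : x ∈ K
    · have hZd : DifferentiableAt ℝ Z x :=
        (hZ.contDiffAt (hU.mem_nhds (hKU hx))).differentiableAt one_ne_zero
      have hd : ∀ i : Fin N, HasFDerivAt (fun x => φ x * Z x i)
          (φ x • ((EuclideanSpace.proj (𝕜 := ℝ) i).comp (fderiv ℝ Z x)) + Z x i • fderiv ℝ φ x)
          x := fun i =>
        ((hφ.differentiable one_ne_zero) x).hasFDerivAt.mul
          ((EuclideanSpace.proj (𝕜 := ℝ) i).hasFDerivAt.comp x hZd.hasFDerivAt)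
      have hexp : Z x = ∑ i : Fin N, Z x i • EuclideanSpace.single i (1 : ℝ) := by
        simpa using ((EuclideanSpace.basisFun (Fin N) ℝ).sum_repr (Z x)).symm
      have hin : ⟪Z x, gradient φ x⟫
          = ∑ i : Fin N, Z x i * fderiv ℝ φ x (EuclideanSpace.single i 1) := by
        rw [real_inner_comm, inner_gradient_left]
        conv_lhs => rw [hexp]
        simp
      rw [hin, divergenceE, Finset.sum_mul, ← Finset.sum_add_distrib]
      refine Finset.sum_congr rfl fun i _ => ?_
      rw [(hd i).fderiv]
      simp
      ring
    · rw [real_inner_comm, inner_gradient_left, fderiv_eq_zero_off hK.isClosed hφ0 hx, hφ0 x hx]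
      simp [fderiv_eq_zero_off hK.isClosed (h0 _) hx]
  simp_rw [hpt]
  rw [integral_finsetSum _ fun i _ => ?_]
  · exact Finset.sum_eq_zero fun i _ => integral_fderiv_apply_eq_zero (hC i) (hS i) _
  · exact (((hC i).continuous_fderiv one_ne_zero).clm_apply
      continuous_const).integrable_of_hasCompactSupport ((hS i).fderiv_apply ℝ _)

theorem ContDiffOn.continuousOn_gradient {N : ℕ} {U : Set (EuclideanSpace ℝ (Fin N))}
    (hU : IsOpen U) {u : EuclideanSpace ℝ (Fin N) → ℝ} (hu : ContDiffOn ℝ 1 u U) :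
    ContinuousOn (gradient u) U :=
  (InnerProductSpace.toDual ℝ (EuclideanSpace ℝ (Fin N))).symm.continuous.comp_continuousOn
    (hu.continuousOn_fderiv_of_isOpen hU le_rfl)

/-- The terms of (E), other than the Laplacian, as a function of position, value and gradient. -/
def lowerOrder {N : ℕ} (ρ lam τ θ q : ℝ) (x : EuclideanSpace ℝ (Fin N)) (z : ℝ)
    (ξ : EuclideanSpace ℝ (Fin N)) : ℝ :=
  ((N : ℝ) - 2 + 2 * ρ) * (⟪x, ξ⟫ / ‖x‖ ^ 2) - lam * Gt τ x z ξ + ‖x‖ ^ θ * z ^ q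

section WeakForm

variable {N : ℕ} {ρ lam τ θ q : ℝ} {Ω : Set (EuclideanSpace ℝ (Fin N))}
  {u : EuclideanSpace ℝ (Fin N) → ℝ}

theorem PosC1.continuousOn_inner_div (hΩ : IsOpen Ω) (hu : PosC1 Ω u) :
    ContinuousOn (fun x => ⟪x, gradient u x⟫ / ‖x‖ ^ 2) (Ω \ {0}) :=
  (continuousOn_id.inner (𝕜 := ℝ)
    (hu.1.continuousOn_gradient (hΩ.sdiff isClosed_singleton))).div
    (continuousOn_id.norm.pow 2) fun x hx => by
      have : 0 < ‖x‖ := norm_pos_iff.2 hx.2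
      positivity

theorem PosC1.continuousOn_Gt (hτ1 : τ < 1) (hΩ : IsOpen Ω) (hu : PosC1 Ω u) :
    ContinuousOn (fun x => Gt τ x (u x) (gradient u x)) (Ω \ {0}) := by
  refine ContinuousOn.div (ContinuousOn.mul ?_ ?_) ?_ fun x hx => ?_
  · exact hu.1.continuousOn.rpow_const fun x hx => Or.inl (hu.2 x hx).ne'
  · exact (hu.1.continuousOn_gradient (hΩ.sdiff isClosed_singleton)).norm.rpow_const
      fun x _ => Or.inr (by linarith)
  · exact continuousOn_id.norm.rpow_const fun x hx => Or.inl (norm_ne_zero_iff.2 hx.2)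
  · exact (Real.rpow_pos_of_pos (norm_pos_iff.2 hx.2) _).ne'

theorem PosC1.continuousOn_absorption (hu : PosC1 Ω u) :
    ContinuousOn (fun x => ‖x‖ ^ θ * u x ^ q) (Ω \ {0}) :=
  (continuousOn_id.norm.rpow_const fun _ hx => Or.inl (norm_ne_zero_iff.2 hx.2)).mul
    (hu.1.continuousOn.rpow_const fun x hx => Or.inl (hu.2 x hx).ne')

theorem PosC1.continuousOn_lowerOrder (hτ1 : τ < 1) (hΩ : IsOpen Ω) (hu : PosC1 Ω u) :
    ContinuousOn (fun x => lowerOrder ρ lam τ θ q x (u x) (gradient u x)) (Ω \ {0}) :=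
  ((continuousOn_const.mul (hu.continuousOn_inner_div hΩ)).sub
    (continuousOn_const.mul (hu.continuousOn_Gt hτ1 hΩ))).add hu.continuousOn_absorption

theorem weakE_eq_integral (hτ1 : τ < 1) (hΩ : IsOpen Ω) (hu : PosC1 Ω u)
    {K : Set (EuclideanSpace ℝ (Fin N))} (hK : IsCompact K) (hKΩ : K ⊆ Ω \ {0})
    {φ : EuclideanSpace ℝ (Fin N) → ℝ} (hφ : ContDiff ℝ 1 φ) (hφ0 : ∀ x ∉ K, φ x = 0) :
    weakE N ρ lam τ θ q Ω u φ = ∫ x, (⟪gradient u x, gradient φ x⟫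
      + lowerOrder ρ lam τ θ q x (u x) (gradient u x) * φ x) := by
  have hU : IsOpen (Ω \ {(0 : EuclideanSpace ℝ (Fin N))}) := hΩ.sdiff isClosed_singleton
  have hg0 : ∀ x ∉ K, ⟪gradient u x, gradient φ x⟫ = 0 := fun x hx => by
    rw [real_inner_comm, inner_gradient_left, fderiv_eq_zero_off hK.isClosed hφ0 hx]
    simp
  have hint : ∀ g : EuclideanSpace ℝ (Fin N) → ℝ, ContinuousOn g (Ω \ {0}) →
      (∀ x ∉ K, g x = 0) → Integrable g := fun g hg h0 =>
    (hg.continuous_of_eq_zero_off hU hK.isClosed hKΩ h0).integrable_of_hasCompactSupport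
      (HasCompactSupport.intro hK h0)
  have hset : ∀ g : EuclideanSpace ℝ (Fin N) → ℝ, (∀ x ∉ K, g x = 0) →
      ∫ x in Ω \ {0}, g x = ∫ x, g x := fun g h0 =>
    setIntegral_eq_integral_of_forall_compl_eq_zero fun x hx => h0 x fun h => hx (hKΩ h)
  have hm : ∀ (g : EuclideanSpace ℝ (Fin N) → ℝ), ∀ x ∉ K, g x * φ x = 0 := fun g x hx => by
    rw [hφ0 x hx, mul_zero]
  have i1 : Integrable fun x => ⟪gradient u x, gradient φ x⟫ :=
    hint _ ((hu.1.continuousOn_gradient hU).inner (𝕜 := ℝ)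
      (hφ.contDiffOn.continuousOn_gradient hU)) hg0
  have i2 : Integrable fun x =>
      ((N : ℝ) - 2 + 2 * ρ) * (⟪x, gradient u x⟫ / ‖x‖ ^ 2 * φ x) :=
    (hint _ ((hu.continuousOn_inner_div hΩ).mul hφ.continuous.continuousOn)
      (hm _)).const_mul _
  have i3 : Integrable fun x => lam * (Gt τ x (u x) (gradient u x) * φ x) :=
    (hint _ ((hu.continuousOn_Gt hτ1 hΩ).mul hφ.continuous.continuousOn) (hm _)).const_mul _
  have i4 : Integrable fun x => ‖x‖ ^ θ * u x ^ q * φ x :=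
    hint _ ((hu.continuousOn_absorption (θ := θ) (q := q)).mul
      hφ.continuous.continuousOn) (hm _)
  have i12 : Integrable fun x => ⟪gradient u x, gradient φ x⟫
      + ((N : ℝ) - 2 + 2 * ρ) * (⟪x, gradient u x⟫ / ‖x‖ ^ 2 * φ x) := i1.add i2
  have i123 : Integrable fun x => ⟪gradient u x, gradient φ x⟫
      + ((N : ℝ) - 2 + 2 * ρ) * (⟪x, gradient u x⟫ / ‖x‖ ^ 2 * φ x)
      - lam * (Gt τ x (u x) (gradient u x) * φ x) := i12.sub i3
  rw [weakE, hset _ hg0, hset _ (hm _), hset _ (hm _), hset _ (hm _), ← integral_const_mul,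
    ← integral_const_mul, ← integral_add i1 i2, ← integral_sub i12 i3, ← integral_add i123 i4]
  refine integral_congr_ae (Eventually.of_forall fun x => ?_)
  simp only [lowerOrder]
  ring

end WeakForm

/-- A weak super-solution satisfies the differential inequality pointwise for every smooth function
touching it from below. Here `Z` is the gradient of the touching function `W`. -/
theorem IsSuperSolutionE.divergenceE_le_of_touching {N : ℕ} {ρ lam τ θ q : ℝ}
    {Ω U : Set (EuclideanSpace ℝ (Fin N))} {u W : EuclideanSpace ℝ (Fin N) → ℝ}
    {Z : EuclideanSpace ℝ (Fin N) → EuclideanSpace ℝ (Fin N)} {x₀ : EuclideanSpace ℝ (Fin N)}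
    (hτ1 : τ < 1) (hΩ : IsOpen Ω) (hu : IsSuperSolutionE N ρ lam τ θ q Ω u)
    (hU : IsOpen U) (hUΩ : U ⊆ Ω \ {0}) (hx₀ : x₀ ∈ U)
    (hW : ContDiffOn ℝ 1 W U) (hZ : ContDiffOn ℝ 1 Z U)
    (hWZ : ∀ x ∈ U, HasGradientAt W (Z x) x)
    (hle : ∀ x ∈ U, W x ≤ u x) (heq : W x₀ = u x₀) :
    divergenceE Z x₀ ≤ lowerOrder ρ lam τ θ q x₀ (W x₀) (Z x₀) := by
  have huU : ContDiffOn ℝ 1 u U := hu.1.1.mono hUΩ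
  have hug : ∀ x ∈ U, HasGradientAt u (gradient u x) x := fun x hx =>
    ((huU.contDiffAt (hU.mem_nhds hx)).differentiableAt one_ne_zero).hasGradientAt
  have hgrad : gradient u x₀ = Z x₀ := by
    have hmin : IsLocalMin (fun x => u x - W x) x₀ := by
      filter_upwards [hU.mem_nhds hx₀] with x hx
      have := hle x hx
      linarith
    have := hmin.hasFDerivAt_eq_zero
      ((hug x₀ hx₀).hasFDerivAt.sub (hWZ x₀ hx₀).hasFDerivAt)
    exact (InnerProductSpace.toDual ℝ _).injective (sub_eq_zero.1 this)
  by_contra! hlt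
  set B : EuclideanSpace ℝ (Fin N) → ℝ :=
    fun x => lowerOrder ρ lam τ θ q x (u x) (gradient u x) with hB
  have hBc : ContinuousOn B U := (hu.1.continuousOn_lowerOrder hτ1 hΩ).mono hUΩ
  have hDc := continuousOn_divergenceE hU hZ
  have hpos : 0 < divergenceE Z x₀ - B x₀ := by
    rw [hB]
    simp only [hgrad, ← heq]
    linarith
  set d := (divergenceE Z x₀ - B x₀) / 2 with hd
  have hd0 : 0 < d := by positivity
  set a := d / (2 * N + 1) with ha
  have ha0 : 0 < a := by positivity
  have haN : 2 * a * N < d := by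
    rw [ha]
    field_simp
    linarith
  have hev : ∀ᶠ x in 𝓝 x₀, x ∈ U ∧ d < divergenceE Z x - B x :=
    (hU.eventually_mem hx₀).and (((hDc.sub hBc).continuousAt (hU.mem_nhds hx₀)).eventually
      (lt_mem_nhds (show d < divergenceE Z x₀ - B x₀ by linarith)))
  obtain ⟨r, hr, hball⟩ := Metric.eventually_nhds_iff_ball.1 hev
  have hVU : Metric.ball x₀ r ⊆ U := fun x hx => (hball x hx).1
  have hKV : Metric.closedBall x₀ (r / 2) ⊆ Metric.ball x₀ r :=
    Metric.closedBall_subset_ball (by linarith)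
  have hKc : IsCompact (Metric.closedBall x₀ (r / 2)) := isCompact_closedBall _ _
  set h : EuclideanSpace ℝ (Fin N) → ℝ := fun x => u x - W x + a * ‖x - x₀‖ ^ 2 with hh
  set μ := a * (r / 2) ^ 2 with hμ
  have hμ0 : 0 < μ := by positivity
  have hψ : ContDiff ℝ 1 expNegInvGlue := expNegInvGlue.contDiff (n := 1)
  classical
  set φ : EuclideanSpace ℝ (Fin N) → ℝ :=
    fun x => if x ∈ Metric.ball x₀ r then expNegInvGlue (μ - h x) else 0 with hφdef
  have hφV : ∀ x ∈ Metric.ball x₀ r, φ x = expNegInvGlue (μ - h x) := fun x hx => if_pos hx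
  have hφ0 : ∀ x ∉ Metric.closedBall x₀ (r / 2), φ x = 0 := by
    intro x hx
    by_cases hxV : x ∈ Metric.ball x₀ r
    · rw [hφV x hxV]
      apply expNegInvGlue.zero_of_nonpos
      have h1 := hle x (hVU hxV)
      have h2 : r / 2 < ‖x - x₀‖ := by simpa [dist_eq_norm] using hx
      have h3 : (r / 2) ^ 2 ≤ ‖x - x₀‖ ^ 2 := by gcongr
      have h4 := mul_le_mul_of_nonneg_left h3 ha0.le
      simp only [hh, hμ]
      linarith
    · exact if_neg hxV
  have hφnn : ∀ x, 0 ≤ φ x := by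
    intro x
    simp only [hφdef]
    split_ifs
    exacts [expNegInvGlue.nonneg _, le_rfl]
  have hhC : ContDiffOn ℝ 1 h (Metric.ball x₀ r) :=
    ((huU.sub hW).mono hVU).add
      (contDiffOn_const.mul ((contDiff_id.sub contDiff_const).norm_sq ℝ).contDiffOn)
  have hφC : ContDiff ℝ 1 φ := by
    refine ContDiffOn.contDiff_of_eq_zero_off Metric.isOpen_ball hKc.isClosed hKV ?_ hφ0
    exact (hψ.comp_contDiffOn (contDiffOn_const.sub hhC)).congr hφV
  set Y : EuclideanSpace ℝ (Fin N) → EuclideanSpace ℝ (Fin N) :=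
    fun x => Z x - (2 * a) • (x - x₀) with hY
  have hYC : ContDiffOn ℝ 1 Y U :=
    hZ.sub (show ContDiff ℝ 1 fun x : EuclideanSpace ℝ (Fin N) => (2 * a) • (x - x₀) by
      fun_prop).contDiffOn
  have hφg : ∀ x ∈ Metric.ball x₀ r,
      gradient φ x = -(deriv expNegInvGlue (μ - h x)) • (gradient u x - Y x) := by
    intro x hx
    have hnorm : HasFDerivAt (fun x => ‖x - x₀‖ ^ 2)
        (2 • (innerSL ℝ (x - x₀)).comp (ContinuousLinearMap.id ℝ _)) x :=
      ((hasFDerivAt_id x).sub_const x₀).norm_sq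
    have hhd := ((hug x (hVU hx)).hasFDerivAt.sub (hWZ x (hVU hx)).hasFDerivAt).add
      (hnorm.const_mul a)
    have hcomp := ((hψ.differentiable one_ne_zero) (μ - h x)).hasDerivAt.comp_hasFDerivAt x
      (hhd.const_sub μ)
    have hφd := hcomp.congr_of_eventuallyEq (f₁ := φ) (by
      filter_upwards [Metric.isOpen_ball.mem_nhds hx] with y hy using hφV y hy)
    refine HasGradientAt.gradient (hasGradientAt_iff_hasFDerivAt.2 (hφd.congr_fderiv ?_))
    ext v
    simp [hY]
    ring
  have hYdiv : ∀ x ∈ U, divergenceE Y x = divergenceE Z x - 2 * a * N := by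
    intro x hx
    have hZd : DifferentiableAt ℝ Z x :=
      (hZ.contDiffAt (hU.mem_nhds hx)).differentiableAt one_ne_zero
    have hYd := hZd.hasFDerivAt.sub (((hasFDerivAt_id x).sub_const x₀).const_smul (2 * a))
    have : fderiv ℝ Y x = _ := hYd.fderiv
    simp [divergenceE, this, Finset.sum_sub_distrib]
    ring
  have hweak : 0 ≤ weakE N ρ lam τ θ q Ω u φ := by
    refine hu.2 φ ⟨hφC, HasCompactSupport.intro hKc hφ0, ?_⟩ hφnn
    exact (closure_minimal (Function.support_subset_iff'.2 hφ0) hKc.isClosed).trans (hKV.trans (hVU.trans hUΩ))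
  rw [weakE_eq_integral hτ1 hΩ hu.1 hKc (hKV.trans (hVU.trans hUΩ)) hφC hφ0] at hweak
  have hdiv := integral_inner_gradient_add_mul_divergenceE hU hKc (hKV.trans hVU) hφC hφ0 hYC
  have hφgc : ContinuousOn (gradient φ) U := hφC.contDiffOn.continuousOn_gradient hU
  have hφg0 : ∀ x ∉ Metric.closedBall x₀ (r / 2), gradient φ x = 0 := fun x hx => by
    rw [gradient, fderiv_eq_zero_off hKc.isClosed hφ0 hx, map_zero]
  have hz₁ : ∀ x ∉ Metric.closedBall x₀ (r / 2),
      ⟪gradient u x, gradient φ x⟫ + B x * φ x = 0 := fun x hx => by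
    rw [hφg0 x hx, hφ0 x hx, inner_zero_right, mul_zero, add_zero]
  have hz₂ : ∀ x ∉ Metric.closedBall x₀ (r / 2),
      ⟪Y x, gradient φ x⟫ + divergenceE Y x * φ x = 0 := fun x hx => by
    rw [hφg0 x hx, hφ0 x hx, inner_zero_right, mul_zero, add_zero]
  have hc₁ : Continuous fun x => ⟪gradient u x, gradient φ x⟫ + B x * φ x :=
    (((huU.continuousOn_gradient hU).inner (𝕜 := ℝ) hφgc).add
      (hBc.mul hφC.continuous.continuousOn)).continuous_of_eq_zero_off hU hKc.isClosed
      (hKV.trans hVU) hz₁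
  have hc₂ : Continuous fun x => ⟪Y x, gradient φ x⟫ + divergenceE Y x * φ x :=
    ((hYC.continuousOn.inner (𝕜 := ℝ) hφgc).add
      ((continuousOn_divergenceE hU hYC).mul
        hφC.continuous.continuousOn)).continuous_of_eq_zero_off hU hKc.isClosed
      (hKV.trans hVU) hz₂
  have hsub := integral_sub (hc₂.integrable_of_hasCompactSupport (μ := volume)
      (HasCompactSupport.intro hKc hz₂))
    (hc₁.integrable_of_hasCompactSupport (μ := volume)
      (HasCompactSupport.intro hKc hz₁))
  have hge : ∀ x ∈ Metric.ball x₀ r, (d - 2 * a * N) * φ x ≤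
      (⟪Y x, gradient φ x⟫ + divergenceE Y x * φ x)
        - (⟪gradient u x, gradient φ x⟫ + B x * φ x) := by
    intro x hx
    have h1 : ⟪Y x, gradient φ x⟫ - ⟪gradient u x, gradient φ x⟫
        = deriv expNegInvGlue (μ - h x) * ‖gradient u x - Y x‖ ^ 2 := by
      rw [← inner_sub_left, hφg x hx, inner_smul_right, ← neg_sub (gradient u x) (Y x),
        inner_neg_left, real_inner_self_eq_norm_sq]
      ring
    have h2 : 0 ≤ deriv expNegInvGlue (μ - h x) := expNegInvGlue.monotone.deriv_nonneg
    have h3 := mul_nonneg h2 (sq_nonneg ‖gradient u x - Y x‖)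
    have h4 := mul_le_mul_of_nonneg_right (hball x hx).2.le (hφnn x)
    rw [hYdiv x (hVU hx)]
    linarith
  have hint : 0 < ∫ x, ((⟪Y x, gradient φ x⟫ + divergenceE Y x * φ x)
      - (⟪gradient u x, gradient φ x⟫ + B x * φ x)) :=
    (hc₂.sub hc₁).integral_pos_of_hasCompactSupport_nonneg_nonzero (μ := volume) (x := x₀)
    (HasCompactSupport.intro hKc fun x hx =>
      sub_eq_zero.2 ((hz₂ x hx).trans (hz₁ x hx).symm))
    (fun x => by
      by_cases hx : x ∈ Metric.ball x₀ r
      · exact (mul_nonneg (by linarith) (hφnn x)).trans (hge x hx)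
      · have hx' : x ∉ Metric.closedBall x₀ (r / 2) := fun h => hx (hKV h)
        exact (sub_eq_zero.2 ((hz₂ x hx').trans (hz₁ x hx').symm)).ge)
    (by
      have hx₀V : x₀ ∈ Metric.ball x₀ r := Metric.mem_ball_self hr
      refine ((mul_pos (by linarith) ?_).trans_le (hge x₀ hx₀V)).ne'
      rw [hφV x₀ hx₀V]
      apply expNegInvGlue.pos_of_pos
      simpa [hh, heq] using hμ0)
  rw [hsub, hdiv] at hint
  linarith

section RadialBarrier

variable {N : ℕ}

theorem divergenceE_radial {A : ℝ → ℝ} {A' : ℝ} {x : EuclideanSpace ℝ (Fin N)}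
    (hA : HasDerivAt A A' (‖x‖ ^ 2)) :
    divergenceE (fun y : EuclideanSpace ℝ (Fin N) => A (‖y‖ ^ 2) • y) x
      = N * A (‖x‖ ^ 2) + 2 * ‖x‖ ^ 2 * A' := by
  have h := (hA.comp_hasFDerivAt x (hasStrictFDerivAt_norm_sq x).hasFDerivAt).smul
    (hasFDerivAt_id x)
  have h' : fderiv ℝ (fun y : EuclideanSpace ℝ (Fin N) => A (‖y‖ ^ 2) • y) x = _ := h.fderiv
  have hn : ∑ i : Fin N, x i * x i = ‖x‖ ^ 2 := by
    rw [EuclideanSpace.real_norm_sq_eq]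
    simp [sq]
  simp only [divergenceE, h']
  simp [Finset.sum_add_distrib, EuclideanSpace.inner_single_right]
  rw [← hn, Finset.mul_sum, Finset.sum_mul]
  exact Finset.sum_congr rfl fun i _ => by ring

/-- The barrier `c (|x|^(2κ) - ε)^p`. -/
def barrier (c κ ε p : ℝ) (x : EuclideanSpace ℝ (Fin N)) : ℝ :=
  c * ((‖x‖ ^ 2) ^ κ - ε) ^ p

/-- The radial factor of the gradient of `barrier`, as a function of `|x|²`. -/
def barrierSlope (c κ ε p σ : ℝ) : ℝ :=
  c * (2 * κ * p) * ((σ ^ κ - ε) ^ (p - 1) * σ ^ (κ - 1))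

theorem contDiffAt_rpow_sub_rpow {κ ε : ℝ} (r : ℝ) {σ : ℝ} (hσ : 0 < σ) (hε : ε < σ ^ κ) :
    ContDiffAt ℝ 1 (fun σ : ℝ => (σ ^ κ - ε) ^ r) σ :=
  ((contDiffAt_id.rpow_const_of_ne hσ.ne').sub contDiffAt_const).rpow_const_of_ne
    (sub_pos.2 hε).ne'

theorem contDiffAt_barrier {c κ ε p : ℝ} {x : EuclideanSpace ℝ (Fin N)} (hx : x ≠ 0)
    (hε : ε < (‖x‖ ^ 2) ^ κ) : ContDiffAt ℝ 1 (barrier c κ ε p) x :=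
  contDiffAt_const.mul ((contDiffAt_rpow_sub_rpow p
    (by have := norm_pos_iff.2 hx; positivity) hε).comp x (contDiff_norm_sq ℝ).contDiffAt)

theorem contDiffAt_barrierSlope_smul {c κ ε p : ℝ} {x : EuclideanSpace ℝ (Fin N)} (hx : x ≠ 0)
    (hε : ε < (‖x‖ ^ 2) ^ κ) :
    ContDiffAt ℝ 1 (fun y : EuclideanSpace ℝ (Fin N) => barrierSlope c κ ε p (‖y‖ ^ 2) • y) x := by
  have hσ : 0 < ‖x‖ ^ 2 := by have := norm_pos_iff.2 hx; positivity
  have h : ContDiffAt ℝ 1 (barrierSlope c κ ε p) (‖x‖ ^ 2) :=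
    contDiffAt_const.mul ((contDiffAt_rpow_sub_rpow (p - 1) hσ hε).mul
      (contDiffAt_id.rpow_const_of_ne hσ.ne'))
  exact (h.comp x (contDiff_norm_sq ℝ).contDiffAt).smul contDiffAt_id

theorem hasGradientAt_barrier {c κ ε p : ℝ} {x : EuclideanSpace ℝ (Fin N)} (hx : x ≠ 0)
    (hε : ε < (‖x‖ ^ 2) ^ κ) :
    HasGradientAt (barrier c κ ε p) (barrierSlope c κ ε p (‖x‖ ^ 2) • x) x := by
  have hσ : 0 < ‖x‖ ^ 2 := by have := norm_pos_iff.2 hx; positivity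
  have h1 : HasDerivAt (fun σ : ℝ => c * (σ ^ κ - ε) ^ p) _ (‖x‖ ^ 2) :=
    (((Real.hasDerivAt_rpow_const (p := κ) (Or.inl hσ.ne')).sub_const ε).rpow_const (p := p)
      (Or.inl (sub_pos.2 hε).ne')).const_mul c
  have h2 := h1.comp_hasFDerivAt x (hasStrictFDerivAt_norm_sq x).hasFDerivAt
  refine hasGradientAt_iff_hasFDerivAt.2 (h2.congr_fderiv ?_)
  ext v
  simp [barrierSlope]
  ring

/-- The barrier is a strict classical sub-solution where it is positive and small enough. -/
theorem lowerOrder_barrier_lt {ρ lam τ θ q δ m c κ ε p : ℝ} {x : EuclideanSpace ℝ (Fin N)}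
    (hx : x ≠ 0) (hε0 : 0 < ε) (hε : ε < (‖x‖ ^ 2) ^ κ) (hc : 0 < c)
    (hδ : 0 < δ) (hm : 0 < m) (hκ : 0 < κ) (hp : p = 2 / δ) (hmκ : 2 * κ * p = m)
    (hgrow : ∀ s, m ≤ s → δ * s ^ 2 ≤ s ^ 2 - 2 * ρ * s + lam * s ^ (1 - τ))
    (hsmall : ‖x‖ ^ (θ + 2) * barrier c κ ε p x ^ (q - 1) < δ / 2 * m ^ 2) :
    lowerOrder ρ lam τ θ q x (barrier c κ ε p x) (barrierSlope c κ ε p (‖x‖ ^ 2) • x)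
      < divergenceE (fun y : EuclideanSpace ℝ (Fin N) => barrierSlope c κ ε p (‖y‖ ^ 2) • y) x := by
  have hr : 0 < ‖x‖ := norm_pos_iff.2 hx
  have hσ : 0 < ‖x‖ ^ 2 := by positivity
  have hp0 : 0 < p := by rw [hp]; positivity
  have hpinv : p⁻¹ = δ / 2 := by rw [hp, inv_div]
  set r := ‖x‖ with hrdef
  set σ := r ^ 2 with hσdef
  set X := σ ^ κ with hX
  have hX0 : 0 < X := Real.rpow_pos_of_pos hσ _
  set Y := X - ε with hYdef
  have hY : 0 < Y := sub_pos.2 hε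
  set s := m * X / Y with hs
  have hms : m ≤ s := by
    rw [hs, le_div_iff₀ hY]
    exact mul_le_mul_of_nonneg_left (by linarith) hm.le
  have hs0 : 0 < s := hm.trans_le hms
  set w := barrier c κ ε p x with hw
  have hwv : w = c * Y ^ p := rfl
  have hw0 : 0 < w := by rw [hwv]; positivity
  have hA : barrierSlope c κ ε p σ = s * w / σ := by
    rw [barrierSlope, hmκ, ← hX, ← hYdef, Real.rpow_sub_one hY.ne', Real.rpow_sub_one hσ.ne',
      ← hX, hwv, hs]
    field_simp
  have hA' : HasDerivAt (barrierSlope c κ ε p)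
      (w * s * ((1 - δ / 2) * s + 2 * κ - 2) / (2 * σ ^ 2)) σ := by
    have h1 : HasDerivAt (barrierSlope c κ ε p) _ σ :=
      ((((Real.hasDerivAt_rpow_const (p := κ) (Or.inl hσ.ne')).sub_const ε).rpow_const
        (p := p - 1) (Or.inl hY.ne')).mul
        (Real.hasDerivAt_rpow_const (p := κ - 1) (Or.inl hσ.ne'))).const_mul (c * (2 * κ * p))
    refine h1.congr_deriv ?_
    rw [← hX, ← hYdef, Real.rpow_sub_one hY.ne' (p - 1), Real.rpow_sub_one hY.ne' p,
      Real.rpow_sub_one hσ.ne' (κ - 1), Real.rpow_sub_one hσ.ne' κ, ← hX, hwv, hs, ← hpinv, ← hmκ]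
    field_simp
    ring
  have hG : σ * Gt τ x w (barrierSlope c κ ε p σ • x) = w * s ^ (1 - τ) := by
    have e1 : ‖barrierSlope c κ ε p σ • x‖ = s * w / r := by
      rw [norm_smul, hA, Real.norm_of_nonneg (by positivity), ← hrdef, hσdef]
      field_simp
    rw [Gt, e1, ← hrdef, Real.div_rpow (by positivity) hr.le, Real.mul_rpow hs0.le hw0.le,
      Real.rpow_sub hw0, Real.rpow_sub hr, Real.rpow_add hr]
    simp only [Real.rpow_one]
    have := Real.rpow_pos_of_pos hw0 τ
    have := Real.rpow_pos_of_pos hr τ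
    rw [hσdef]
    field_simp
  have hq' : σ * (r ^ θ * w ^ q) = r ^ (θ + 2) * w ^ (q - 1) * w := by
    rw [Real.rpow_add hr, Real.rpow_sub_one hw0.ne', Real.rpow_two, hσdef]
    field_simp
  have hin : ⟪x, barrierSlope c κ ε p σ • x⟫ / r ^ 2 = s * w / σ := by
    rw [inner_smul_right, real_inner_self_eq_norm_sq, ← hrdef, hA, hσdef]
    field_simp
  rw [divergenceE_radial hA', lowerOrder, ← hrdef, hin, ← hσdef, hA]
  refine lt_of_mul_lt_mul_left ?_ hσ.le
  have e2 : σ * (((N : ℝ) - 2 + 2 * ρ) * (s * w / σ)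
      - lam * Gt τ x w ((s * w / σ) • x) + r ^ θ * w ^ q)
      = (((N : ℝ) - 2 + 2 * ρ) * s - lam * s ^ (1 - τ) + r ^ (θ + 2) * w ^ (q - 1)) * w := by
    rw [hA] at hG
    rw [mul_add, mul_sub, mul_left_comm σ lam, hG, hq']
    field_simp
  have e3 : σ * (N * (s * w / σ)
      + 2 * σ * (w * s * ((1 - δ / 2) * s + 2 * κ - 2) / (2 * σ ^ 2)))
      = (N * s + s * ((1 - δ / 2) * s + 2 * κ - 2)) * w := by
    field_simp
  rw [e2, e3]
  refine mul_lt_mul_of_pos_right ?_ hw0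
  have h1 := hgrow s hms
  have h2 : m ^ 2 ≤ s ^ 2 := by gcongr
  nlinarith [mul_pos hκ hs0]

end RadialBarrier

/-- A super-solution that dominates `c` on the sphere of radius `R ≤ 1` dominates every barrier
with amplitude `c` inside that sphere. -/
theorem IsSuperSolutionE.barrier_le {N : ℕ} {ρ lam τ θ q δ m c κ ε p R : ℝ}
    {Ω : Set (EuclideanSpace ℝ (Fin N))} {u : EuclideanSpace ℝ (Fin N) → ℝ}
    (hτ1 : τ < 1) (hq : 1 < q) (hΩ : IsOpen Ω) (hu : IsSuperSolutionE N ρ lam τ θ q Ω u)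
    (hR1 : R ≤ 1) (hRΩ : Metric.closedBall 0 R ⊆ Ω)
    (hε0 : 0 < ε) (hc : 0 < c) (hδ : 0 < δ) (hm : 0 < m) (hκ : 0 < κ)
    (hp : p = 2 / δ) (hmκ : 2 * κ * p = m)
    (hgrow : ∀ s, m ≤ s → δ * s ^ 2 ≤ s ^ 2 - 2 * ρ * s + lam * s ^ (1 - τ))
    (hexp : 0 ≤ θ + 2 + m * (q - 1)) (hcq : c ^ (q - 1) < δ / 2 * m ^ 2)
    (hsphere : ∀ x ∈ Metric.sphere 0 R, c < u x)
    {x : EuclideanSpace ℝ (Fin N)} (hxR : ‖x‖ ≤ R) (hxε : ε < (‖x‖ ^ 2) ^ κ) :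
    barrier c κ ε p x ≤ u x := by
  have hp0 : 0 < p := by rw [hp]; positivity
  have hXc : Continuous fun y : EuclideanSpace ℝ (Fin N) => (‖y‖ ^ 2) ^ κ :=
    (continuous_norm.pow 2).rpow_const fun _ => Or.inr hκ.le
  have hne : ∀ y : EuclideanSpace ℝ (Fin N), ε ≤ (‖y‖ ^ 2) ^ κ → y ≠ 0 := by
    rintro y hy rfl
    rw [norm_zero, zero_pow two_ne_zero, Real.zero_rpow hκ.ne'] at hy
    linarith
  have hbc : Continuous (barrier c κ ε p : EuclideanSpace ℝ (Fin N) → ℝ) :=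
    continuous_const.mul ((hXc.sub continuous_const).rpow_const fun _ => Or.inr hp0.le)
  set S : Set (EuclideanSpace ℝ (Fin N)) :=
    Metric.closedBall 0 R ∩ {y | ε ≤ (‖y‖ ^ 2) ^ κ} with hS
  have hSc : IsCompact S :=
    (isCompact_closedBall _ _).inter_right (isClosed_le continuous_const hXc)
  have hSΩ : S ⊆ Ω \ {0} := fun y hy => ⟨hRΩ hy.1, hne y hy.2⟩
  have hxS : x ∈ S := ⟨by simpa using hxR, hxε.le⟩
  obtain ⟨x₁, hx₁, hmax⟩ := hSc.exists_isMaxOn ⟨x, hxS⟩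
    (hbc.continuousOn.div (hu.1.1.continuousOn.mono hSΩ) fun y hy => (hu.1.2 y (hSΩ hy)).ne')
  by_contra! hlt
  have hux := hu.1.2 x (hSΩ hxS)
  have hux₁ := hu.1.2 x₁ (hSΩ hx₁)
  set k := barrier c κ ε p x₁ / u x₁ with hk
  have hmaxk : ∀ y ∈ S, barrier c κ ε p y / u y ≤ k := fun y hy => isMaxOn_iff.1 hmax y hy
  have hk1 : 1 < k := ((one_lt_div hux).2 hlt).trans_le (hmaxk x hxS)
  have hk0 : 0 < k := by linarith
  have hb₁ : u x₁ < barrier c κ ε p x₁ := (one_lt_div hux₁).1 hk1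
  have hR₁ : ‖x₁‖ ≤ R := by simpa using hx₁.1
  have hε₁ : ε < (‖x₁‖ ^ 2) ^ κ := by
    refine lt_of_le_of_ne hx₁.2 fun h => ?_
    rw [barrier, ← h, sub_self, Real.zero_rpow hp0.ne', mul_zero] at hb₁
    linarith
  have hn₁ : 0 < ‖x₁‖ := norm_pos_iff.2 (hne x₁ hε₁.le)
  have hpow : ((‖x₁‖ ^ 2) ^ κ - ε) ^ p ≤ ‖x₁‖ ^ m := by
    have h1 : ((‖x₁‖ ^ 2) ^ κ) ^ p = ‖x₁‖ ^ m := by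
      rw [← hmκ, Real.rpow_mul hn₁.le, Real.rpow_mul hn₁.le, Real.rpow_two]
    rw [← h1]
    exact Real.rpow_le_rpow (by linarith) (by linarith) hp0.le
  have hlt₁ : ‖x₁‖ < R := by
    refine lt_of_le_of_ne hR₁ fun h => ?_
    have h1 := hsphere x₁ (by simpa using h)
    have h2 : ‖x₁‖ ^ m ≤ 1 := Real.rpow_le_one hn₁.le (hR₁.trans hR1) hm.le
    have h3 := mul_le_mul_of_nonneg_left (hpow.trans h2) hc.le
    rw [barrier] at hb₁
    linarith
  have hck : 0 < c / k := by positivity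
  have hckc : c / k ≤ c := div_le_self hc.le hk1.le
  have hscale : ∀ y : EuclideanSpace ℝ (Fin N),
      barrier (c / k) κ ε p y = barrier c κ ε p y / k := fun y => by
    simp only [barrier]
    ring
  set U : Set (EuclideanSpace ℝ (Fin N)) :=
    Metric.ball 0 R ∩ {y | ε < (‖y‖ ^ 2) ^ κ} with hU
  have hUo : IsOpen U := Metric.isOpen_ball.inter (isOpen_lt continuous_const hXc)
  have hUS : U ⊆ S := fun y hy =>
    ⟨Metric.ball_subset_closedBall hy.1, hy.2.out.le⟩
  have hUne : ∀ y ∈ U, y ≠ 0 := fun y hy => hne y (le_of_lt hy.2)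
  have htouch := hu.divergenceE_le_of_touching hτ1 hΩ hUo (hUS.trans hSΩ)
    (W := barrier (c / k) κ ε p)
    (Z := fun y => barrierSlope (c / k) κ ε p (‖y‖ ^ 2) • y) (x₀ := x₁)
    ⟨by simpa using hlt₁, hε₁⟩
    (fun y hy => (contDiffAt_barrier (hUne y hy) hy.2).contDiffWithinAt)
    (fun y hy => (contDiffAt_barrierSlope_smul (hUne y hy) hy.2).contDiffWithinAt)
    (fun y hy => hasGradientAt_barrier (hUne y hy) hy.2)
    (fun y hy => by
      rw [hscale, div_le_comm₀ hk0 (hu.1.2 y (hSΩ (hUS hy)))]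
      exact hmaxk y (hUS hy))
    (by rw [hscale, hk, div_div_cancel₀ (hux₁.trans hb₁).ne'])
  refine htouch.not_gt (lowerOrder_barrier_lt (hne x₁ hε₁.le) hε0 hε₁ hck hδ hm hκ hp hmκ hgrow ?_)
  refine lt_of_le_of_lt ?_ hcq
  have hY : 0 ≤ ((‖x₁‖ ^ 2) ^ κ - ε) ^ p := Real.rpow_nonneg (by linarith) _
  have h1 : barrier (c / k) κ ε p x₁ ≤ c * ‖x₁‖ ^ m :=
    mul_le_mul hckc hpow hY hc.le
  have h2 : barrier (c / k) κ ε p x₁ ^ (q - 1) ≤ (c * ‖x₁‖ ^ m) ^ (q - 1) :=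
    Real.rpow_le_rpow (mul_nonneg hck.le hY) h1 (by linarith)
  rw [Real.mul_rpow hc.le (by positivity), ← Real.rpow_mul hn₁.le] at h2
  have h3 := mul_le_mul_of_nonneg_left h2 (Real.rpow_nonneg hn₁.le (θ + 2))
  have h4 : ‖x₁‖ ^ (θ + 2) * (c ^ (q - 1) * ‖x₁‖ ^ (m * (q - 1)))
      = c ^ (q - 1) * ‖x₁‖ ^ (θ + 2 + m * (q - 1)) := by
    rw [Real.rpow_add hn₁ (θ + 2) (m * (q - 1)), mul_left_comm]
  have h5 : ‖x₁‖ ^ (θ + 2 + m * (q - 1)) ≤ 1 :=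
    Real.rpow_le_one hn₁.le (hR₁.trans hR1) hexp
  rw [h4] at h3
  exact h3.trans (mul_le_of_le_one_right (Real.rpow_nonneg hc.le _) h5)

/-- Near the origin a super-solution is bounded below by a multiple of `|x|^m`. -/
theorem IsSuperSolutionE.exists_mul_rpow_le {N : ℕ} {ρ lam τ θ q δ m : ℝ}
    {Ω : Set (EuclideanSpace ℝ (Fin N))} {u : EuclideanSpace ℝ (Fin N) → ℝ}
    (hτ1 : τ < 1) (hq : 1 < q) (hΩ : IsOpen Ω) (h0 : (0 : EuclideanSpace ℝ (Fin N)) ∈ Ω)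
    (hu : IsSuperSolutionE N ρ lam τ θ q Ω u) (hδ : 0 < δ) (hm : 0 < m)
    (hgrow : ∀ s, m ≤ s → δ * s ^ 2 ≤ s ^ 2 - 2 * ρ * s + lam * s ^ (1 - τ))
    (hexp : 0 ≤ θ + 2 + m * (q - 1)) :
    ∃ c > 0, ∃ R > 0, ∀ x : EuclideanSpace ℝ (Fin N), x ≠ 0 → ‖x‖ ≤ R →
      c * ‖x‖ ^ m ≤ u x := by
  obtain ⟨R₀, hR₀, hR₀Ω⟩ := Metric.nhds_basis_closedBall.mem_iff.1 (hΩ.mem_nhds h0)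
  set R := min R₀ 1 with hRdef
  have hR : 0 < R := lt_min hR₀ one_pos
  have hRΩ : Metric.closedBall (0 : EuclideanSpace ℝ (Fin N)) R ⊆ Ω :=
    (Metric.closedBall_subset_closedBall (min_le_left _ _)).trans hR₀Ω
  have hsΩ : Metric.sphere (0 : EuclideanSpace ℝ (Fin N)) R ⊆ Ω \ {0} := fun y hy =>
    ⟨hRΩ (Metric.sphere_subset_closedBall hy), fun h => by
      rw [Set.mem_singleton_iff.1 h, mem_sphere_zero_iff_norm, norm_zero] at hy
      linarith⟩
  obtain ⟨v, hv, hvu⟩ := (isCompact_sphere (0 : EuclideanSpace ℝ (Fin N)) R).exists_forall_le'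
    (hu.1.1.continuousOn.mono hsΩ) fun y hy => hu.1.2 y (hsΩ hy)
  set c := min (v / 2) ((δ / 4 * m ^ 2) ^ (1 / (q - 1))) with hcdef
  have hc : 0 < c := lt_min (by linarith) (by positivity)
  have hcq : c ^ (q - 1) < δ / 2 * m ^ 2 := by
    have h1 : c ^ (q - 1) ≤ ((δ / 4 * m ^ 2) ^ (1 / (q - 1))) ^ (q - 1) :=
      Real.rpow_le_rpow hc.le (min_le_right _ _) (by linarith)
    rw [← Real.rpow_mul (by positivity), one_div_mul_cancel (by linarith), Real.rpow_one] at h1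
    nlinarith [mul_pos hδ (pow_pos hm 2)]
  refine ⟨c, hc, R, hR, fun x hx hxR => ?_⟩
  set p := 2 / δ with hp
  have hp0 : 0 < p := by positivity
  set κ := m / (2 * p) with hκ
  have hκ0 : 0 < κ := by positivity
  have hmκ : 2 * κ * p = m := by
    rw [hκ]
    field_simp
  have hn : 0 < ‖x‖ := norm_pos_iff.2 hx
  have hX : 0 < (‖x‖ ^ 2) ^ κ := by positivity
  have hpow : ((‖x‖ ^ 2) ^ κ) ^ p = ‖x‖ ^ m := by
    rw [← hmκ, Real.rpow_mul hn.le, Real.rpow_mul hn.le, Real.rpow_two]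
  have hlim : Tendsto (fun ε : ℝ => barrier c κ ε p x) (𝓝[>] 0) (𝓝 (c * ‖x‖ ^ m)) := by
    have hcont : Continuous fun ε : ℝ => barrier c κ ε p x :=
      continuous_const.mul ((continuous_const.sub continuous_id).rpow_const
        fun _ => Or.inr hp0.le)
    have := (hcont.tendsto 0).mono_left (nhdsWithin_le_nhds (s := Set.Ioi 0))
    rwa [barrier, sub_zero, hpow] at this
  refine le_of_tendsto hlim ?_
  filter_upwards [Ioo_mem_nhdsGT hX] with ε hε
  exact hu.barrier_le hτ1 hq hΩ (min_le_right _ _) hRΩ hε.1 hc hδ hm hκ0 hp hmκ hgrow hexp hcq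
    (fun y hy => ((min_le_left _ _).trans_lt (by linarith)).trans_le (hvu y hy)) hxR hε.2

/-- Assume `β < 0`, `f_ρ(β) > 0`, and Case [N₀], [N₁] or [N₂] holds (in Case
[N₂] assume in addition `β < ϖ₁`). Then every positive super-solution `u` of (E) in
`Ω \ {0}` satisfies `|x|^{β-η} u(x) → ∞` as `|x| → 0` for every `η > 0`. -/
theorem stmt8_lower_growth
    (N : ℕ) (hN : 2 ≤ N) (ρ lam τ θ q : ℝ)
    (hτ0 : 0 ≤ τ) (hτ1 : τ < 1) (hq : 1 < q)
    (Ω : Set (EuclideanSpace ℝ (Fin N))) (hΩ : IsOpen Ω) (h0 : (0 : EuclideanSpace ℝ (Fin N)) ∈ Ω)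
    (hβneg : (θ + 2) / (q - 1) < 0)
    (hf : 0 < fRho ρ lam τ ((θ + 2) / (q - 1)))
    (hcase : CaseN0 ρ lam τ ∨ CaseN1 ρ lam τ ∨
      (CaseN2 ρ lam τ ∧ ∃ w1 : ℝ, IsMinNegRoot ρ lam τ w1 ∧ (θ + 2) / (q - 1) < w1))
    (u : EuclideanSpace ℝ (Fin N) → ℝ)
    (hu : IsSuperSolutionE N ρ lam τ θ q Ω u) :
    ∀ η : ℝ, 0 < η →
      Filter.Tendsto (fun x : EuclideanSpace ℝ (Fin N) => ‖x‖ ^ ((θ + 2) / (q - 1) - η) * u x)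
        (𝓝[≠] (0 : EuclideanSpace ℝ (Fin N))) atTop := by
  intro η hη
  set β := (θ + 2) / (q - 1) with hβ
  have hq1 : 0 < q - 1 := by linarith
  have hθ : θ + 2 = β * (q - 1) := by rw [hβ]; field_simp
  obtain ⟨δ, hδ, hgrow⟩ := exists_mul_sq_le_fRho ρ lam τ (-β) hτ0 hτ1 (by linarith)
    fun s hs => fRho_pos_of_le ρ lam τ β hτ1 hβneg hf hcase (-s) (by linarith)
  obtain ⟨c, hc, R, hR, hlow⟩ := hu.exists_mul_rpow_le (m := -β + η / 2) hτ1 hq hΩ h0 hδ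
    (by linarith) (fun s hs => hgrow s (by linarith)) (by rw [hθ]; nlinarith)
  have hlim : Tendsto (fun x : EuclideanSpace ℝ (Fin N) => c * ‖x‖ ^ (-(η / 2)))
      (𝓝[≠] 0) atTop :=
    ((tendsto_rpow_neg_nhdsGT_zero (by linarith)).comp tendsto_norm_nhdsNE_zero).const_mul_atTop hc
  refine tendsto_atTop_mono' _ ?_ hlim
  filter_upwards [self_mem_nhdsWithin,
    mem_nhdsWithin_of_mem_nhds (Metric.closedBall_mem_nhds 0 hR)] with x hx hxR
  have hn : 0 < ‖x‖ := norm_pos_iff.2 hx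
  have h1 := mul_le_mul_of_nonneg_left (hlow x hx (by simpa using hxR))
    (Real.rpow_nonneg hn.le (β - η))
  refine le_trans (le_of_eq ?_) h1
  rw [mul_left_comm, ← Real.rpow_add hn]
  congr 2
  ring

end
end
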